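/- arXiv:1203.6738 — 2 statements merged into one kernel-verified Lean document; each statement's English description precedes it below -/
import Mathlib

section
/- (Strichartz estimate at the scaling-critical exponent.) Let (n,k) be an admissible nonlinearity pair with k ≥ 2 and set p = (n+2)k. Then there exists C > 0 such that for every real N ≥ 1 and every finitely supported a : ℤⁿ → ℂ with supp a ⊆ {ξ ∈ ℤⁿ : |ξ| ≤ N}, one has ‖u_a‖_{L^p([0,2π]×[0,2π]ⁿ)} ≤ C · N^{n/2 − 1/k} · ‖a‖_{ℓ²}. -/
open MeasureTheory Real Finset

noncomputable section

/-- The free Schrödinger wave `u_a(t,x) = Σ_ξ a(ξ) e^{i(x·ξ − t|ξ|²)}` on the torus. -/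
def tWave (n : ℕ) (a : (Fin n → ℤ) →₀ ℂ) (t : ℝ) (x : Fin n → ℝ) : ℂ :=
  ∑ ξ ∈ a.support, a ξ *
    Complex.exp (Complex.I *
      (((∑ i, x i * (ξ i : ℝ)) - t * ∑ i, ((ξ i : ℝ)) ^ 2 : ℝ) : ℂ))

/-- The ℓ² norm of the Fourier coefficients. -/
def l2Norm (n : ℕ) (a : (Fin n → ℤ) →₀ ℂ) : ℝ :=
  Real.sqrt (∑ ξ ∈ a.support, ‖a ξ‖ ^ 2)

/-- Euclidean norm of a lattice point in `ℤⁿ`. -/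
def znorm (n : ℕ) (ξ : Fin n → ℤ) : ℝ :=
  Real.sqrt (∑ i, ((ξ i : ℝ)) ^ 2)

/-- The period box `[0,2π] × [0,2π]ⁿ`. -/
def stBox (n : ℕ) : Set (ℝ × (Fin n → ℝ)) :=
  Set.Icc 0 (2 * π) ×ˢ Set.univ.pi fun _ => Set.Icc 0 (2 * π)

/-- The `L^p` norm over the period box `[0,2π] × [0,2π]ⁿ`. -/
def boxLpNorm (n : ℕ) (p : ℝ) (f : ℝ → (Fin n → ℝ) → ℂ) : ℝ :=
  (∫ q in stBox n, ‖f q.1 q.2‖ ^ p) ^ (1 / p)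

end

/-- `(n,k)` is an admissible nonlinearity pair. -/
def AdmissibleNL (n k : ℕ) : Prop :=
  (n = 1 ∧ 3 ≤ k) ∨ ((n = 2 ∨ n = 3 ∨ n = 4) ∧ 2 ≤ k) ∨ (5 ≤ n ∧ 1 ≤ k)

/-- The absolute value of the two-variable Jacobi theta function, normalised so that its supremum
over the elliptic variable is invariant under the modular group. -/
noncomputable def thetaNorm (z τ : ℂ) : ℝ :=
  ‖jacobiTheta₂ z τ‖ * Real.exp (-π * z.im ^ 2 / τ.im) * τ.im ^ (1 / 4 : ℝ)

lemma thetaNorm_add_one (z τ : ℂ) : thetaNorm z (τ + 1) = thetaNorm (z + 1 / 2) τ := by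
  have h : jacobiTheta₂ z (τ + 1) = jacobiTheta₂ (z + 1 / 2) τ := by
    unfold jacobiTheta₂
    refine tsum_congr fun n => ?_
    unfold jacobiTheta₂_term
    obtain ⟨m, hm⟩ : ∃ m : ℤ, n ^ 2 = n + 2 * m := by
      obtain ⟨m, hm⟩ := (Int.even_mul_succ_self (n - 1))
      exact ⟨m, by linear_combination hm⟩
    have hm' : (n : ℂ) ^ 2 = n + 2 * m := by exact_mod_cast hm
    rw [Complex.exp_eq_exp_iff_exists_int]
    refine ⟨m, ?_⟩
    linear_combination (π * Complex.I) * hm'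
  have h2 : (z + 1 / 2 : ℂ).im = z.im := by simp
  have h3 : (τ + 1 : ℂ).im = τ.im := by simp
  rw [thetaNorm, thetaNorm, h, h2, h3]

lemma thetaNorm_neg_inv (z : ℂ) {τ : ℂ} (hτ : 0 < τ.im) :
    thetaNorm z τ = thetaNorm (z / τ) (-1 / τ) := by
  have hτ0 : τ ≠ 0 := by rintro rfl; simp at hτ
  have hn : 0 < Complex.normSq τ := Complex.normSq_pos.2 hτ0
  have him : (-1 / τ : ℂ).im = τ.im / Complex.normSq τ := by
    rw [neg_div, Complex.neg_im, one_div, Complex.inv_im]; ring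
  have h1 : ‖(-Complex.I * τ) ^ (1 / 2 : ℂ)‖ = Complex.normSq τ ^ (1 / 4 : ℝ) := by
    rw [Complex.norm_cpow_of_ne_zero (by simp [hτ0])]
    have e1 : (1 / 2 : ℂ).im = 0 := by simp
    have e2 : (1 / 2 : ℂ).re = 1 / 2 := by simp
    rw [e1, e2, mul_zero, Real.exp_zero, div_one, Complex.normSq_eq_norm_sq,
      ← Real.rpow_natCast, ← Real.rpow_mul (norm_nonneg _)]
    simp; norm_num
  have hexp : ‖Complex.exp (-π * Complex.I * z ^ 2 / τ)‖ * Real.exp (-π * z.im ^ 2 / τ.im) =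
      Real.exp (-π * (z / τ).im ^ 2 / (-1 / τ : ℂ).im) := by
    rw [Complex.norm_exp, ← Real.exp_add, him]
    congr 1
    have hy : τ.im ≠ 0 := hτ.ne'
    have e : (-π * Complex.I * z ^ 2 / τ : ℂ).re = π * (z ^ 2 / τ).im := by
      have : (-π * Complex.I * z ^ 2 / τ : ℂ) = ((-π : ℝ) : ℂ) * (Complex.I * (z ^ 2 / τ)) := by
        push_cast; ring
      rw [this, Complex.re_ofReal_mul, Complex.I_mul_re]; ring
    rw [e, Complex.div_im, Complex.div_im]
    have hn' : Complex.normSq τ ≠ 0 := hn.ne'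
    have hq : Complex.normSq τ = τ.re * τ.re + τ.im * τ.im := Complex.normSq_apply τ
    have s1 : (z ^ 2).re = z.re ^ 2 - z.im ^ 2 := by simp [sq]
    have s2 : (z ^ 2).im = 2 * z.re * z.im := by simp [sq]; ring
    rw [s1, s2]
    field_simp
    rw [hq]
    ring
  rw [thetaNorm, thetaNorm, jacobiTheta₂_functional_equation, norm_mul, norm_mul, norm_div, h1,
    ← hexp, him, Real.div_rpow hτ.le hn.le, norm_one]
  ring

lemma thetaNorm_le_iff_modular (g : Matrix.SpecialLinearGroup (Fin 2) ℤ) :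
    ∀ (τ : UpperHalfPlane) (M : ℝ), (∀ z, thetaNorm z (g • τ : UpperHalfPlane) ≤ M) ↔
      ∀ z, thetaNorm z τ ≤ M := by
  have hg : g ∈ Subgroup.closure {ModularGroup.S, ModularGroup.T} := by
    rw [SpecialLinearGroup.SL2Z_generators]; trivial
  have hS : ∀ (τ : UpperHalfPlane) (M : ℝ),
      (∀ z, thetaNorm z (ModularGroup.S • τ : UpperHalfPlane) ≤ M) ↔
      ∀ z, thetaNorm z τ ≤ M := by
    intro τ M
    have e : ((ModularGroup.S • τ : UpperHalfPlane) : ℂ) = -1 / τ := by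
      rw [UpperHalfPlane.modular_S_smul, UpperHalfPlane.coe_mk, inv_neg, neg_div, one_div]
    rw [e]
    constructor
    · intro h z
      rw [thetaNorm_neg_inv z τ.im_pos]
      exact h _
    · intro h z
      have := thetaNorm_neg_inv (z * τ) τ.im_pos
      rw [mul_div_cancel_right₀ _ τ.ne_zero] at this
      rw [← this]
      exact h _
  have hT : ∀ (τ : UpperHalfPlane) (M : ℝ),
      (∀ z, thetaNorm z (ModularGroup.T • τ : UpperHalfPlane) ≤ M) ↔
      ∀ z, thetaNorm z τ ≤ M := by
    intro τ M
    have e : ((ModularGroup.T • τ : UpperHalfPlane) : ℂ) = τ + 1 := by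
      rw [UpperHalfPlane.modular_T_smul, UpperHalfPlane.coe_vadd]; push_cast; ring
    rw [e]
    constructor
    · intro h z
      have := thetaNorm_add_one (z - 1 / 2) τ
      rw [sub_add_cancel] at this
      rw [← this]
      exact h _
    · intro h z
      rw [thetaNorm_add_one]
      exact h _
  induction hg using Subgroup.closure_induction with
  | mem x hx =>
    rcases hx with rfl | rfl
    · exact hS
    · exact hT
  | one => intro τ M; rw [one_smul]
  | mul x y _ _ hx hy => intro τ M; rw [mul_smul, hx, hy]
  | inv x _ hx => intro τ M; rw [← hx, smul_inv_smul]

lemma exists_thetaNorm_le_of_half_le_im :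
    ∃ C > 0, ∀ z τ : ℂ, 1 / 2 ≤ τ.im → thetaNorm z τ ≤ C * τ.im ^ (1 / 4 : ℝ) := by
  have hs : Summable fun n : ℤ => Real.exp (-(π / 4) * (n : ℝ) ^ 2) := by
    have h0 := (summable_jacobiTheta₂_term_iff 0 (Complex.I / 4)).2 (by simp)
    refine h0.norm.congr fun n => ?_
    rw [norm_jacobiTheta₂_term]
    simp; ring
  refine ⟨Real.exp (π / 8) * ∑' n : ℤ, Real.exp (-(π / 4) * (n : ℝ) ^ 2) + 1, ?_, ?_⟩
  · have : 0 ≤ ∑' n : ℤ, Real.exp (-(π / 4) * (n : ℝ) ^ 2) :=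
      tsum_nonneg (fun n : ℤ => (Real.exp_pos (-(π / 4) * (n : ℝ) ^ 2)).le)
    positivity
  intro z τ hτ
  have hy : 0 < τ.im := by linarith
  unfold thetaNorm
  refine mul_le_mul_of_nonneg_right ?_ (by positivity)
  have hsum := (hasSum_jacobiTheta₂_term z hy).summable.norm
  have key : ∀ n : ℤ, ‖jacobiTheta₂_term n z τ‖ * Real.exp (-π * z.im ^ 2 / τ.im) ≤
      Real.exp (π / 8) * Real.exp (-(π / 4) * ((n + round (z.im / τ.im) : ℤ) : ℝ) ^ 2) := by
    intro n
    rw [norm_jacobiTheta₂_term, ← Real.exp_add, ← Real.exp_add]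
    refine Real.exp_le_exp.2 ?_
    set β := z.im / τ.im with hβ
    have hz : z.im = β * τ.im := by rw [hβ]; field_simp
    have hr := abs_le.1 (abs_sub_round β)
    set m : ℤ := round β
    have e1 : -π * (n : ℝ) ^ 2 * τ.im - 2 * π * n * z.im + -π * z.im ^ 2 / τ.im =
        -(π * τ.im * ((n : ℝ) + β) ^ 2) := by
      rw [hz]; field_simp; ring
    rw [e1]
    push_cast
    have h2 : ((n : ℝ) + m) ^ 2 / 2 - 1 / 4 ≤ ((n : ℝ) + β) ^ 2 := by
      have h3 : (β - m) ^ 2 ≤ 1 / 4 := by nlinarith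
      nlinarith [sq_nonneg (((n : ℝ) + m) + 2 * (β - m))]
    have h4 : 1 / 2 * ((n : ℝ) + β) ^ 2 ≤ τ.im * ((n : ℝ) + β) ^ 2 := by gcongr
    nlinarith [Real.pi_pos]
  have hs' : Summable fun n : ℤ => Real.exp (π / 8) *
      Real.exp (-(π / 4) * ((n + round (z.im / τ.im) : ℤ) : ℝ) ^ 2) :=
    (hs.comp_injective (add_left_injective (round (z.im / τ.im)))).mul_left _
  calc ‖jacobiTheta₂ z τ‖ * Real.exp (-π * z.im ^ 2 / τ.im)
      ≤ (∑' n : ℤ, ‖jacobiTheta₂_term n z τ‖) * Real.exp (-π * z.im ^ 2 / τ.im) := by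
        gcongr; exact norm_tsum_le_tsum_norm hsum
    _ = ∑' n : ℤ, ‖jacobiTheta₂_term n z τ‖ * Real.exp (-π * z.im ^ 2 / τ.im) := by
        rw [tsum_mul_right]
    _ ≤ ∑' n : ℤ, Real.exp (π / 8) *
          Real.exp (-(π / 4) * ((n + round (z.im / τ.im) : ℤ) : ℝ) ^ 2) :=
        (hsum.mul_right _).tsum_le_tsum key hs'
    _ = Real.exp (π / 8) * ∑' n : ℤ, Real.exp (-(π / 4) * (n : ℝ) ^ 2) := by
        rw [tsum_mul_left]
        congr 1
        exact (Equiv.addRight (round (z.im / τ.im))).tsum_eq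
          (fun n : ℤ => Real.exp (-(π / 4) * (n : ℝ) ^ 2))
    _ ≤ _ := by linarith

/-- Weyl's bound for the Gaussian-weighted kernel of the one-dimensional periodic Schrödinger
equation, obtained from the modularity of the theta function. -/
lemma exists_norm_jacobiTheta₂_le :
    ∃ C > 0, ∀ τ : ℂ, 0 < τ.im → ∃ c d : ℤ, (c ≠ 0 ∨ d ≠ 0) ∧
      ∀ x : ℝ, ‖jacobiTheta₂ x τ‖ * ‖(c * τ + d : ℂ)‖ ^ (1 / 2 : ℝ) ≤ C := by
  obtain ⟨C, hC, h⟩ := exists_thetaNorm_le_of_half_le_im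
  refine ⟨C, hC, fun τ hτ => ?_⟩
  lift τ to UpperHalfPlane using hτ
  obtain ⟨g, hg⟩ := ModularGroup.exists_smul_mem_fd τ
  have him : 1 / 2 ≤ (g • τ : UpperHalfPlane).im := by
    have := ModularGroup.three_le_four_mul_im_sq_of_mem_fd hg
    have h0 := (g • τ : UpperHalfPlane).im_pos
    nlinarith
  have hb := (thetaNorm_le_iff_modular g τ (C * (g • τ : UpperHalfPlane).im ^ (1 / 4 : ℝ))).1
    (fun z => h z _ him)
  refine ⟨g 1 0, g 1 1, ?_, fun x => ?_⟩
  · by_contra! hcd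
    have := g.det_coe
    rw [Matrix.det_fin_two, hcd.1, hcd.2] at this
    simp at this
  have hx := hb x
  have hd : (0 : ℝ) < Complex.normSq (g 1 0 * τ + g 1 1 : ℂ) := by
    have := UpperHalfPlane.normSq_denom_pos (g : GL (Fin 2) ℝ) τ.im_ne_zero
    rwa [ModularGroup.denom_apply] at this
  rw [ModularGroup.im_smul_eq_div_normSq, ModularGroup.denom_apply, thetaNorm] at hx
  have hy : 0 < τ.im := τ.im_pos
  rw [Real.div_rpow hy.le hd.le] at hx
  have e : Complex.normSq (g 1 0 * τ + g 1 1 : ℂ) ^ (1 / 4 : ℝ) =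
      ‖(g 1 0 * τ + g 1 1 : ℂ)‖ ^ (1 / 2 : ℝ) := by
    rw [Complex.normSq_eq_norm_sq, ← Real.rpow_natCast, ← Real.rpow_mul (norm_nonneg _)]
    norm_num
  have hd' : 0 < ‖(g 1 0 * τ + g 1 1 : ℂ)‖ ^ (1 / 2 : ℝ) := by rw [← e]; positivity
  rw [e] at hx
  simp only [Complex.ofReal_im, ne_eq, OfNat.ofNat_ne_zero, not_false_eq_true, zero_pow, mul_zero,
    zero_div, Real.exp_zero, mul_one] at hx
  have hy4 : 0 < τ.im ^ (1 / 4 : ℝ) := by positivity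
  rw [mul_div_assoc', le_div_iff₀ hd'] at hx
  have hx' : τ.im ^ (1 / 4 : ℝ) *
      (‖jacobiTheta₂ x τ‖ * ‖(g 1 0 * τ + g 1 1 : ℂ)‖ ^ (1 / 2 : ℝ)) ≤
      τ.im ^ (1 / 4 : ℝ) * C := by
    calc _ = ‖jacobiTheta₂ x τ‖ * τ.im ^ (1 / 4 : ℝ) *
          ‖(g 1 0 * τ + g 1 1 : ℂ)‖ ^ (1 / 2 : ℝ) := by ring
      _ ≤ _ := by simpa [mul_comm] using hx
  exact le_of_mul_le_mul_left hx' hy4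

lemma exists_card_divisors_le_rpow {ε : ℝ} (hε : 0 < ε) :
    ∃ C > 0, ∀ n : ℕ, n ≠ 0 → ((n.divisors).card : ℝ) ≤ C * (n : ℝ) ^ ε := by
  set A : ℝ := 1 + 1 / (ε * Real.log 2) with hA
  have hl2 : 0 < Real.log 2 := Real.log_pos one_lt_two
  have hA1 : 1 ≤ A := by rw [hA]; have : 0 < 1 / (ε * Real.log 2) := by positivity
                         linarith
  obtain ⟨P, hP⟩ := exists_nat_ge ((2 : ℝ) ^ (1 / ε))
  refine ⟨A ^ P, by positivity, fun n hn => ?_⟩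
  have hfac : (n : ℝ) ^ ε = ∏ p ∈ n.primeFactors, ((p : ℝ) ^ (n.factorization p)) ^ ε := by
    rw [Real.finsetProd_rpow _ _ (fun i _ => by positivity)]
    congr 1
    conv_lhs => rw [← Nat.prod_factorization_pow_eq_self hn]
    simp [Finsupp.prod, Nat.cast_prod]
  have hsmall : ∏ p ∈ n.primeFactors, (if p < P then A else 1) ≤ A ^ P := by
    rw [← Finset.prod_filter, Finset.prod_const]
    refine pow_le_pow_right₀ hA1 ?_
    calc _ ≤ (Finset.range P).card := Finset.card_le_card (fun p hp => by
            simp only [Finset.mem_filter] at hp; simpa using hp.2)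
      _ = P := Finset.card_range P
  rw [Nat.card_divisors hn, hfac]
  push_cast
  calc ∏ p ∈ n.primeFactors, ((n.factorization p : ℝ) + 1)
      ≤ ∏ p ∈ n.primeFactors, ((if p < P then A else 1) *
          ((p : ℝ) ^ (n.factorization p)) ^ ε) := by
        refine Finset.prod_le_prod (fun i _ => by positivity) fun p hp => ?_
        have hp2 : (2 : ℝ) ≤ p := by exact_mod_cast (Nat.prime_of_mem_primeFactors hp).two_le
        have hp0 : (0 : ℝ) < p := by linarith
        set k := n.factorization p
        rw [← Real.rpow_natCast, ← Real.rpow_mul hp0.le, mul_comm (k : ℝ) ε]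
        split_ifs with h
        · have h1 : (2 : ℝ) ^ (ε * k) ≤ (p : ℝ) ^ (ε * k) := by gcongr
          have h2 : 1 + ε * k * Real.log 2 ≤ (2 : ℝ) ^ (ε * k) := by
            rw [Real.rpow_def_of_pos two_pos]
            have := Real.add_one_le_exp (Real.log 2 * (ε * k))
            linarith
          have h3 : (k : ℝ) = 1 / (ε * Real.log 2) * (ε * k * Real.log 2) := by field_simp
          have h4 : (0 : ℝ) ≤ ε * k * Real.log 2 := by positivity
          calc (k : ℝ) + 1 ≤ A * (1 + ε * k * Real.log 2) := by
                rw [hA]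
                have h5 : 0 < 1 / (ε * Real.log 2) := by positivity
                nlinarith
            _ ≤ A * (p : ℝ) ^ (ε * k) := by gcongr; linarith
        · have h1 : (2 : ℝ) ^ (1 / ε) ≤ p := hP.trans (by exact_mod_cast not_lt.1 h)
          have h2 : (2 : ℝ) ≤ (p : ℝ) ^ ε := by
            calc (2 : ℝ) = ((2 : ℝ) ^ (1 / ε)) ^ ε := by
                  rw [← Real.rpow_mul two_pos.le, one_div_mul_cancel hε.ne', Real.rpow_one]
              _ ≤ _ := by gcongr
          rw [one_mul, Real.rpow_mul hp0.le, Real.rpow_natCast]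
          calc (k : ℝ) + 1 ≤ 2 ^ k := by exact_mod_cast Nat.lt_two_pow_self
            _ ≤ _ := by gcongr
    _ = (∏ p ∈ n.primeFactors, (if p < P then A else 1)) *
          ∏ p ∈ n.primeFactors, ((p : ℝ) ^ (n.factorization p)) ^ ε := Finset.prod_mul_distrib
    _ ≤ _ := by gcongr

lemma card_le_of_mem_interval (s : Finset ℤ) (x X : ℝ) (hX : 0 ≤ X)
    (hs : ∀ a ∈ s, x ≤ a ∧ (a : ℝ) ≤ x + X) : (s.card : ℝ) ≤ X + 1 := by
  have hsub : s ⊆ Finset.Icc ⌈x⌉ ⌊x + X⌋ := fun a ha => by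
    rw [Finset.mem_Icc]
    exact ⟨Int.ceil_le.2 (hs a ha).1, Int.le_floor.2 (hs a ha).2⟩
  have h1 : (s.card : ℝ) ≤ ((⌊x + X⌋ + 1 - ⌈x⌉).toNat : ℝ) := by
    have := Finset.card_le_card hsub
    rw [Int.card_Icc] at this
    exact_mod_cast this
  refine h1.trans ?_
  have h2 : ((⌊x + X⌋ + 1 - ⌈x⌉).toNat : ℝ) = max ((⌊x + X⌋ + 1 - ⌈x⌉ : ℤ) : ℝ) 0 := by
    have : ((⌊x + X⌋ + 1 - ⌈x⌉).toNat : ℤ) = max (⌊x + X⌋ + 1 - ⌈x⌉) 0 := Int.toNat_eq_max _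
    exact_mod_cast congrArg (Int.cast : ℤ → ℝ) this
  rw [h2]
  refine max_le ?_ (by linarith)
  push_cast
  have := Int.floor_le (x + X)
  have := Int.le_ceil x
  linarith

lemma card_le_of_mem_interval_of_modEq (s : Finset ℤ) (x X : ℝ) (hX : 0 ≤ X) (b : ℕ) (hb : 0 < b)
    (hs : ∀ a ∈ s, x ≤ a ∧ (a : ℝ) ≤ x + X) (hmod : ∀ a ∈ s, ∀ a' ∈ s, (b : ℤ) ∣ a - a') :
    (s.card : ℝ) ≤ X / b + 1 := by
  have hb' : (0 : ℝ) < b := by exact_mod_cast hb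
  rcases s.eq_empty_or_nonempty with rfl | ⟨m, hm⟩
  · simp; positivity
  have hdiv : ∀ a ∈ s, a = m + b * ((a - m) / b) := fun a ha => by
    rw [Int.mul_ediv_cancel' (hmod a ha m hm)]; ring
  have hinj : Set.InjOn (fun a : ℤ => (a - m) / b) s := by
    intro a ha a' ha' h
    rw [hdiv a ha, hdiv a' ha']
    simp only at h
    rw [h]
  rw [← Finset.card_image_of_injOn hinj]
  refine card_le_of_mem_interval _ ((x - m) / b) (X / b) (by positivity) ?_
  intro c hc
  obtain ⟨a, ha, rfl⟩ := Finset.mem_image.1 hc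
  have h1 : (a : ℝ) = m + b * ((a - m) / b : ℤ) := by exact_mod_cast hdiv a ha
  have h2 := hs a ha
  rw [← add_div, div_le_iff₀ hb', le_div_iff₀ hb']
  constructor <;> linarith [h2.1, h2.2]

/-- The distance from a real number to the nearest integer. -/
noncomputable def distInt (x : ℝ) : ℝ := |x - round x|

lemma distInt_le (x : ℝ) (m : ℤ) : distInt x ≤ |x - m| := round_le x m

/-- If `h` has no good rational approximation with small denominator, then few multiples of `h`
are close to an integer. -/
lemma card_filter_distInt_mul_le (h : ℝ) (P : ℕ) (hP : 0 < P) {η D δ : ℝ} (hη : 0 ≤ η) (hD : 0 < D)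
    (hδ : 0 < δ) (hh : ∀ d : ℕ, 1 ≤ d → (d : ℝ) ≤ D → δ < distInt (d * h)) :
    (((Finset.Icc 1 P).filter fun L : ℕ => distInt (L * h) ≤ η).card : ℝ) ≤
      4 * η * P + 3 * P / D + 3 + 4 * D * η ^ 2 / δ + 6 * η / δ := by
  obtain ⟨r, hr1, hr2⟩ := Real.exists_rat_abs_sub_le_and_den_le h hP
  set d := r.den with hd
  set a := r.num with ha
  have hdpos : 0 < d := r.den_pos
  have hd0 : (0 : ℝ) < d := by exact_mod_cast hdpos
  have hP0 : (0 : ℝ) < P := by exact_mod_cast hP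
  have hdP : (d : ℝ) ≤ P := by exact_mod_cast hr2
  have hrr : (r : ℝ) = a / d := by
    rw [ha, hd]; exact_mod_cast (Rat.num_div_den r).symm
  set β : ℝ := h - a / d with hβ
  have hβ1 : |β| ≤ 1 / ((P + 1) * d) := by rw [hβ, ← hrr]; exact hr1
  set S := (Finset.Icc 1 P).filter fun L : ℕ => distInt (L * h) ≤ η with hS
  set f : ℕ → ℤ := fun L => L * a - round (L * h) * d with hf
  have hSmem : ∀ L ∈ S, (1 : ℝ) ≤ L ∧ (L : ℝ) ≤ P ∧ |(L : ℝ) * h - round (L * h)| ≤ η := by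
    intro L hL
    rw [hS, Finset.mem_filter, Finset.mem_Icc] at hL
    exact ⟨by exact_mod_cast hL.1.1, by exact_mod_cast hL.1.2, hL.2⟩
  have hfe : ∀ L : ℕ, (L : ℝ) * h - round (L * h) = (f L : ℝ) / d + L * β := by
    intro L
    rw [hf, hβ]
    push_cast
    field_simp
    ring
  have himg : ((S.image f).card : ℝ) ≤ 2 * d * η + 3 := by
    have := card_le_of_mem_interval (S.image f) (-(d * η + 1)) (2 * (d * η + 1)) (by positivity) ?_
    · linarith
    intro c hc
    obtain ⟨L, hL, rfl⟩ := Finset.mem_image.1 hc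
    obtain ⟨h1, h2, h3⟩ := hSmem L hL
    rw [hfe L] at h3
    have h4 : |(L : ℝ) * β| ≤ 1 / d := by
      rw [abs_mul, abs_of_nonneg (by positivity : (0 : ℝ) ≤ L)]
      calc (L : ℝ) * |β| ≤ (P + 1) * (1 / ((P + 1) * d)) := by gcongr; linarith
        _ = 1 / d := by field_simp
    have h5 : |(f L : ℝ) / d| ≤ η + 1 / d := by
      calc |(f L : ℝ) / d| = |((f L : ℝ) / d + L * β) - L * β| := by ring_nf
        _ ≤ _ := (abs_sub _ _).trans (add_le_add h3 h4)
    rw [abs_div, abs_of_pos hd0, div_le_iff₀ hd0] at h5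
    have h6 : (η + 1 / d) * d = d * η + 1 := by field_simp
    rw [h6] at h5
    have := abs_le.1 h5
    constructor <;> linarith
  have hfibmod : ∀ ρ : ℤ, ∀ L ∈ S.filter (fun L => f L = ρ), ∀ L' ∈ S.filter (fun L => f L = ρ),
      (d : ℤ) ∣ (L : ℤ) - L' := by
    intro ρ L hL L' hL'
    have e1 := (Finset.mem_filter.1 hL).2
    have e2 := (Finset.mem_filter.1 hL').2
    have e3 : ((L : ℤ) - L') * a = d * (round ((L : ℝ) * h) - round ((L' : ℝ) * h)) := by
      simp only [hf] at e1 e2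
      linear_combination e1 - e2
    have hcop : IsCoprime (d : ℤ) a := by
      rw [Int.isCoprime_iff_gcd_eq_one, Int.gcd_comm]
      exact r.reduced
    exact hcop.dvd_of_dvd_mul_right ⟨_, e3⟩
  have hfib : ∀ (x X : ℝ), 0 ≤ X → ∀ ρ : ℤ, (∀ L ∈ S.filter (fun L => f L = ρ),
      x ≤ (L : ℝ) ∧ (L : ℝ) ≤ x + X) → ((S.filter (fun L => f L = ρ)).card : ℝ) ≤ X / d + 1 := by
    intro x X hX ρ hx
    rw [← Finset.card_image_of_injective _ (Nat.cast_injective (R := ℤ))]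
    refine card_le_of_mem_interval_of_modEq _ x X hX d hdpos ?_ ?_
    · intro c hc
      obtain ⟨L, hL, rfl⟩ := Finset.mem_image.1 hc
      exact_mod_cast hx L hL
    · intro c hc c' hc'
      obtain ⟨L, hL, rfl⟩ := Finset.mem_image.1 hc
      obtain ⟨L', hL', rfl⟩ := Finset.mem_image.1 hc'
      exact hfibmod ρ L hL L' hL'
  have htot : ∀ Y : ℝ, (∀ ρ, ((S.filter (fun L => f L = ρ)).card : ℝ) ≤ Y) →
      (S.card : ℝ) ≤ (2 * d * η + 3) * Y := by
    intro Y hY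
    have hY0 : 0 ≤ Y := le_trans (by positivity) (hY 0)
    calc (S.card : ℝ) = ∑ ρ ∈ S.image f, ((S.filter (fun L => f L = ρ)).card : ℝ) := by
          exact_mod_cast Finset.card_eq_sum_card_image f S
      _ ≤ ∑ ρ ∈ S.image f, Y := Finset.sum_le_sum fun ρ _ => hY ρ
      _ = (S.image f).card * Y := by rw [Finset.sum_const, nsmul_eq_mul]
      _ ≤ _ := by gcongr
  rcases lt_or_ge D d with hc | hc
  · have h1 := htot (P / d + 1) fun ρ => hfib 0 P hP0.le ρ fun L hL => by
      have := hSmem L (Finset.mem_filter.1 hL).1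
      constructor <;> linarith [this.1, this.2.1]
    refine h1.trans ?_
    have e : (2 * d * η + 3) * ((P : ℝ) / d + 1) = 2 * η * P + 2 * (d * η) + 3 * (P / d) + 3 := by
      field_simp; ring
    have h2 : (d : ℝ) * η ≤ P * η := by gcongr
    have h3 : (P : ℝ) / d ≤ P / D := by gcongr
    have h4 : 0 ≤ 4 * D * η ^ 2 / δ := by positivity
    have h5 : 0 ≤ 6 * η / δ := by positivity
    have h6 : 3 * (P : ℝ) / D = 3 * (P / D) := by ring
    rw [e, h6]
    linarith
  · have hν : δ < d * |β| := by
      have h1 := hh d hdpos hc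
      have h2 := distInt_le (d * h) a
      have h3 : (d : ℝ) * h - a = d * β := by rw [hβ]; field_simp
      rw [h3, abs_mul, abs_of_pos hd0] at h2
      linarith
    have hβ0 : 0 < |β| := by
      by_contra! h0
      have : |β| = 0 := le_antisymm h0 (abs_nonneg _)
      rw [this, mul_zero] at hν
      linarith
    have h1 := htot (2 * η / δ + 1) fun ρ => by
      have h2 : ((S.filter (fun L => f L = ρ)).card : ℝ) ≤ (2 * η / |β|) / d + 1 := by
        refine hfib (-((ρ : ℝ) / d / β) - η / |β|) (2 * η / |β|) (by positivity) ρ fun L hL => ?_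
        have h3 := (hSmem L (Finset.mem_filter.1 hL).1).2.2
        rw [hfe, (Finset.mem_filter.1 hL).2] at h3
        have hb0 : β ≠ 0 := abs_pos.1 hβ0
        have h4 : |(L : ℝ) + (ρ : ℝ) / d / β| ≤ η / |β| := by
          rw [le_div_iff₀ hβ0, ← abs_mul]
          have : ((L : ℝ) + (ρ : ℝ) / d / β) * β = ρ / d + L * β := by field_simp; ring
          rwa [this]
        have h5 := abs_le.1 h4
        have h6 : 2 * η / |β| = 2 * (η / |β|) := by ring
        rw [h6]
        constructor <;> linarith [h5.1, h5.2]
      refine h2.trans ?_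
      rw [div_div, mul_comm |β|]
      gcongr
    refine h1.trans ?_
    have e : (2 * d * η + 3) * (2 * η / δ + 1) =
        4 * d * η ^ 2 / δ + 6 * η / δ + 2 * (d * η) + 3 := by
      field_simp; ring
    have h2 : (d : ℝ) * η ≤ P * η := by gcongr
    have h3 : 4 * d * η ^ 2 / δ ≤ 4 * D * η ^ 2 / δ := by gcongr
    have h4 : 0 ≤ 3 * (P : ℝ) / D := by positivity
    have h5 : 0 ≤ P * η := by positivity
    rw [e]
    linarith

lemma measurable_distInt : Measurable distInt := by
  unfold distInt
  have h : Measurable fun x : ℝ => ((round x : ℤ) : ℝ) := by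
    have : (fun x : ℝ => ((round x : ℤ) : ℝ)) = fun x => ((⌊x + 1 / 2⌋ : ℤ) : ℝ) := by
      funext x; rw [round_eq]
    rw [this]
    exact measurable_from_top.comp (Int.measurable_floor.comp (measurable_id.add_const _))
  exact (measurable_id.sub h).abs

/-- The union of the major arcs around the rationals with denominators up to `Q`. -/
def majorArcs (Q δ : ℝ) : Set ℝ := {t | ∃ q : ℕ, 1 ≤ q ∧ (q : ℝ) ≤ Q ∧ distInt (q * t) ≤ δ}

lemma majorArcs_eq_biUnion (Q δ : ℝ) (hQ : 0 ≤ Q) :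
    majorArcs Q δ = ⋃ q ∈ Finset.Icc 1 ⌊Q⌋₊, {t : ℝ | distInt ((q : ℕ) * t) ≤ δ} := by
  ext t
  simp only [majorArcs, Set.mem_ofPred_eq, Set.mem_iUnion, Finset.mem_Icc, exists_prop]
  constructor
  · rintro ⟨q, h1, h2, h3⟩; exact ⟨q, ⟨h1, Nat.le_floor h2⟩, h3⟩
  · rintro ⟨q, ⟨h1, h2⟩, h3⟩; exact ⟨q, h1, (Nat.le_floor_iff hQ).1 h2, h3⟩

lemma measurableSet_majorArcs (Q δ : ℝ) : MeasurableSet (majorArcs Q δ) := by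
  have : majorArcs Q δ = ⋃ q : ℕ, {t : ℝ | 1 ≤ q ∧ (q : ℝ) ≤ Q ∧ distInt (q * t) ≤ δ} := by
    ext t; simp [majorArcs]
  rw [this]
  refine MeasurableSet.iUnion fun q => ?_
  by_cases hq : 1 ≤ q ∧ (q : ℝ) ≤ Q
  · have : {t : ℝ | 1 ≤ q ∧ (q : ℝ) ≤ Q ∧ distInt (q * t) ≤ δ} =
        {t : ℝ | distInt (q * t) ≤ δ} := by
      ext t; simp [hq.1, hq.2]
    rw [this]
    exact measurableSet_le (measurable_distInt.comp (measurable_id.const_mul _)) measurable_const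
  · have : {t : ℝ | 1 ≤ q ∧ (q : ℝ) ≤ Q ∧ distInt (q * t) ≤ δ} = ∅ := by
      ext t; simp only [Set.mem_ofPred_eq, Set.mem_empty_iff_false, iff_false]
      exact fun h => hq ⟨h.1, h.2.1⟩
    rw [this]; exact MeasurableSet.empty

lemma distInt_neg_le (x : ℝ) : distInt (-x) ≤ distInt x := by
  have := distInt_le (-x) (-round x)
  rwa [show -x - ((-round x : ℤ) : ℝ) = -(x - round x) by push_cast; ring, abs_neg] at this

lemma volume_biUnion_Icc_le (F : Finset ℤ) (q α δ M : ℝ) (hq : 0 < q) (hδ : 0 ≤ δ)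
    (hF : (F.card : ℝ) ≤ M) (S : Set ℝ)
    (hS : ∀ σ ∈ S, ∃ a ∈ F, |q * σ + α - a| ≤ δ) :
    volume S ≤ ENNReal.ofReal (M * (2 * δ / q)) := by
  have hsub : S ⊆ ⋃ a ∈ F, Set.Icc ((a - α - δ) / q) ((a - α + δ) / q) := by
    intro σ hσ
    obtain ⟨a, ha, h⟩ := hS σ hσ
    rw [Set.mem_iUnion₂]
    refine ⟨a, ha, ?_⟩
    have := abs_le.1 h
    rw [Set.mem_Icc, div_le_iff₀ hq, le_div_iff₀ hq]
    constructor <;> linarith [this.1, this.2]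
  calc volume S ≤ ∑ a ∈ F, volume (Set.Icc (((a : ℝ) - α - δ) / q) ((a - α + δ) / q)) :=
        (measure_mono hsub).trans (measure_biUnion_finset_le _ _)
    _ = ∑ a ∈ F, ENNReal.ofReal (2 * δ / q) := by
        refine Finset.sum_congr rfl fun a _ => ?_
        rw [Real.volume_Icc]
        congr 1
        ring
    _ = ENNReal.ofReal (F.card * (2 * δ / q)) := by
        rw [Finset.sum_const, nsmul_eq_mul, ENNReal.ofReal_mul (by positivity),
          ENNReal.ofReal_natCast]
    _ ≤ _ := by gcongr

lemma volume_majorArcs_le (Q δ : ℝ) (hQ : 0 ≤ Q) (hδ : 0 ≤ δ) :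
    volume (majorArcs Q δ ∩ Set.Icc (-2) 2) ≤ ENNReal.ofReal (12 * Q * δ) := by
  have hsub : majorArcs Q δ ∩ Set.Icc (-2) 2 ⊆
      ⋃ q ∈ Finset.Icc 1 ⌊Q⌋₊, ({t : ℝ | distInt ((q : ℕ) * t) ≤ δ} ∩ Set.Icc (-2) 2) := by
    rw [majorArcs_eq_biUnion Q δ hQ, Set.iUnion₂_inter]
  calc _ ≤ ∑ q ∈ Finset.Icc 1 ⌊Q⌋₊,
        volume ({t : ℝ | distInt ((q : ℕ) * t) ≤ δ} ∩ Set.Icc (-2) 2) :=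
        (measure_mono hsub).trans (measure_biUnion_finset_le _ _)
    _ ≤ ∑ q ∈ Finset.Icc 1 ⌊Q⌋₊, ENNReal.ofReal (12 * δ) := by
        refine Finset.sum_le_sum fun q hq => ?_
        have hq1 : 1 ≤ q := (Finset.mem_Icc.1 hq).1
        have hq0 : (1 : ℝ) ≤ q := by exact_mod_cast hq1
        have h1 := volume_biUnion_Icc_le (Finset.Icc ⌈-(2 * q + 1 / 2 : ℝ)⌉ ⌊(2 * q + 1 / 2 : ℝ)⌋)
          q 0 δ (4 * q + 2) (by linarith) hδ ?_
          ({t : ℝ | distInt ((q : ℕ) * t) ≤ δ} ∩ Set.Icc (-2) 2) ?_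
        · refine h1.trans (ENNReal.ofReal_le_ofReal ?_)
          rw [mul_div_assoc', div_le_iff₀ (by linarith)]
          nlinarith
        · have := card_le_of_mem_interval (Finset.Icc ⌈-(2 * q + 1 / 2 : ℝ)⌉ ⌊(2 * q + 1 / 2 : ℝ)⌋)
            (-(2 * q + 1 / 2 : ℝ)) (4 * q + 1) (by positivity) ?_
          · linarith
          · intro a ha
            rw [Finset.mem_Icc] at ha
            refine ⟨Int.ceil_le.1 ha.1, ?_⟩
            have := Int.le_floor.1 ha.2
            linarith
        · rintro σ ⟨h1, h2, h3⟩
          refine ⟨round ((q : ℝ) * σ), ?_, by rw [add_zero]; exact h1⟩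
          have h4 := abs_le.1 (abs_sub_round ((q : ℝ) * σ))
          have h5 : (q : ℝ) * σ ≤ 2 * q := by nlinarith
          have h6 : -(2 * (q : ℝ)) ≤ q * σ := by nlinarith
          rw [Finset.mem_Icc]
          exact ⟨Int.ceil_le.2 (by linarith [h4.2]), Int.le_floor.2 (by linarith [h4.1])⟩
    _ = ENNReal.ofReal (⌊Q⌋₊ * (12 * δ)) := by
        rw [Finset.sum_const, nsmul_eq_mul, ENNReal.ofReal_mul (by positivity : (0 : ℝ) ≤ ⌊Q⌋₊),
          ENNReal.ofReal_natCast, Nat.card_Icc, Nat.add_sub_cancel]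
    _ ≤ _ := by
        refine ENNReal.ofReal_le_ofReal ?_
        have := Nat.floor_le hQ
        nlinarith

lemma lcm_eq_mul_div_gcd {q₁ q₂ g b₁ b₂ : ℕ} (h₁ : q₁ = g * b₁) (h₂ : q₂ = g * b₂)
    (hcop : Nat.Coprime b₁ b₂) : Nat.lcm q₁ q₂ = b₁ * q₂ := by
  rw [h₁, h₂, Nat.lcm_mul_left, hcop.lcm_eq_mul]
  ring

lemma volume_pair_arcs_le_of_le {q₁ q₂ g b₁ b₂ : ℕ} (hg : 0 < g) (hb₁ : 0 < b₁)
    (h₁ : q₁ = g * b₁) (hcop : Nat.Coprime b₁ b₂) (h₂ : q₂ = g * b₂)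
    (hle : b₂ ≤ b₁) (α β δ u : ℝ) (hδ : 0 ≤ δ) :
    volume {σ : ℝ | σ ∈ Set.Icc u (u + 4) ∧ distInt (q₁ * σ + α) ≤ δ ∧ distInt (q₂ * σ + β) ≤ δ} ≤
      ENNReal.ofReal (12 * δ * (4 * δ + 1 / b₁)) := by
  have hg0 : (1 : ℝ) ≤ g := by exact_mod_cast hg
  have hb0 : (1 : ℝ) ≤ b₁ := by exact_mod_cast hb₁
  have hb2 : (b₂ : ℝ) ≤ b₁ := by exact_mod_cast hle
  have hq1 : (q₁ : ℝ) = g * b₁ := by exact_mod_cast h₁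
  have hq2 : (q₂ : ℝ) = g * b₂ := by exact_mod_cast h₂
  have hq0 : (0 : ℝ) < q₁ := by rw [hq1]; positivity
  set W : ℝ := 2 * δ * b₁ with hW
  have hW0 : 0 ≤ W := by positivity
  classical
  set F : Finset ℤ := (Finset.Icc ⌈q₁ * u + α - 1 / 2⌉ ⌊q₁ * (u + 4) + α + 1 / 2⌋).filter
    (fun a => ∃ a' : ℤ, |((b₂ * a - b₁ * a' : ℤ) : ℝ) + (b₁ * β - b₂ * α)| ≤ W) with hF
  have hFmem : ∀ a ∈ F, q₁ * u + α - 1 / 2 ≤ a ∧ (a : ℝ) ≤ q₁ * u + α - 1 / 2 + (4 * q₁ + 1) := by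
    intro a ha
    rw [hF, Finset.mem_filter, Finset.mem_Icc] at ha
    refine ⟨Int.ceil_le.1 ha.1.1, ?_⟩
    have := Int.le_floor.1 ha.1.2
    linarith
  have hex : ∀ a : ℤ, ∃ a' : ℤ, a ∈ F →
      |((b₂ * a - b₁ * a' : ℤ) : ℝ) + (b₁ * β - b₂ * α)| ≤ W := by
    intro a
    by_cases ha : a ∈ F
    · obtain ⟨a', h⟩ := (Finset.mem_filter.1 ha).2
      exact ⟨a', fun _ => h⟩
    · exact ⟨0, fun h => absurd h ha⟩
  choose v hv using hex
  have hcard : (F.card : ℝ) ≤ (2 * W + 1) * (6 * g) := by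
    set f : ℤ → ℤ := fun a => b₂ * a - b₁ * v a with hf
    have himg : ((F.image f).card : ℝ) ≤ 2 * W + 1 := by
      refine card_le_of_mem_interval _ (-(b₁ * β - b₂ * α) - W) (2 * W) (by positivity) ?_
      intro c hc
      obtain ⟨a, ha, rfl⟩ := Finset.mem_image.1 hc
      have := abs_le.1 (hv a ha)
      constructor <;> linarith [this.1, this.2]
    have hfib : ∀ ρ, ((F.filter (fun a => f a = ρ)).card : ℝ) ≤ 6 * g := by
      intro ρ
      have := card_le_of_mem_interval_of_modEq (F.filter (fun a => f a = ρ))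
        (q₁ * u + α - 1 / 2) (4 * q₁ + 1) (by positivity) b₁ hb₁
        (fun a ha => hFmem a (Finset.mem_filter.1 ha).1) ?_
      · refine this.trans ?_
        rw [hq1]
        have e : (4 * ((g : ℝ) * b₁) + 1) / b₁ = 4 * g + 1 / b₁ := by field_simp
        have h1 : 1 / (b₁ : ℝ) ≤ 1 := by rw [div_le_one (by linarith)]; exact hb0
        rw [e]; linarith
      · intro a ha a' ha'
        have e1 := (Finset.mem_filter.1 ha).2
        have e2 := (Finset.mem_filter.1 ha').2
        have e3 : (b₂ : ℤ) * (a - a') = b₁ * (v a - v a') := by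
          simp only [hf] at e1 e2
          linear_combination e1 - e2
        exact (Nat.isCoprime_iff_coprime.2 hcop).dvd_of_dvd_mul_left ⟨_, e3⟩
    calc (F.card : ℝ) = ∑ ρ ∈ F.image f, ((F.filter (fun a => f a = ρ)).card : ℝ) := by
          exact_mod_cast Finset.card_eq_sum_card_image f F
      _ ≤ ∑ ρ ∈ F.image f, (6 * g : ℝ) := Finset.sum_le_sum fun ρ _ => hfib ρ
      _ = (F.image f).card * (6 * g) := by rw [Finset.sum_const, nsmul_eq_mul]
      _ ≤ _ := by gcongr
  have hvol := volume_biUnion_Icc_le F q₁ α δ _ hq0 hδ hcard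
    {σ : ℝ | σ ∈ Set.Icc u (u + 4) ∧ distInt (q₁ * σ + α) ≤ δ ∧ distInt (q₂ * σ + β) ≤ δ} ?_
  · refine hvol.trans (ENNReal.ofReal_le_ofReal (le_of_eq ?_))
    rw [hq1, hW]
    field_simp
    ring
  · rintro σ ⟨⟨hu1, hu2⟩, h3, h4⟩
    refine ⟨round (q₁ * σ + α), ?_, h3⟩
    have h5 := abs_le.1 (abs_sub_round (q₁ * σ + α))
    rw [hF, Finset.mem_filter, Finset.mem_Icc]
    have h6 : q₁ * u ≤ q₁ * σ := by gcongr
    have h7 : q₁ * σ ≤ q₁ * (u + 4) := by gcongr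
    refine ⟨⟨Int.ceil_le.2 (by linarith [h5.2]), Int.le_floor.2 (by linarith [h5.1])⟩,
      round (q₂ * σ + β), ?_⟩
    set a := round (q₁ * σ + α)
    set a' := round (q₂ * σ + β)
    have e : ((b₂ * a - b₁ * a' : ℤ) : ℝ) + (b₁ * β - b₂ * α) =
        b₁ * (q₂ * σ + β - a') - b₂ * (q₁ * σ + α - a) := by
      rw [hq1, hq2]; push_cast; ring
    rw [e]
    calc _ ≤ |b₁ * (q₂ * σ + β - a')| + |b₂ * (q₁ * σ + α - a)| := abs_sub _ _
      _ = b₁ * |q₂ * σ + β - a'| + b₂ * |q₁ * σ + α - a| := by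
          rw [abs_mul, abs_mul, abs_of_nonneg (by positivity : (0 : ℝ) ≤ b₁),
            abs_of_nonneg (by positivity : (0 : ℝ) ≤ b₂)]
      _ ≤ b₁ * δ + b₁ * δ := by
          unfold distInt at h3 h4; gcongr
      _ = W := by rw [hW]; ring

/-- The set of simultaneous approximation by fractions with denominators `q₁` and `q₂`. -/
lemma volume_pair_arcs_le {q₁ q₂ : ℕ} (hq₁ : 0 < q₁) (hq₂ : 0 < q₂) (h δ u : ℝ) (hδ : 0 ≤ δ) :
    volume {σ : ℝ | σ ∈ Set.Icc u (u + 4) ∧ distInt (q₁ * σ) ≤ δ ∧ distInt (q₂ * (σ + h)) ≤ δ} ≤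
      if distInt (Nat.lcm q₁ q₂ * h) ≤ 2 * δ * ((max q₁ q₂ / Nat.gcd q₁ q₂ : ℕ) : ℝ) then
        ENNReal.ofReal (12 * δ * (4 * δ + 1 / ((max q₁ q₂ / Nat.gcd q₁ q₂ : ℕ) : ℝ))) else 0 := by
  obtain ⟨g, b₁, b₂, hg, hcop, h₁, h₂⟩ := Nat.exists_coprime' (m := q₁) (n := q₂)
    (Nat.gcd_pos_of_pos_left _ hq₁)
  rw [mul_comm] at h₁ h₂
  have hb₁ : 0 < b₁ := Nat.pos_of_mul_pos_left (h₁ ▸ hq₁)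
  have hb₂ : 0 < b₂ := Nat.pos_of_mul_pos_left (h₂ ▸ hq₂)
  have hgcd : Nat.gcd q₁ q₂ = g := by rw [h₁, h₂, Nat.gcd_mul_left, hcop.gcd_eq_one, mul_one]
  have hmax : max q₁ q₂ / Nat.gcd q₁ q₂ = max b₁ b₂ := by
    rw [hgcd, h₁, h₂, Nat.mul_max_mul_left, Nat.mul_div_cancel_left _ hg]
  rw [hmax]
  have hlcm := lcm_eq_mul_div_gcd h₁ h₂ hcop
  split_ifs with hc
  · have hset : {σ : ℝ | σ ∈ Set.Icc u (u + 4) ∧ distInt (q₁ * σ) ≤ δ ∧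
        distInt (q₂ * (σ + h)) ≤ δ} = {σ : ℝ | σ ∈ Set.Icc u (u + 4) ∧
          distInt (q₁ * σ + 0) ≤ δ ∧ distInt (q₂ * σ + q₂ * h) ≤ δ} := by
      simp only [add_zero, mul_add]
    rw [hset]
    rcases le_total b₂ b₁ with hle | hle
    · rw [max_eq_left hle]
      exact volume_pair_arcs_le_of_le hg hb₁ h₁ hcop h₂ hle 0 _ δ u hδ
    · rw [max_eq_right hle]
      refine le_trans (measure_mono ?_)
        (volume_pair_arcs_le_of_le hg hb₂ h₂ hcop.symm h₁ hle (q₂ * h) 0 δ u hδ)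
      rintro σ ⟨h1, h2, h3⟩
      exact ⟨h1, h3, h2⟩
  · refine le_of_eq ?_
    have : {σ : ℝ | σ ∈ Set.Icc u (u + 4) ∧ distInt (q₁ * σ) ≤ δ ∧
        distInt (q₂ * (σ + h)) ≤ δ} = ∅ := by
      rw [Set.eq_empty_iff_forall_notMem]
      rintro σ ⟨-, h3, h4⟩
      apply hc
      have e := distInt_le (Nat.lcm q₁ q₂ * h)
        (b₁ * round (q₂ * (σ + h)) - b₂ * round (q₁ * σ))
      refine e.trans ?_
      have hq1 : (q₁ : ℝ) = g * b₁ := by exact_mod_cast h₁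
      have hq2 : (q₂ : ℝ) = g * b₂ := by exact_mod_cast h₂
      have e2 : (Nat.lcm q₁ q₂ * h : ℝ) -
          ((b₁ * round (q₂ * (σ + h)) - b₂ * round (q₁ * σ) : ℤ) : ℝ) =
          b₁ * (q₂ * (σ + h) - round (q₂ * (σ + h))) - b₂ * (q₁ * σ - round (q₁ * σ)) := by
        rw [hlcm]; push_cast; rw [hq1, hq2]; ring
      rw [e2]
      unfold distInt at h3 h4
      have hm1 : (b₁ : ℝ) ≤ (max b₁ b₂ : ℕ) := by exact_mod_cast le_max_left _ _
      have hm2 : (b₂ : ℝ) ≤ (max b₁ b₂ : ℕ) := by exact_mod_cast le_max_right _ _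
      calc _ ≤ |(b₁ : ℝ) * (q₂ * (σ + h) - round (q₂ * (σ + h)))| +
            |(b₂ : ℝ) * (q₁ * σ - round (q₁ * σ))| := abs_sub _ _
        _ = b₁ * |q₂ * (σ + h) - round (q₂ * (σ + h))| + b₂ * |q₁ * σ - round (q₁ * σ)| := by
            rw [abs_mul, abs_mul, abs_of_nonneg (by positivity : (0 : ℝ) ≤ b₁),
              abs_of_nonneg (by positivity : (0 : ℝ) ≤ b₂)]
        _ ≤ (max b₁ b₂ : ℕ) * δ + (max b₁ b₂ : ℕ) * δ := by gcongr
        _ = _ := by ring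
    rw [this, measure_empty]

lemma log_maxDivGcd_spec {m q₁ q₂ : ℕ} (h₁ : q₁ ∈ Finset.Icc 1 m) (h₂ : q₂ ∈ Finset.Icc 1 m) :
    0 < max q₁ q₂ / Nat.gcd q₁ q₂ ∧ max q₁ q₂ / Nat.gcd q₁ q₂ ≤ m ∧
      Nat.lcm q₁ q₂ ≤ m * (max q₁ q₂ / Nat.gcd q₁ q₂) ∧ Nat.lcm q₁ q₂ ≤ m * m ∧
      0 < Nat.lcm q₁ q₂ := by
  rw [Finset.mem_Icc] at h₁ h₂
  have hgpos : 0 < Nat.gcd q₁ q₂ := Nat.gcd_pos_of_pos_left _ h₁.1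
  have hb : max q₁ q₂ / Nat.gcd q₁ q₂ ≤ m := (Nat.div_le_self _ _).trans (max_le h₁.2 h₂.2)
  have hd : Nat.gcd q₁ q₂ ∣ max q₁ q₂ := by
    rcases max_choice q₁ q₂ with h | h <;> rw [h]
    · exact Nat.gcd_dvd_left _ _
    · exact Nat.gcd_dvd_right _ _
  have hmaxpos : 0 < max q₁ q₂ := lt_max_of_lt_left h₁.1
  have hl : Nat.lcm q₁ q₂ ≤ m * (max q₁ q₂ / Nat.gcd q₁ q₂) := by
    have e : Nat.lcm q₁ q₂ = min q₁ q₂ * (max q₁ q₂ / Nat.gcd q₁ q₂) := by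
      rw [← Nat.mul_div_assoc _ hd, min_mul_max]; rfl
    rw [e]
    exact Nat.mul_le_mul_right _ ((min_le_left _ _).trans h₁.2)
  exact ⟨Nat.div_pos (Nat.le_of_dvd hmaxpos hd) hgpos, hb, hl,
    hl.trans (Nat.mul_le_mul_left _ hb), Nat.lcm_pos h₁.1 h₂.1⟩

lemma card_filter_log_distInt_le (m j K : ℕ)
    (hK : ∀ L : ℕ, L ≠ 0 → L ≤ m * m → (L.divisors).card ≤ K) (h δ : ℝ) (hδ : 0 ≤ δ) :
    (((Finset.Icc 1 m ×ˢ Finset.Icc 1 m).filter fun q : ℕ × ℕ =>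
      Nat.log 2 (max q.1 q.2 / Nat.gcd q.1 q.2) = j ∧ distInt (Nat.lcm q.1 q.2 * h) ≤
        2 * δ * ((max q.1 q.2 / Nat.gcd q.1 q.2 : ℕ) : ℝ)).card) ≤
      K ^ 2 * ((Finset.Icc 1 (m * 2 ^ (j + 1))).filter fun L : ℕ =>
        distInt (L * h) ≤ 2 * δ * 2 ^ (j + 1)).card := by
  refine Finset.card_le_mul_card_image_of_maps_to (f := fun q : ℕ × ℕ => Nat.lcm q.1 q.2) ?_ _ ?_
  · rintro ⟨q₁, q₂⟩ hq
    simp only [Finset.mem_filter, Finset.mem_product] at hq ⊢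
    obtain ⟨⟨h1, h2⟩, hj, hd⟩ := hq
    obtain ⟨hb0, hbm, hl, hl2, hl0⟩ := log_maxDivGcd_spec h1 h2
    have hb2 : max q₁ q₂ / Nat.gcd q₁ q₂ ≤ 2 ^ (j + 1) := by
      rw [← hj]; exact (Nat.lt_pow_succ_log_self one_lt_two _).le
    refine ⟨Finset.mem_Icc.2 ⟨hl0, hl.trans (Nat.mul_le_mul_left _ hb2)⟩, hd.trans ?_⟩
    have : ((max q₁ q₂ / Nat.gcd q₁ q₂ : ℕ) : ℝ) ≤ 2 ^ (j + 1) := by exact_mod_cast hb2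
    gcongr
  · intro L _
    by_cases hL : L ≠ 0 ∧ L ≤ m * m
    · refine (Finset.card_le_card (t := L.divisors ×ˢ L.divisors) ?_).trans ?_
      · rintro ⟨q₁, q₂⟩ hq
        simp only [Finset.mem_filter, Finset.mem_product, Nat.mem_divisors] at hq ⊢
        rw [← hq.2]
        have := hL.1; rw [← hq.2] at this
        exact ⟨⟨Nat.dvd_lcm_left _ _, this⟩, Nat.dvd_lcm_right _ _, this⟩
      · rw [Finset.card_product, sq]
        exact Nat.mul_le_mul (hK L hL.1 hL.2) (hK L hL.1 hL.2)
    · refine le_trans (le_of_eq ?_) (Nat.zero_le _)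
      rw [Finset.card_eq_zero, Finset.eq_empty_iff_forall_notMem]
      rintro ⟨q₁, q₂⟩ hq
      simp only [Finset.mem_filter, Finset.mem_product] at hq
      obtain ⟨⟨⟨h1, h2⟩, -, -⟩, he⟩ := hq
      obtain ⟨-, -, -, hl2, hl0⟩ := log_maxDivGcd_spec h1 h2
      exact hL ⟨by omega, by omega⟩

lemma sum_pair_arcs_le (m K : ℕ) (hm : 0 < m)
    (hK : ∀ L : ℕ, L ≠ 0 → L ≤ m * m → (L.divisors).card ≤ K) {h δ D : ℝ} (hδ : 0 < δ) (hD : 0 < D)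
    {Q : ℝ} (hmQ : (m : ℝ) ≤ Q) (hDQ : D ≤ Q)
    (hh : ∀ d : ℕ, 1 ≤ d → (d : ℝ) ≤ D → δ * D / Q < distInt (d * h)) :
    (∑ q ∈ Finset.Icc 1 m ×ˢ Finset.Icc 1 m,
      if distInt (Nat.lcm q.1 q.2 * h) ≤ 2 * δ * ((max q.1 q.2 / Nat.gcd q.1 q.2 : ℕ) : ℝ) then
        1 / ((max q.1 q.2 / Nat.gcd q.1 q.2 : ℕ) : ℝ) else 0) ≤
      (Nat.log 2 m + 1) * (K ^ 2 * (96 * δ * Q ^ 2 + 33 * (Q / D))) := by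
  have hm1 : (1 : ℝ) ≤ m := by exact_mod_cast hm
  have hQ : 0 < Q := by linarith
  have hmaps : ∀ q ∈ Finset.Icc 1 m ×ˢ Finset.Icc 1 m,
      Nat.log 2 (max q.1 q.2 / Nat.gcd q.1 q.2) ∈ Finset.range (Nat.log 2 m + 1) := by
    intro q hq
    rw [Finset.mem_product] at hq
    rw [Finset.mem_range, Nat.lt_succ_iff]
    exact Nat.log_mono_right (log_maxDivGcd_spec hq.1 hq.2).2.1
  rw [← Finset.sum_fiberwise_of_maps_to hmaps]
  have : ((Nat.log 2 m : ℝ) + 1) * (K ^ 2 * (96 * δ * Q ^ 2 + 33 * (Q / D))) =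
      ∑ j ∈ Finset.range (Nat.log 2 m + 1), (K ^ 2 * (96 * δ * Q ^ 2 + 33 * (Q / D)) : ℝ) := by
    rw [Finset.sum_const, Finset.card_range, nsmul_eq_mul]; push_cast; rfl
  rw [this]
  refine Finset.sum_le_sum fun j hj => ?_
  rw [Finset.mem_range, Nat.lt_succ_iff] at hj
  have h2j : (2 : ℝ) ^ j ≤ Q := by
    have : 2 ^ j ≤ m := (Nat.pow_le_pow_right two_pos hj).trans (Nat.pow_log_le_self 2 hm.ne')
    exact le_trans (by exact_mod_cast this) hmQ
  have hc := card_filter_log_distInt_le m j K hK h δ hδ.le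
  have hc2 := card_filter_distInt_mul_le h (m * 2 ^ (j + 1)) (by positivity)
    (η := 2 * δ * 2 ^ (j + 1)) (by positivity) hD (show 0 < δ * D / Q by positivity) hh
  rw [← Finset.sum_filter, Finset.filter_filter]
  have hx : (0 : ℝ) < 2 ^ j := by positivity
  calc _ ≤ ∑ q ∈ (Finset.Icc 1 m ×ˢ Finset.Icc 1 m).filter fun q : ℕ × ℕ =>
      Nat.log 2 (max q.1 q.2 / Nat.gcd q.1 q.2) = j ∧ distInt (Nat.lcm q.1 q.2 * h) ≤
        2 * δ * ((max q.1 q.2 / Nat.gcd q.1 q.2 : ℕ) : ℝ), (1 / 2 ^ j : ℝ) := by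
        refine Finset.sum_le_sum fun q hq => ?_
        simp only [Finset.mem_filter, Finset.mem_product] at hq
        obtain ⟨⟨h1, h2⟩, hj, -⟩ := hq
        refine one_div_le_one_div_of_le hx ?_
        have := Nat.pow_log_le_self 2 (log_maxDivGcd_spec h1 h2).1.ne'
        rw [hj] at this
        exact_mod_cast this
    _ ≤ (K ^ 2 * (4 * (2 * δ * 2 ^ (j + 1)) * (m * 2 ^ (j + 1) : ℕ) +
          3 * (m * 2 ^ (j + 1) : ℕ) / D + 3 + 4 * D * (2 * δ * 2 ^ (j + 1)) ^ 2 / (δ * D / Q) +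
          6 * (2 * δ * 2 ^ (j + 1)) / (δ * D / Q))) * (1 / 2 ^ j) := by
        rw [Finset.sum_const, nsmul_eq_mul]
        gcongr
        refine ((Nat.cast_le (α := ℝ)).2 hc).trans ?_
        rw [Nat.cast_mul, Nat.cast_pow]
        gcongr
    _ = K ^ 2 * (32 * δ * m * 2 ^ j + 6 * (m / D) + 3 / 2 ^ j + 64 * δ * Q * 2 ^ j +
          24 * (Q / D)) := by
        push_cast
        rw [pow_succ]
        field_simp
        ring
    _ ≤ _ := by
        refine mul_le_mul_of_nonneg_left ?_ (by positivity)
        have e1 : 32 * δ * m * 2 ^ j ≤ 32 * δ * Q * Q := by gcongr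
        have e2 : (m : ℝ) / D ≤ Q / D := by gcongr
        have e3 : 3 / (2 : ℝ) ^ j ≤ 3 := by
          rw [div_le_iff₀ hx]; nlinarith [one_le_pow₀ (one_le_two (α := ℝ)) (n := j)]
        have e4 : 1 ≤ Q / D := by rwa [one_le_div hD]
        have e5 : 64 * δ * Q * 2 ^ j ≤ 64 * δ * Q * Q := by gcongr
        nlinarith

/-- If `h` is not well approximable, then the major arcs and their translate by `-h` have
a small intersection. -/
lemma exists_volume_inter_majorArcs_le : ∃ C > 0, ∀ Q δ D h : ℝ, 1 ≤ Q → 0 < δ → 0 < D → D ≤ Q →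
    h ∉ majorArcs D (δ * D / Q) →
    volume {σ : ℝ | σ ∈ Set.Icc (-2) 2 ∧ σ ∈ majorArcs Q δ ∧ σ + h ∈ majorArcs Q δ} ≤
      ENNReal.ofReal (C * Q ^ (1 / 20 : ℝ) * (δ ^ 2 * Q ^ 2 + δ * Q / D)) := by
  obtain ⟨C₀, hC₀, hdiv⟩ := exists_card_divisors_le_rpow (ε := 1 / 200) (by norm_num)
  refine ⟨48 + 12 * 96 * (C₀ ^ 2 * 200), by positivity, fun Q δ D h hQ hδ hD hDQ hh => ?_⟩
  set m := ⌊Q⌋₊ with hmdef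
  have hm : 0 < m := Nat.floor_pos.2 hQ
  have hmQ : (m : ℝ) ≤ Q := Nat.floor_le (by linarith)
  have hm1 : (1 : ℝ) ≤ m := by exact_mod_cast hm
  set K := ⌊C₀ * Q ^ (1 / 100 : ℝ)⌋₊ with hKdef
  have hK : ∀ L : ℕ, L ≠ 0 → L ≤ m * m → (L.divisors).card ≤ K := by
    intro L hL hLm
    refine Nat.le_floor ((hdiv L hL).trans ?_)
    gcongr
    have : (L : ℝ) ≤ Q ^ (2 : ℝ) := by
      have h1 : (L : ℝ) ≤ m * m := by exact_mod_cast hLm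
      rw [Real.rpow_two]; nlinarith
    calc (L : ℝ) ^ (1 / 200 : ℝ) ≤ (Q ^ (2 : ℝ)) ^ (1 / 200 : ℝ) := by gcongr
      _ = _ := by rw [← Real.rpow_mul (by linarith)]; norm_num
  have hKle : (K : ℝ) ≤ C₀ * Q ^ (1 / 100 : ℝ) := Nat.floor_le (by positivity)
  have hsum := sum_pair_arcs_le m K hm hK hδ hD hmQ hDQ (h := h) (fun d h1 h2 => by
    by_contra hc; exact hh ⟨d, h1, h2, not_lt.1 hc⟩)
  have hlog : ((Nat.log 2 m : ℝ) + 1) ≤ 200 * Q ^ (1 / 100 : ℝ) := by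
    have e1 : (Nat.log 2 m : ℝ) * Real.log 2 ≤ Real.log m := by
      rw [← Real.log_rpow two_pos, Real.rpow_natCast]
      refine Real.log_le_log (by positivity) ?_
      exact_mod_cast Nat.pow_log_le_self 2 hm.ne'
    have e2 : Real.log m ≤ (m : ℝ) ^ (1 / 100 : ℝ) / (1 / 100) :=
      Real.log_le_rpow_div (by positivity) (by norm_num)
    have e3 : (m : ℝ) ^ (1 / 100 : ℝ) ≤ Q ^ (1 / 100 : ℝ) := by gcongr
    have e4 : 1 ≤ Q ^ (1 / 100 : ℝ) := Real.one_le_rpow hQ (by norm_num)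
    have := Real.log_two_gt_d9
    have e5 : (0 : ℝ) ≤ Nat.log 2 m := by positivity
    nlinarith
  calc _ ≤ volume (⋃ q ∈ Finset.Icc 1 m ×ˢ Finset.Icc 1 m, {σ : ℝ | σ ∈ Set.Icc (-2) (-2 + 4) ∧
        distInt (q.1 * σ) ≤ δ ∧ distInt (q.2 * (σ + h)) ≤ δ}) := by
        refine measure_mono ?_
        rintro σ ⟨h1, ⟨q₁, ha, hb, hc⟩, ⟨q₂, ha', hb', hc'⟩⟩
        rw [Set.mem_iUnion₂]
        refine ⟨(q₁, q₂), ?_, ?_, hc, hc'⟩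
        · rw [Finset.mem_product, Finset.mem_Icc, Finset.mem_Icc]
          exact ⟨⟨ha, Nat.le_floor hb⟩, ha', Nat.le_floor hb'⟩
        · norm_num; exact h1
    _ ≤ ∑ q ∈ Finset.Icc 1 m ×ˢ Finset.Icc 1 m, volume {σ : ℝ | σ ∈ Set.Icc (-2) (-2 + 4) ∧
        distInt (q.1 * σ) ≤ δ ∧ distInt (q.2 * (σ + h)) ≤ δ} := measure_biUnion_finset_le _ _
    _ ≤ ∑ q ∈ Finset.Icc 1 m ×ˢ Finset.Icc 1 m, ENNReal.ofReal (48 * δ ^ 2 + 12 * δ *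
        if distInt (Nat.lcm q.1 q.2 * h) ≤ 2 * δ * ((max q.1 q.2 / Nat.gcd q.1 q.2 : ℕ) : ℝ) then
        1 / ((max q.1 q.2 / Nat.gcd q.1 q.2 : ℕ) : ℝ) else 0) := by
        refine Finset.sum_le_sum fun q hq => ?_
        rw [Finset.mem_product, Finset.mem_Icc, Finset.mem_Icc] at hq
        refine (volume_pair_arcs_le hq.1.1 hq.2.1 h δ (-2) hδ.le).trans ?_
        split_ifs
        · refine ENNReal.ofReal_le_ofReal (le_of_eq ?_); ring
        · exact zero_le
    _ = ENNReal.ofReal (∑ q ∈ Finset.Icc 1 m ×ˢ Finset.Icc 1 m, (48 * δ ^ 2 + 12 * δ *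
        if distInt (Nat.lcm q.1 q.2 * h) ≤ 2 * δ * ((max q.1 q.2 / Nat.gcd q.1 q.2 : ℕ) : ℝ) then
        1 / ((max q.1 q.2 / Nat.gcd q.1 q.2 : ℕ) : ℝ) else 0)) := by
        rw [ENNReal.ofReal_sum_of_nonneg]
        intro q _
        split_ifs <;> positivity
    _ ≤ _ := by
        refine ENNReal.ofReal_le_ofReal ?_
        rw [Finset.sum_add_distrib, Finset.sum_const, Finset.card_product,
          Nat.card_Icc, Nat.add_sub_cancel, nsmul_eq_mul, ← Finset.mul_sum]
        set X := Q ^ (1 / 100 : ℝ) with hX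
        have hX1 : 1 ≤ X := Real.one_le_rpow hQ (by norm_num)
        have hX3 : X ^ 3 ≤ Q ^ (1 / 20 : ℝ) := by
          rw [hX, ← Real.rpow_natCast, ← Real.rpow_mul (by linarith)]
          exact Real.rpow_le_rpow_of_exponent_le hQ (by norm_num)
        have hY1 : 1 ≤ Q ^ (1 / 20 : ℝ) := Real.one_le_rpow hQ (by norm_num)
        have hA : 0 ≤ δ * Q / D := by positivity
        calc _ ≤ ((m * m : ℕ) : ℝ) * (48 * δ ^ 2) + 12 * δ * (200 * X * ((C₀ * X) ^ 2 *
              (96 * δ * Q ^ 2 + 33 * (Q / D)))) := by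
              gcongr
              refine hsum.trans ?_
              gcongr
          _ ≤ (Q * Q) * (48 * δ ^ 2) + 12 * δ * (200 * X * ((C₀ * X) ^ 2 *
              (96 * δ * Q ^ 2 + 96 * (Q / D)))) := by
              push_cast
              have : 0 ≤ Q / D := by positivity
              gcongr
              norm_num
          _ = 48 * (δ ^ 2 * Q ^ 2) + 12 * 96 * (C₀ ^ 2 * 200) * (X ^ 3) * (δ ^ 2 * Q ^ 2 +
              δ * Q / D) := by ring
          _ ≤ 48 * Q ^ (1 / 20 : ℝ) * (δ ^ 2 * Q ^ 2 + δ * Q / D) +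
              12 * 96 * (C₀ ^ 2 * 200) * Q ^ (1 / 20 : ℝ) * (δ ^ 2 * Q ^ 2 + δ * Q / D) := by
              have hB : 0 ≤ δ ^ 2 * Q ^ 2 := by positivity
              gcongr ?_ + ?_
              · nlinarith
              · gcongr
          _ = _ := by ring

lemma exists_norm_jacobiTheta₂_le_of_notMem_majorArcs : ∃ C > 0, ∀ N μ : ℝ, 0 < N → 0 < μ →
    C / μ ^ 2 ≤ 1 → ∀ t x : ℝ, t / π ∉ majorArcs (π * N ^ 2 * (C / μ ^ 2)) (C / μ ^ 2) →
    ‖jacobiTheta₂ ((x / (2 * π) : ℝ) : ℂ)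
      ((-(t / π) : ℝ) + (1 / (π * N ^ 2) : ℝ) * Complex.I)‖ ≤ μ := by
  obtain ⟨C, hC, hJ⟩ := exists_norm_jacobiTheta₂_le
  refine ⟨C ^ 2, by positivity, fun N μ hN hμ hδ t x ht => ?_⟩
  set τ : ℂ := (-(t / π) : ℝ) + (1 / (π * N ^ 2) : ℝ) * Complex.I with hτ
  have him : τ.im = 1 / (π * N ^ 2) := by
    rw [hτ, Complex.add_im, Complex.ofReal_im, Complex.im_ofReal_mul, Complex.I_im, mul_one,
      zero_add]
  have hre : τ.re = -(t / π) := by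
    rw [hτ, Complex.add_re, Complex.ofReal_re, Complex.re_ofReal_mul, Complex.I_re, mul_zero,
      add_zero]
  have hpos : 0 < π * N ^ 2 := by positivity
  obtain ⟨c, d, hcd, hb⟩ := hJ τ (by rw [him]; positivity)
  by_contra hlt
  push Not at hlt
  apply ht
  have hx := hb (x / (2 * π))
  set δ := C ^ 2 / μ ^ 2 with hδdef
  have hδ0 : 0 < δ := by positivity
  have hnorm : ‖(c * τ + d : ℂ)‖ < δ := by
    set y := ‖(c * τ + d : ℂ)‖ with hy
    have hy0 : 0 ≤ y := norm_nonneg _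
    by_contra hyd
    push Not at hyd
    have h1 : C / μ ≤ y ^ (1 / 2 : ℝ) := by
      rw [← Real.sqrt_eq_rpow]
      apply Real.le_sqrt_of_sq_le
      rw [div_pow]; exact hyd
    have h2 : C = μ * (C / μ) := by field_simp
    have h3 : 0 < C / μ := by positivity
    have : μ * (C / μ) < ‖jacobiTheta₂ ((x / (2 * π) : ℝ) : ℂ) τ‖ * y ^ (1 / 2 : ℝ) := by
      calc _ < ‖jacobiTheta₂ ((x / (2 * π) : ℝ) : ℂ) τ‖ * (C / μ) := by gcongr
        _ ≤ _ := by gcongr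
    linarith
  have hrec : |(c : ℝ) * (t / π) - d| < δ := by
    have h := (Complex.abs_re_le_norm (c * τ + d : ℂ)).trans_lt hnorm
    have e : (c * τ + d : ℂ).re = -(c * (t / π) - d) := by
      simp [hre]; ring
    rwa [e, abs_neg] at h
  have himc : |(c : ℝ)| < π * N ^ 2 * δ := by
    have h := (Complex.abs_im_le_norm (c * τ + d : ℂ)).trans_lt hnorm
    have e : (c * τ + d : ℂ).im = c * (1 / (π * N ^ 2)) := by
      simp [him]
    rw [e, abs_mul, abs_of_pos (show 0 < 1 / (π * N ^ 2) by positivity), mul_one_div,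
      div_lt_iff₀ hpos] at h
    linarith
  have hc : c ≠ 0 := by
    rintro rfl
    have hd : d ≠ 0 := by simpa using hcd
    have h1 : (1 : ℝ) ≤ |(d : ℝ)| := by exact_mod_cast Int.one_le_abs hd
    simp only [Int.cast_zero, zero_mul, zero_sub, abs_neg] at hrec
    linarith
  refine ⟨c.natAbs, Int.natAbs_pos.2 hc, ?_, ?_⟩
  · rw [Nat.cast_natAbs, Int.cast_abs]; exact himc.le
  · rw [Nat.cast_natAbs, Int.cast_abs]
    rcases abs_choice (c : ℝ) with h | h <;> rw [h]
    · exact (distInt_le _ d).trans hrec.le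
    · rw [neg_mul]
      exact (distInt_neg_le _).trans ((distInt_le _ d).trans hrec.le)

lemma summable_exp_neg_sq_div {N : ℝ} (hN : 0 < N) :
    Summable fun m : ℤ => Real.exp (-((m : ℝ) ^ 2 / N ^ 2)) := by
  have h := (summable_jacobiTheta₂_term_iff 0 (((1 / (π * N ^ 2) : ℝ) : ℂ) * Complex.I)).2 (by
    rw [Complex.im_ofReal_mul, Complex.I_im, mul_one]; positivity)
  refine h.norm.congr fun m => ?_
  rw [norm_jacobiTheta₂_term]
  rw [Complex.im_ofReal_mul, Complex.I_im, Complex.zero_im]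
  congr 1
  field_simp
  ring

lemma norm_gaussian_phase (N t x : ℝ) (m : ℤ) :
    ‖(Real.exp (-((m : ℝ) ^ 2 / N ^ 2)) : ℂ) *
      Complex.exp (Complex.I * (x * m - t * (m : ℝ) ^ 2 : ℝ))‖ =
      Real.exp (-((m : ℝ) ^ 2 / N ^ 2)) := by
  rw [norm_mul, mul_comm Complex.I, Complex.norm_exp_ofReal_mul_I, mul_one, Complex.norm_real,
    Real.norm_of_nonneg (Real.exp_pos _).le]

/-- The truncated Gaussian-regularised one-dimensional Schrödinger kernel is small away from
the major arcs. -/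
lemma exists_norm_gaussian_kernel_le : ∃ C > 0, ∀ N μ : ℝ, 0 < N → 0 < μ →
    C / μ ^ 2 ≤ 1 → ∃ M₀ : ℕ, ∀ M ≥ M₀, ∀ t x : ℝ,
      t / π ∉ majorArcs (π * N ^ 2 * (C / μ ^ 2)) (C / μ ^ 2) →
      ‖∑ m ∈ Finset.Icc (-(M : ℤ)) M, (Real.exp (-((m : ℝ) ^ 2 / N ^ 2)) : ℂ) *
        Complex.exp (Complex.I * (x * m - t * (m : ℝ) ^ 2 : ℝ))‖ ≤ 2 * μ := by
  obtain ⟨C, hC, hJ⟩ := exists_norm_jacobiTheta₂_le_of_notMem_majorArcs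
  refine ⟨C, hC, fun N μ hN hμ hδ => ?_⟩
  have hw := summable_exp_neg_sq_div hN
  have htail := tendsto_tsum_compl_atTop_zero fun m : ℤ => Real.exp (-((m : ℝ) ^ 2 / N ^ 2))
  obtain ⟨s₀, hs₀⟩ := Filter.eventually_atTop.1 (htail.eventually (gt_mem_nhds hμ))
  refine ⟨s₀.sup Int.natAbs, fun M hM t x ht => ?_⟩
  set s := Finset.Icc (-(M : ℤ)) M
  have hs : s₀ ⊆ s := fun m hm => by
    have h1 : m.natAbs ≤ M := (Finset.le_sup (f := Int.natAbs) hm).trans hM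
    rw [Finset.mem_Icc]; omega
  set f : ℤ → ℂ := fun m => (Real.exp (-((m : ℝ) ^ 2 / N ^ 2)) : ℂ) *
        Complex.exp (Complex.I * (x * m - t * (m : ℝ) ^ 2 : ℝ)) with hf
  have hnorm : ∀ m, ‖f m‖ = Real.exp (-((m : ℝ) ^ 2 / N ^ 2)) := norm_gaussian_phase N t x
  have hfs : Summable f := Summable.of_norm (hw.congr fun m => (hnorm m).symm)
  have hJe : jacobiTheta₂ ((x / (2 * π) : ℝ) : ℂ)
      ((-(t / π) : ℝ) + (1 / (π * N ^ 2) : ℝ) * Complex.I) = ∑' m, f m := by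
    refine tsum_congr fun m => ?_
    rw [jacobiTheta₂_term, hf]
    simp only [Complex.ofReal_exp]
    rw [← Complex.exp_add]
    congr 1
    have hpi : (π : ℂ) ≠ 0 := by exact_mod_cast Real.pi_ne_zero
    have hN' : (N : ℂ) ≠ 0 := by exact_mod_cast hN.ne'
    push_cast
    field_simp
    ring_nf
    rw [Complex.I_sq]
    ring
  have h1 := hJ N μ hN hμ hδ t x ht
  rw [hJe, ← hfs.sum_add_tsum_compl (s := s)] at h1
  have h2 : ‖∑' m : ((s : Set ℤ)ᶜ : Set ℤ), f m‖ ≤ μ := by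
    refine (norm_tsum_le_tsum_norm (hfs.norm.subtype _)).trans ?_
    simp only [hnorm]
    exact (hs₀ s hs).le
  calc ‖∑ m ∈ s, f m‖ = ‖(∑ m ∈ s, f m + ∑' m : ((s : Set ℤ)ᶜ : Set ℤ), f m) -
      ∑' m : ((s : Set ℤ)ᶜ : Set ℤ), f m‖ := by rw [add_sub_cancel_right]
    _ ≤ _ := norm_sub_le _ _
    _ ≤ 2 * μ := by linarith

/-- The truncated Gaussian-regularised Schrödinger kernel on the `n`-dimensional torus. -/
noncomputable def gaussKernel (n M : ℕ) (N t : ℝ) (x : Fin n → ℝ) : ℂ :=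
  ∑ ξ ∈ Fintype.piFinset fun _ : Fin n => Finset.Icc (-(M : ℤ)) M,
    (Real.exp (-((∑ i, (ξ i : ℝ) ^ 2) / N ^ 2)) : ℂ) *
      Complex.exp (Complex.I * ((∑ i, x i * (ξ i : ℝ)) - t * ∑ i, (ξ i : ℝ) ^ 2 : ℝ))

lemma gaussKernel_eq_prod (n M : ℕ) (N t : ℝ) (x : Fin n → ℝ) :
    gaussKernel n M N t x = ∏ i, ∑ m ∈ Finset.Icc (-(M : ℤ)) M,
      (Real.exp (-((m : ℝ) ^ 2 / N ^ 2)) : ℂ) *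
        Complex.exp (Complex.I * (x i * m - t * (m : ℝ) ^ 2 : ℝ)) := by
  rw [Finset.prod_univ_sum]
  refine Finset.sum_congr rfl fun ξ _ => ?_
  rw [Finset.prod_mul_distrib, ← Complex.exp_sum, ← Complex.ofReal_prod, ← Real.exp_sum,
    ← Finset.mul_sum, ← Complex.ofReal_sum, Finset.sum_sub_distrib, ← Finset.mul_sum,
    Finset.sum_neg_distrib, ← Finset.sum_div]

lemma exists_norm_gaussKernel_le (n : ℕ) : ∃ C > 0, ∀ N μ : ℝ, 0 < N → 0 < μ →
    C / μ ^ 2 ≤ 1 → ∃ M₀ : ℕ, ∀ M ≥ M₀, ∀ (t : ℝ) (x : Fin n → ℝ),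
      t / π ∉ majorArcs (π * N ^ 2 * (C / μ ^ 2)) (C / μ ^ 2) →
      ‖gaussKernel n M N t x‖ ≤ (2 * μ) ^ n := by
  obtain ⟨C, hC, h⟩ := exists_norm_gaussian_kernel_le
  refine ⟨C, hC, fun N μ hN hμ hδ => ?_⟩
  obtain ⟨M₀, hM⟩ := h N μ hN hμ hδ
  refine ⟨M₀, fun M hM' t x ht => ?_⟩
  rw [gaussKernel_eq_prod, norm_prod]
  refine (Finset.prod_le_prod (fun _ _ => norm_nonneg _)
    fun i _ => hM M hM' t (x i) ht).trans ?_
  simp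

lemma integral_indicator_sub_le {ν : Measure ℝ} (hν : ν ≤ volume) {B : Set ℝ}
    (hB : MeasurableSet B) {β : ℝ} (hβ : 0 ≤ β) (hBβ : volume B ≤ ENNReal.ofReal β) (t : ℝ) :
    ∫ s, B.indicator (1 : ℝ → ℝ) (t - s) ∂ν ≤ β ∧ ∫ s, B.indicator (1 : ℝ → ℝ) (s - t) ∂ν ≤ β := by
  classical
  have h1 : MeasurableSet {s | t - s ∈ B} := (measurable_const.sub measurable_id) hB
  have h2 : MeasurableSet {s | s - t ∈ B} := (measurable_id.sub measurable_const) hB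
  have e1 : (fun s => B.indicator (1 : ℝ → ℝ) (t - s)) = {s | t - s ∈ B}.indicator 1 := by
    funext s; simp [Set.indicator_apply]
  have e2 : (fun s => B.indicator (1 : ℝ → ℝ) (s - t)) = {s | s - t ∈ B}.indicator 1 := by
    funext s; simp [Set.indicator_apply]
  rw [e1, e2, integral_indicator_one h1, integral_indicator_one h2]
  constructor
  · refine ENNReal.toReal_le_of_le_ofReal hβ ((hν _).trans (le_trans (le_of_eq ?_) hBβ))
    exact (Measure.measurePreserving_sub_left volume t).measure_preimage hB.nullMeasurableSet
  · refine ENNReal.toReal_le_of_le_ofReal hβ ((hν _).trans (le_trans (le_of_eq ?_) hBβ))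
    exact (measurePreserving_sub_right volume t).measure_preimage hB.nullMeasurableSet

lemma integral_indicator_sub_mul_le {ν : Measure ℝ} [IsFiniteMeasure ν] (hν : ν ≤ volume)
    {B : Set ℝ} (hB : MeasurableSet B) {β : ℝ} (hβ : 0 ≤ β) (hBβ : volume B ≤ ENNReal.ofReal β)
    {A : ℝ → ℝ} (hA : Measurable A) (hA0 : ∀ t, 0 ≤ A t) {a : ℝ} (hAa : ∀ t, A t ≤ a) :
    Integrable (fun p : ℝ × ℝ => B.indicator (1 : ℝ → ℝ) (p.1 - p.2) * (A p.1 + A p.2))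
      (ν.prod ν) ∧
    ∫ p : ℝ × ℝ, B.indicator (1 : ℝ → ℝ) (p.1 - p.2) * (A p.1 + A p.2) ∂(ν.prod ν) ≤
      2 * β * ∫ t, A t ∂ν := by
  have hind : Measurable (B.indicator (1 : ℝ → ℝ)) := measurable_one.indicator hB
  have hi0 : ∀ x, 0 ≤ B.indicator (1 : ℝ → ℝ) x := fun x =>
    Set.indicator_nonneg (fun _ _ => zero_le_one) x
  have hi1 : ∀ x, B.indicator (1 : ℝ → ℝ) x ≤ 1 := fun x =>
    Set.indicator_le_self' (fun _ _ => zero_le_one) x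
  have hAi : Integrable A ν := Integrable.of_bound hA.aestronglyMeasurable a
    (Filter.Eventually.of_forall fun t => by rw [Real.norm_of_nonneg (hA0 t)]; exact hAa t)
  have hint : ∀ f : ℝ × ℝ → ℝ, Measurable f → (∀ p, 0 ≤ f p) → (∀ p, f p ≤ a) →
      Integrable (fun p : ℝ × ℝ => B.indicator (1 : ℝ → ℝ) (p.1 - p.2) * f p) (ν.prod ν) := by
    intro f hf h0 h1
    refine Integrable.of_bound ((hind.comp (measurable_fst.sub measurable_snd)).mul
      hf).aestronglyMeasurable a (Filter.Eventually.of_forall fun p => ?_)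
    rw [Real.norm_of_nonneg (mul_nonneg (hi0 _) (h0 p))]
    calc _ ≤ 1 * f p := mul_le_mul_of_nonneg_right (hi1 _) (h0 p)
      _ ≤ a := by rw [one_mul]; exact h1 p
  have i1 := hint (fun p => A p.1) (hA.comp measurable_fst) (fun p => hA0 _) (fun p => hAa _)
  have i2 := hint (fun p => A p.2) (hA.comp measurable_snd) (fun p => hA0 _) (fun p => hAa _)
  have esum : (fun p : ℝ × ℝ => B.indicator (1 : ℝ → ℝ) (p.1 - p.2) * (A p.1 + A p.2)) =
      (fun p => B.indicator (1 : ℝ → ℝ) (p.1 - p.2) * A p.1) +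
        fun p => B.indicator (1 : ℝ → ℝ) (p.1 - p.2) * A p.2 := by
    funext p; simp [mul_add]
  refine ⟨esum ▸ i1.add i2, ?_⟩
  rw [esum, integral_add' i1 i2, two_mul, add_mul]
  refine add_le_add ?_ ?_
  · rw [integral_prod _ i1, ← integral_const_mul]
    refine integral_mono i1.integral_prod_left (hAi.const_mul _) fun t => ?_
    simp only [integral_mul_const]
    exact mul_le_mul_of_nonneg_right (integral_indicator_sub_le hν hB hβ hBβ t).1 (hA0 t)
  · rw [integral_prod_symm _ i2, ← integral_const_mul]
    refine integral_mono i2.integral_prod_right (hAi.const_mul _) fun t => ?_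
    simp only [integral_mul_const]
    exact mul_le_mul_of_nonneg_right (integral_indicator_sub_le hν hB hβ hBβ t).2 (hA0 t)

lemma norm_le_of_sq_le {E : Type*} [NormedAddCommGroup E] {q : ℝ → E} {A : ℝ → ℝ} {V a : ℝ}
    (hqA : ∀ t, ‖q t‖ ^ 2 ≤ V * A t) (hV : 0 ≤ V) (hAa : ∀ t, A t ≤ a) (t : ℝ) :
    ‖q t‖ ≤ √(V * a) :=
  Real.le_sqrt_of_sq_le ((hqA t).trans (mul_le_mul_of_nonneg_left (hAa t) hV))

lemma stronglyMeasurable_indicator_sub {E : Type*} [TopologicalSpace E] [Zero E] {q : ℝ → E}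
    {B : Set ℝ} (hq : StronglyMeasurable q) (hB : MeasurableSet B) :
    StronglyMeasurable fun p : ℝ × ℝ => B.indicator (fun _ => q p.2) (p.1 - p.2) := by
  classical
  have : (fun p : ℝ × ℝ => B.indicator (fun _ => q p.2) (p.1 - p.2)) =
      {p : ℝ × ℝ | p.1 - p.2 ∈ B}.indicator fun p => q p.2 := by
    funext p; simp [Set.indicator_apply]
  rw [this]
  exact (hq.comp_measurable measurable_snd).indicator
    ((measurable_fst.sub measurable_snd) hB)

lemma integrable_of_sq_le {E : Type*} [NormedAddCommGroup E] {ν : Measure ℝ} [IsFiniteMeasure ν]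
    {q : ℝ → E} {A : ℝ → ℝ} {V a : ℝ} (hq : StronglyMeasurable q) (hqA : ∀ t, ‖q t‖ ^ 2 ≤ V * A t)
    (hV : 0 ≤ V) (hAa : ∀ t, A t ≤ a) : Integrable q ν :=
  Integrable.of_bound hq.aestronglyMeasurable _
    (Filter.Eventually.of_forall (norm_le_of_sq_le hqA hV hAa))

lemma integrable_indicator_sub {E : Type*} [NormedAddCommGroup E] {ν : Measure ℝ}
    [IsFiniteMeasure ν]
    {q : ℝ → E} {A : ℝ → ℝ} {B : Set ℝ} {V a : ℝ} (hq : StronglyMeasurable q)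
    (hqA : ∀ t, ‖q t‖ ^ 2 ≤ V * A t)
    (hV : 0 ≤ V) (hAa : ∀ t, A t ≤ a) (hB : MeasurableSet B) (t : ℝ) :
    Integrable (fun s => B.indicator (fun _ => q s) (t - s)) ν := by
  classical
  refine Integrable.of_bound ((stronglyMeasurable_indicator_sub hq hB).comp_measurable
    (measurable_const.prodMk measurable_id)).aestronglyMeasurable √(V * a)
    (Filter.Eventually.of_forall fun s => ?_)
  rw [Set.indicator_apply]
  split_ifs
  · exact norm_le_of_sq_le hqA hV hAa s
  · rw [norm_zero]; positivity

section TTStar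

variable {H : Type*} [NormedAddCommGroup H] [InnerProductSpace ℂ H]
  {ν : Measure ℝ} [IsFiniteMeasure ν] {q : ℝ → H} {A : ℝ → ℝ} {B B' : Set ℝ}
  {V a κ κ' β β' ρ : ℝ}

/-- The part of the integral of `q` over times `s` with `t - s ∈ B`. -/
noncomputable def nearIntegral (ν : Measure ℝ) (B : Set ℝ) (q : ℝ → H) (t : ℝ) : H :=
  ∫ s, B.indicator (fun _ => q s) (t - s) ∂ν

lemma norm_inner_le_of_sq_le (hqA : ∀ t, ‖q t‖ ^ 2 ≤ V * A t) (s t : ℝ) :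
    ‖inner ℂ (q s) (q t)‖ ≤ V / 2 * (A s + A t) := by
  have h1 := norm_inner_le_norm (𝕜 := ℂ) (q s) (q t)
  nlinarith [hqA s, hqA t, sq_nonneg (‖q s‖ - ‖q t‖)]

lemma stronglyMeasurable_nearIntegral (hq : StronglyMeasurable q) (hB : MeasurableSet B) :
    StronglyMeasurable (nearIntegral ν B q) :=
  (stronglyMeasurable_indicator_sub hq hB).integral_prod_right

lemma norm_integral_sq_le_add [CompleteSpace H] (hq : StronglyMeasurable q) (hA : Measurable A)
    (hA0 : ∀ t, 0 ≤ A t) (hAa : ∀ t, A t ≤ a) (hV : 0 ≤ V) (hqA : ∀ t, ‖q t‖ ^ 2 ≤ V * A t)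
    (hB : MeasurableSet B) (hκ : ∀ t s, t - s ∉ B → ‖inner ℂ (q t) (q s)‖ ≤ κ * (A t * A s))
    (hκ0 : 0 ≤ κ) {G : ℝ → ℝ} (hG : Integrable G ν)
    (hGle : ∀ t, ‖inner ℂ (q t) (nearIntegral ν B q t)‖ ≤ G t) :
    ‖∫ t, q t ∂ν‖ ^ 2 ≤ κ * (∫ t, A t ∂ν) ^ 2 + ∫ t, G t ∂ν := by
  classical
  have hAi : Integrable A ν := Integrable.of_bound hA.aestronglyMeasurable a
    (Filter.Eventually.of_forall fun t => by rw [Real.norm_of_nonneg (hA0 t)]; exact hAa t)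
  have hqi : Integrable q ν := integrable_of_sq_le hq hqA hV hAa
  set z := ∫ t, q t ∂ν with hz
  set m := ∫ t, A t ∂ν with hm
  have key : ∀ t, ‖inner ℂ (q t) z‖ ≤ κ * m * A t + G t := by
    intro t
    have hn := integrable_indicator_sub (ν := ν) hq hqA hV hAa hB t
    have hf := integrable_indicator_sub (ν := ν) hq hqA hV hAa hB.compl t
    have e : z = nearIntegral ν B q t + ∫ s, Bᶜ.indicator (fun _ => q s) (t - s) ∂ν := by
      rw [nearIntegral, ← integral_add hn hf, hz]
      refine integral_congr_ae (Filter.Eventually.of_forall fun s => ?_)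
      exact (Set.indicator_self_add_compl_apply B (fun _ => q s) (t - s)).symm
    rw [e, inner_add_right, add_comm (κ * m * A t)]
    refine (norm_add_le _ _).trans (add_le_add (hGle t) ?_)
    rw [← integral_inner hf]
    refine (norm_integral_le_of_norm_le (hAi.const_mul (κ * A t))
      (Filter.Eventually.of_forall fun s => ?_)).trans (le_of_eq ?_)
    · rw [Set.indicator_apply]
      split_ifs with h
      · rw [mul_assoc]; exact hκ t s h
      · rw [inner_zero_right, norm_zero]
        have := hA0 t; have := hA0 s; positivity
    · rw [integral_const_mul]; ring
  have e1 : ‖z‖ ^ 2 = ‖∫ t, inner ℂ z (q t) ∂ν‖ := by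
    rw [integral_inner hqi, ← hz, inner_self_eq_norm_sq_to_K]
    simp
  rw [e1]
  refine (norm_integral_le_of_norm_le ((hAi.const_mul (κ * m)).add hG)
    (Filter.Eventually.of_forall fun t => ?_)).trans (le_of_eq ?_)
  · rw [norm_inner_symm]; exact key t
  · rw [integral_add' (hAi.const_mul _) hG, integral_const_mul]; ring

/-- The `TT*` bound for a family of vectors that is almost orthogonal away from `B`. -/
lemma norm_integral_sq_le [CompleteSpace H] (hν : ν ≤ volume) (hq : StronglyMeasurable q)
    (hA : Measurable A)
    (hA0 : ∀ t, 0 ≤ A t) (hAa : ∀ t, A t ≤ a) (hV : 0 ≤ V) (hqA : ∀ t, ‖q t‖ ^ 2 ≤ V * A t)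
    (hB : MeasurableSet B) (hκ : ∀ t s, t - s ∉ B → ‖inner ℂ (q t) (q s)‖ ≤ κ * (A t * A s))
    (hκ0 : 0 ≤ κ) (hβ : 0 ≤ β) (hBβ : volume B ≤ ENNReal.ofReal β) :
    ‖∫ t, q t ∂ν‖ ^ 2 ≤ κ * (∫ t, A t ∂ν) ^ 2 + V * β * ∫ t, A t ∂ν := by
  classical
  obtain ⟨hi, hle⟩ := integral_indicator_sub_mul_le hν hB hβ hBβ hA hA0 hAa
  have := norm_integral_sq_le_add hq hA hA0 hAa hV hqA hB hκ hκ0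
    (G := fun t => V / 2 * ∫ s, B.indicator (1 : ℝ → ℝ) (t - s) * (A t + A s) ∂ν)
    (hi.integral_prod_left.const_mul _) (fun t => by
      have hAi : Integrable A ν := Integrable.of_bound hA.aestronglyMeasurable a
        (Filter.Eventually.of_forall fun t => by rw [Real.norm_of_nonneg (hA0 t)]; exact hAa t)
      rw [nearIntegral, ← integral_inner (integrable_indicator_sub hq hqA hV hAa hB t),
        ← integral_const_mul]
      refine norm_integral_le_of_norm_le ?_ (Filter.Eventually.of_forall fun s => ?_)
      · refine Integrable.const_mul ?_ _
        refine Integrable.bdd_mul (c := 1) ((integrable_const _).add hAi) ?_ ?_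
        · exact ((measurable_one.indicator hB).comp
            (measurable_const.sub measurable_id)).aestronglyMeasurable
        · refine Filter.Eventually.of_forall fun s => ?_
          rw [Set.indicator_apply]; split_ifs <;> simp
      · rw [Set.indicator_apply, Set.indicator_apply]
        split_ifs
        · rw [Pi.one_apply, one_mul]; exact norm_inner_le_of_sq_le hqA t s
        · simp)
  refine this.trans ?_
  rw [integral_const_mul, ← integral_prod _ hi]
  nlinarith

lemma integral_norm_nearIntegral_sq_le [CompleteSpace H] (hν : ν ≤ volume)
    (hq : StronglyMeasurable q) (hA : Measurable A)
    (hA0 : ∀ t, 0 ≤ A t) (hAa : ∀ t, A t ≤ a) (hV : 0 ≤ V) (hqA : ∀ t, ‖q t‖ ^ 2 ≤ V * A t)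
    (hB : MeasurableSet B) (hB' : MeasurableSet B') (hβ : 0 ≤ β)
    (hBβ : volume B ≤ ENNReal.ofReal β) (hβ' : 0 ≤ β') (hBβ' : volume B' ≤ ENNReal.ofReal β')
    (hρ : 0 ≤ ρ) (hR : ∀ s s', s - s' ∉ B' →
      ν.real {t | t - s ∈ B ∧ t - s' ∈ B} * ‖inner ℂ (q s) (q s')‖ ≤ ρ * (A s * A s')) :
    ∫ t, ‖nearIntegral ν B q t‖ ^ 2 ∂ν ≤
      ρ * (∫ t, A t ∂ν) ^ 2 + V * β * β' * ∫ t, A t ∂ν := by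
  classical
  have hAi : Integrable A ν := Integrable.of_bound hA.aestronglyMeasurable a
    (Filter.Eventually.of_forall fun t => by rw [Real.norm_of_nonneg (hA0 t)]; exact hAa t)
  obtain ⟨hi, hle⟩ := integral_indicator_sub_mul_le hν hB' hβ' hBβ' hA hA0 hAa
  set F : ℝ → ℝ × ℝ → ℂ := fun t p =>
    inner ℂ (B.indicator (fun _ => q p.1) (t - p.1)) (B.indicator (fun _ => q p.2) (t - p.2))
    with hF
  have hFm : StronglyMeasurable (Function.uncurry F) := by
    have h1 := (stronglyMeasurable_indicator_sub hq hB).comp_measurable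
      (show Measurable fun x : ℝ × ℝ × ℝ => (x.1, x.2.1) by fun_prop)
    have h2 := (stronglyMeasurable_indicator_sub hq hB).comp_measurable
      (show Measurable fun x : ℝ × ℝ × ℝ => (x.1, x.2.2) by fun_prop)
    exact h1.inner h2
  have hFeq : ∀ t p, F t p = ({t | t - p.1 ∈ B ∧ t - p.2 ∈ B} : Set ℝ).indicator
      (fun _ => inner ℂ (q p.1) (q p.2)) t := by
    intro t p
    simp only [hF, Set.indicator_apply, Set.mem_ofPred_eq]
    by_cases h1 : t - p.1 ∈ B <;> by_cases h2 : t - p.2 ∈ B <;> simp [h1, h2]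
  have hqb := norm_le_of_sq_le hqA hV hAa
  have hFb : ∀ t p, ‖F t p‖ ≤ √(V * a) * √(V * a) := by
    intro t p
    rw [hFeq, Set.indicator_apply]
    split_ifs
    · exact (norm_inner_le_norm _ _).trans (mul_le_mul (hqb _) (hqb _) (norm_nonneg _)
        (Real.sqrt_nonneg _))
    · rw [norm_zero]; positivity
  have hFi : Integrable (Function.uncurry F) (ν.prod (ν.prod ν)) :=
    Integrable.of_bound hFm.aestronglyMeasurable _
      (Filter.Eventually.of_forall fun x => hFb x.1 x.2)
  have hFti : ∀ t, Integrable (F t) (ν.prod ν) := fun t =>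
    Integrable.of_bound (hFm.comp_measurable
      (measurable_const.prodMk measurable_id)).aestronglyMeasurable _
      (Filter.Eventually.of_forall fun p => hFb t p)
  have hsq : ∀ t, ((‖nearIntegral ν B q t‖ ^ 2 : ℝ) : ℂ) = ∫ p, F t p ∂(ν.prod ν) := by
    intro t
    have hni := integrable_indicator_sub (ν := ν) hq hqA hV hAa hB t
    rw [integral_prod _ (hFti t)]
    have h1 : ∀ s, ∫ s', F t (s, s') ∂ν =
        inner ℂ (B.indicator (fun _ => q s) (t - s)) (nearIntegral ν B q t) := fun s =>
      integral_inner (𝕜 := ℂ) hni (B.indicator (fun _ => q s) (t - s))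
    simp only [h1]
    have h2 : ∀ s, inner ℂ (B.indicator (fun _ => q s) (t - s)) (nearIntegral ν B q t) =
        (starRingEnd ℂ) (inner ℂ (nearIntegral ν B q t) (B.indicator (fun _ => q s) (t - s))) :=
      fun s => (inner_conj_symm _ _).symm
    simp only [h2]
    rw [integral_conj, integral_inner hni]
    change _ = (starRingEnd ℂ) (inner ℂ (nearIntegral ν B q t) (nearIntegral ν B q t))
    rw [inner_conj_symm, inner_self_eq_norm_sq_to_K]
    simp
  have hnn : 0 ≤ ∫ t, ‖nearIntegral ν B q t‖ ^ 2 ∂ν := integral_nonneg fun t => by positivity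
  have e1 : ∫ t, ‖nearIntegral ν B q t‖ ^ 2 ∂ν = ‖∫ p, ∫ t, F t p ∂ν ∂(ν.prod ν)‖ := by
    rw [← integral_integral_swap hFi]
    simp only [← hsq]
    rw [integral_complex_ofReal, Complex.norm_real, Real.norm_of_nonneg hnn]
  have hpt : ∀ p : ℝ × ℝ, ‖∫ t, F t p ∂ν‖ ≤ ρ * (A p.1 * A p.2) +
      V / 2 * β * (B'.indicator (1 : ℝ → ℝ) (p.1 - p.2) * (A p.1 + A p.2)) := by
    intro p
    have hm1 : MeasurableSet {t | t - p.1 ∈ B} := (measurable_id.sub measurable_const) hB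
    have hm : MeasurableSet {t | t - p.1 ∈ B ∧ t - p.2 ∈ B} :=
      hm1.inter ((measurable_id.sub measurable_const) hB)
    simp only [hFeq]
    rw [integral_indicator_const _ hm, norm_smul, Real.norm_of_nonneg measureReal_nonneg]
    have a1 := hA0 p.1
    have a2 := hA0 p.2
    rw [Set.indicator_apply]
    split_ifs with h
    · have hb : ν.real {t | t - p.1 ∈ B ∧ t - p.2 ∈ B} ≤ β := by
        have := (integral_indicator_sub_le hν hB hβ hBβ p.1).2
        rw [show (fun s => B.indicator (1 : ℝ → ℝ) (s - p.1)) = {t | t - p.1 ∈ B}.indicator 1 by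
          funext s; simp [Set.indicator_apply], integral_indicator_one hm1] at this
        exact (measureReal_mono (fun t ht => ht.1)).trans this
      calc _ ≤ β * (V / 2 * (A p.1 + A p.2)) :=
            mul_le_mul hb (norm_inner_le_of_sq_le hqA _ _) (norm_nonneg _) hβ
        _ ≤ _ := by
            rw [Pi.one_apply]
            have : 0 ≤ ρ * (A p.1 * A p.2) := by positivity
            linarith
    · rw [zero_mul, mul_zero, add_zero]; exact hR _ _ h
  have hprod : Integrable (fun p : ℝ × ℝ => A p.1 * A p.2) (ν.prod ν) := hAi.mul_prod hAi
  rw [e1]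
  refine (norm_integral_le_of_norm_le ((hprod.const_mul ρ).add (hi.const_mul (V / 2 * β)))
    (Filter.Eventually.of_forall hpt)).trans ?_
  rw [integral_add' (hprod.const_mul _) (hi.const_mul _), integral_const_mul, integral_const_mul,
    integral_prod_mul]
  have : 0 ≤ V / 2 * β := by positivity
  nlinarith

/-- The iterated `TT*` bound, which exploits that the translates of `B` rarely overlap. -/
lemma norm_integral_sq_le_of_overlap [CompleteSpace H] (hν : ν ≤ volume) (hq : StronglyMeasurable q)
    (hA : Measurable A)
    (hA0 : ∀ t, 0 ≤ A t) (hAa : ∀ t, A t ≤ a) (hV : 0 ≤ V) (hqA : ∀ t, ‖q t‖ ^ 2 ≤ V * A t)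
    (hB : MeasurableSet B) (hκ : ∀ t s, t - s ∉ B → ‖inner ℂ (q t) (q s)‖ ≤ κ * (A t * A s))
    (hκ0 : 0 ≤ κ) (hB' : MeasurableSet B') (hβ : 0 ≤ β)
    (hBβ : volume B ≤ ENNReal.ofReal β) (hβ' : 0 ≤ β') (hBβ' : volume B' ≤ ENNReal.ofReal β')
    (hρ : 0 ≤ ρ) (hR : ∀ s s', s - s' ∉ B' →
      ν.real {t | t - s ∈ B ∧ t - s' ∈ B} * ‖inner ℂ (q s) (q s')‖ ≤ ρ * (A s * A s'))
    {θ : ℝ} (hθ : 0 < θ) :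
    ‖∫ t, q t ∂ν‖ ^ 2 ≤ κ * (∫ t, A t ∂ν) ^ 2 + θ * V * (∫ t, A t ∂ν) +
      (ρ * (∫ t, A t ∂ν) ^ 2 + V * β * β' * ∫ t, A t ∂ν) / θ := by
  classical
  have hAi : Integrable A ν := Integrable.of_bound hA.aestronglyMeasurable a
    (Filter.Eventually.of_forall fun t => by rw [Real.norm_of_nonneg (hA0 t)]; exact hAa t)
  have hQm : StronglyMeasurable (nearIntegral ν B q) := stronglyMeasurable_nearIntegral hq hB
  have hQi : Integrable (fun t => ‖nearIntegral ν B q t‖ ^ 2) ν := by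
    refine Integrable.of_bound (hQm.norm.pow 2).aestronglyMeasurable
      ((√(V * a) * ν.real Set.univ) ^ 2) (Filter.Eventually.of_forall fun t => ?_)
    rw [norm_pow, norm_norm]
    gcongr
    refine norm_integral_le_of_norm_le_const (Filter.Eventually.of_forall fun s => ?_)
    rw [Set.indicator_apply]
    split_ifs
    · exact norm_le_of_sq_le hqA hV hAa s
    · rw [norm_zero]; positivity
  have hnear := integral_norm_nearIntegral_sq_le hν hq hA hA0 hAa hV hqA hB hB' hβ hBβ hβ' hBβ'
    hρ hR
  have := norm_integral_sq_le_add hq hA hA0 hAa hV hqA hB hκ hκ0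
    (G := fun t => θ * V * A t + ‖nearIntegral ν B q t‖ ^ 2 / θ)
    ((hAi.const_mul _).add (hQi.div_const θ)) (fun t => by
      refine (norm_inner_le_norm _ _).trans ?_
      have h1 := hqA t
      set x := ‖q t‖
      set y := ‖nearIntegral ν B q t‖
      have h2 : θ * x ^ 2 ≤ θ * V * A t := by
        rw [mul_assoc]; exact mul_le_mul_of_nonneg_left h1 hθ.le
      have h3 : 2 * (x * y) ≤ θ * x ^ 2 + y ^ 2 / θ := by
        rw [← sub_nonneg]
        have : θ * x ^ 2 + y ^ 2 / θ - 2 * (x * y) = (θ * x - y) ^ 2 / θ := by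
          field_simp; ring
        rw [this]; positivity
      have h4 : 0 ≤ θ * x ^ 2 := by positivity
      have h5 : 0 ≤ y ^ 2 / θ := by positivity
      linarith)
  refine this.trans ?_
  rw [integral_add (hAi.const_mul _) (hQi.div_const θ), integral_const_mul, integral_div,
    ← add_assoc]
  gcongr

end TTStar

section Orthogonality

/-- The character `x ↦ e^{i x·ξ}` of the torus. -/
noncomputable def torusChar (n : ℕ) (ξ : Fin n → ℤ) (x : Fin n → ℝ) : ℂ :=
  Complex.exp (Complex.I * (∑ i, x i * (ξ i : ℝ) : ℝ))

/-- Lebesgue measure on the spatial period box. -/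
noncomputable abbrev torusVol (n : ℕ) : Measure (Fin n → ℝ) :=
  volume.restrict (Set.univ.pi fun _ => Set.Icc 0 (2 * π))

/-- Lebesgue measure on the temporal period. -/
noncomputable abbrev timeVol : Measure ℝ := volume.restrict (Set.Icc 0 (2 * π))

lemma torusVol_eq_pi (n : ℕ) : torusVol n = Measure.pi fun _ : Fin n => timeVol := by
  rw [torusVol, volume_pi, Measure.restrict_pi_pi]

instance (n : ℕ) : IsFiniteMeasure (torusVol n) := by
  rw [torusVol_eq_pi]; infer_instance

lemma volume_restrict_stBox (n : ℕ) : volume.restrict (stBox n) = timeVol.prod (torusVol n) := by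
  rw [stBox, Measure.volume_eq_prod, Measure.prod_restrict]

lemma timeVol_real_univ : timeVol.real Set.univ = 2 * π := by
  rw [measureReal_restrict_apply_univ, Real.volume_real_Icc_of_le (by positivity), sub_zero]

lemma torusVol_real_univ (n : ℕ) : (torusVol n).real Set.univ = (2 * π) ^ n := by
  rw [torusVol_eq_pi, Measure.real, ← Set.pi_univ Set.univ, Measure.pi_pi]
  simp only [ENNReal.toReal_prod]
  change ∏ _i : Fin n, timeVol.real Set.univ = _
  rw [timeVol_real_univ]
  simp

lemma integral_timeVol_exp (m : ℤ) :
    ∫ t, Complex.exp (Complex.I * (t * (m : ℝ) : ℝ)) ∂timeVol = if m = 0 then 2 * π else 0 := by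
  split_ifs with hm
  · subst hm
    have := timeVol_real_univ
    simp only [Int.cast_zero, mul_zero, Complex.ofReal_zero, Complex.exp_zero]
    rw [integral_const, this, Complex.real_smul, mul_one]
  · rw [integral_Icc_eq_integral_Ioc, ← intervalIntegral.integral_of_le (by positivity)]
    have hc : Complex.I * (m : ℂ) ≠ 0 := mul_ne_zero Complex.I_ne_zero (by exact_mod_cast hm)
    have e : (fun t : ℝ => Complex.exp (Complex.I * (t * (m : ℝ) : ℝ))) =
        fun t : ℝ => Complex.exp (Complex.I * m * t) := by
      funext t; congr 1; push_cast; ring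
    rw [e, integral_exp_mul_complex hc]
    have : Complex.I * (m : ℂ) * ((2 * π : ℝ) : ℂ) = m * (2 * π * Complex.I) := by
      push_cast; ring
    rw [this, Complex.exp_int_mul_two_pi_mul_I]
    simp

lemma integral_torusChar (n : ℕ) (ξ : Fin n → ℤ) :
    ∫ x, torusChar n ξ x ∂(torusVol n) = if ξ = 0 then (2 * π) ^ n else 0 := by
  have e : torusChar n ξ = fun x => ∏ i, Complex.exp (Complex.I * (x i * (ξ i : ℝ) : ℝ)) := by
    funext x
    rw [torusChar, ← Complex.exp_sum, ← Finset.mul_sum, ← Complex.ofReal_sum]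
  rw [e, torusVol_eq_pi,
    integral_fintype_prod_eq_prod fun i (t : ℝ) => Complex.exp (Complex.I * (t * (ξ i : ℝ) : ℝ))]
  simp only [integral_timeVol_exp]
  split_ifs with h
  · simp [h]
  · obtain ⟨i, hi⟩ := Function.ne_iff.1 h
    rw [Complex.ofReal_zero]
    exact Finset.prod_eq_zero (Finset.mem_univ i)
      (by rw [if_neg (by simpa using hi), Complex.ofReal_zero])

lemma norm_torusChar (n : ℕ) (ξ : Fin n → ℤ) (x : Fin n → ℝ) : ‖torusChar n ξ x‖ = 1 := by
  rw [torusChar, mul_comm, Complex.norm_exp_ofReal_mul_I]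

lemma continuous_torusChar (n : ℕ) (ξ : Fin n → ℤ) : Continuous (torusChar n ξ) := by
  unfold torusChar; fun_prop

lemma conj_torusChar_mul (n : ℕ) (ξ η : Fin n → ℤ) (x : Fin n → ℝ) :
    (starRingEnd ℂ) (torusChar n ξ x) * torusChar n η x = torusChar n (η - ξ) x := by
  rw [torusChar, torusChar, torusChar, ← Complex.exp_conj, ← Complex.exp_add]
  congr 1
  rw [map_mul, Complex.conj_I, Complex.conj_ofReal, neg_mul, neg_add_eq_sub, ← mul_sub,
    ← Complex.ofReal_sub, ← Finset.sum_sub_distrib]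
  simp only [Pi.sub_apply, Int.cast_sub, mul_sub]

/-- Parseval's identity for a finite orthogonal family of unimodular functions. -/
lemma integral_norm_sum_sq {Ω ι : Type*} [MeasurableSpace Ω] {ν : Measure Ω} [IsFiniteMeasure ν]
    (s : Finset ι) (e : ι → Ω → ℂ) (he : ∀ i ∈ s, Measurable (e i))
    (he1 : ∀ i ∈ s, ∀ x, ‖e i x‖ = 1) (V : ℝ)
    (hV : ∀ i ∈ s, ∫ x, (starRingEnd ℂ) (e i x) * e i x ∂ν = V)
    (horth : ∀ i ∈ s, ∀ j ∈ s, i ≠ j → ∫ x, (starRingEnd ℂ) (e i x) * e j x ∂ν = 0)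
    (b : ι → ℂ) :
    ∫ x, ‖∑ i ∈ s, b i * e i x‖ ^ 2 ∂ν = V * ∑ i ∈ s, ‖b i‖ ^ 2 := by
  have hint : ∀ i ∈ s, ∀ j ∈ s, Integrable (fun x => (starRingEnd ℂ) (e i x) * e j x) ν := by
    intro i hi j hj
    refine Integrable.of_bound ((Complex.continuous_conj.measurable.comp (he i hi)).mul
      (he j hj)).aestronglyMeasurable 1 (Filter.Eventually.of_forall fun x => ?_)
    rw [norm_mul, RCLike.norm_conj, he1 i hi, he1 j hj, one_mul]
  have hpt : ∀ x, ((‖∑ i ∈ s, b i * e i x‖ ^ 2 : ℝ) : ℂ) =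
      ∑ i ∈ s, ∑ j ∈ s, (starRingEnd ℂ) (b i) * b j * ((starRingEnd ℂ) (e i x) * e j x) := by
    intro x
    rw [← Complex.normSq_eq_norm_sq, Complex.normSq_eq_conj_mul_self, map_sum, Finset.sum_mul_sum]
    refine Finset.sum_congr rfl fun i _ => Finset.sum_congr rfl fun j _ => ?_
    rw [map_mul]; ring
  rw [← Complex.ofReal_inj, ← integral_complex_ofReal]
  simp only [hpt]
  rw [integral_finsetSum _ fun i hi => integrable_finsetSum _ fun j hj =>
    (hint i hi j hj).const_mul _]
  push_cast
  rw [Finset.mul_sum]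
  refine Finset.sum_congr rfl fun i hi => ?_
  rw [integral_finsetSum _ fun j hj => (hint i hi j hj).const_mul _,
    Finset.sum_eq_single_of_mem i hi]
  · rw [integral_const_mul, hV i hi, ← Complex.normSq_eq_conj_mul_self, Complex.normSq_eq_norm_sq]
    push_cast; ring
  · intro j hj hne
    rw [integral_const_mul, horth i hi j hj hne.symm, mul_zero]

lemma integral_norm_sum_torusChar_sq (n : ℕ) (s : Finset (Fin n → ℤ)) (b : (Fin n → ℤ) → ℂ) :
    ∫ x, ‖∑ ξ ∈ s, b ξ * torusChar n ξ x‖ ^ 2 ∂(torusVol n) =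
      (2 * π) ^ n * ∑ ξ ∈ s, ‖b ξ‖ ^ 2 := by
  refine integral_norm_sum_sq s (torusChar n) (fun ξ _ => (continuous_torusChar n ξ).measurable)
    (fun ξ _ => norm_torusChar n ξ) _ (fun ξ _ => ?_) (fun ξ _ η _ hne => ?_) b
  · simp only [conj_torusChar_mul, integral_torusChar, sub_self, if_true]
  · simp only [conj_torusChar_mul, integral_torusChar]
    rw [if_neg (sub_ne_zero.2 hne.symm), Complex.ofReal_zero]

/-- Bessel's inequality for a function bounded by one. -/
lemma sum_norm_integral_mul_torusChar_sq_le (n : ℕ) (s : Finset (Fin n → ℤ))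
    (g : (Fin n → ℝ) → ℂ) (hg : Measurable g) (hg1 : ∀ x, ‖g x‖ ≤ 1) :
    ∑ ξ ∈ s, ‖∫ x, g x * torusChar n ξ x ∂(torusVol n)‖ ^ 2 ≤
      (2 * π) ^ n * ∫ x, ‖g x‖ ∂(torusVol n) := by
  set V : ℝ := (2 * π) ^ n with hV
  have hV0 : 0 < V := by positivity
  set c : (Fin n → ℤ) → ℂ := fun ξ => ∫ x, g x * torusChar n ξ x ∂(torusVol n) with hc
  set S := ∑ ξ ∈ s, ‖c ξ‖ ^ 2 with hS
  set F : (Fin n → ℝ) → ℂ := fun x => ∑ ξ ∈ s, (starRingEnd ℂ) (c ξ) * torusChar n ξ x with hF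
  have hFc : Continuous F := by
    have := fun ξ => continuous_torusChar n ξ
    fun_prop
  have hFsq : ∫ x, ‖F x‖ ^ 2 ∂(torusVol n) = V * S := by
    rw [hF, integral_norm_sum_torusChar_sq]; simp [hS, hV]
  have hFb : ∀ x, ‖F x‖ ≤ ∑ ξ ∈ s, ‖c ξ‖ := fun x => (norm_sum_le _ _).trans (le_of_eq
    (Finset.sum_congr rfl fun ξ _ => by rw [norm_mul, norm_torusChar, mul_one, RCLike.norm_conj]))
  have hFi : Integrable (fun x => ‖F x‖ ^ 2) (torusVol n) :=
    Integrable.of_bound (hFc.norm.pow 2).aestronglyMeasurable ((∑ ξ ∈ s, ‖c ξ‖) ^ 2)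
      (Filter.Eventually.of_forall fun x => by
        rw [norm_pow, norm_norm]; exact pow_le_pow_left₀ (norm_nonneg _) (hFb x) 2)
  have hgi : Integrable (fun x => ‖g x‖) (torusVol n) :=
    Integrable.of_bound hg.norm.aestronglyMeasurable 1
      (Filter.Eventually.of_forall fun x => by rw [norm_norm]; exact hg1 x)
  have hgc : ∀ ξ, Integrable (fun x => g x * torusChar n ξ x) (torusVol n) := fun ξ =>
    Integrable.of_bound (hg.mul (continuous_torusChar n ξ).measurable).aestronglyMeasurable 1
      (Filter.Eventually.of_forall fun x => by rw [norm_mul, norm_torusChar, mul_one]; exact hg1 x)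
  have hSF : (S : ℂ) = ∫ x, g x * F x ∂(torusVol n) := by
    have : ∀ x, g x * F x = ∑ ξ ∈ s, (starRingEnd ℂ) (c ξ) * (g x * torusChar n ξ x) := fun x => by
      rw [hF, Finset.mul_sum]; exact Finset.sum_congr rfl fun ξ _ => by ring
    simp only [this]
    rw [integral_finsetSum _ fun ξ _ => (hgc ξ).const_mul _, hS]
    push_cast
    refine Finset.sum_congr rfl fun ξ _ => ?_
    rw [integral_const_mul, ← Complex.normSq_eq_conj_mul_self, Complex.normSq_eq_norm_sq]
    push_cast; rfl
  have hS0 : 0 ≤ S := Finset.sum_nonneg fun _ _ => by positivity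
  have hle : S ≤ V / 2 * (∫ x, ‖g x‖ ∂(torusVol n)) + 1 / (2 * V) * (V * S) := by
    have e : S = ‖∫ x, g x * F x ∂(torusVol n)‖ := by
      rw [← hSF, Complex.norm_real, Real.norm_of_nonneg hS0]
    rw [← hFsq, ← integral_const_mul, ← integral_const_mul, ← integral_add (hgi.const_mul _)
      (hFi.const_mul _)]
    refine e.le.trans (norm_integral_le_of_norm_le ((hgi.const_mul _).add (hFi.const_mul _))
      (Filter.Eventually.of_forall fun x => ?_))
    rw [norm_mul]
    have h1 := hg1 x
    have h0 := norm_nonneg (g x)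
    have h2 : ‖g x‖ ^ 2 ≤ ‖g x‖ := by nlinarith
    have h3 : V / 2 * ‖g x‖ ^ 2 + 1 / (2 * V) * ‖F x‖ ^ 2 - ‖g x‖ * ‖F x‖ =
        (V * ‖g x‖ - ‖F x‖) ^ 2 / (2 * V) := by field_simp; ring
    have h4 : 0 ≤ (V * ‖g x‖ - ‖F x‖) ^ 2 / (2 * V) := by positivity
    have h5 : V / 2 * ‖g x‖ ^ 2 ≤ V / 2 * ‖g x‖ := by gcongr
    linarith
  have : 1 / (2 * V) * (V * S) = S / 2 := by field_simp
  rw [this] at hle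
  linarith

end Orthogonality

lemma tWave_eq_sum (n : ℕ) (a : (Fin n → ℤ) →₀ ℂ) (t : ℝ) (x : Fin n → ℝ) :
    tWave n a t x = ∑ ξ ∈ a.support, a ξ *
      (Complex.exp (Complex.I * (-t * ∑ i, (ξ i : ℝ) ^ 2 : ℝ)) * torusChar n ξ x) := by
  refine Finset.sum_congr rfl fun ξ _ => ?_
  rw [torusChar, ← Complex.exp_add, ← mul_add, ← Complex.ofReal_add]
  congr 4
  ring

lemma norm_exp_I_mul_ofReal (r : ℝ) : ‖Complex.exp (Complex.I * r)‖ = 1 := by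
  rw [mul_comm, Complex.norm_exp_ofReal_mul_I]

lemma continuous_tWave (n : ℕ) (a : (Fin n → ℤ) →₀ ℂ) :
    Continuous fun p : ℝ × (Fin n → ℝ) => tWave n a p.1 p.2 := by
  unfold tWave; fun_prop

lemma l2Norm_sq (n : ℕ) (a : (Fin n → ℤ) →₀ ℂ) :
    l2Norm n a ^ 2 = ∑ ξ ∈ a.support, ‖a ξ‖ ^ 2 :=
  Real.sq_sqrt (Finset.sum_nonneg fun _ _ => by positivity)

lemma support_subset_piFinset {n : ℕ} {a : (Fin n → ℤ) →₀ ℂ} {N : ℝ}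
    (ha : ∀ ξ ∈ a.support, znorm n ξ ≤ N) {M : ℕ} (hM : ⌊N⌋₊ ≤ M) :
    a.support ⊆ Fintype.piFinset fun _ : Fin n => Finset.Icc (-(M : ℤ)) M := by
  intro ξ hξ
  rw [Fintype.mem_piFinset]
  intro i
  have h1 : |(ξ i : ℝ)| ≤ N := by
    refine le_trans ?_ (ha ξ hξ)
    rw [znorm, ← Real.sqrt_sq_eq_abs]
    exact Real.sqrt_le_sqrt (Finset.single_le_sum (f := fun i => ((ξ i : ℝ)) ^ 2)
      (fun _ _ => sq_nonneg _) (Finset.mem_univ i))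
  have h2 : (ξ i).natAbs ≤ ⌊N⌋₊ := by
    refine Nat.le_floor ?_
    rw [Nat.cast_natAbs, Int.cast_abs]; exact h1
  rw [Finset.mem_Icc]
  omega

/-- The trivial pointwise bound on a frequency-localised wave. -/
lemma norm_tWave_le {n : ℕ} {a : (Fin n → ℤ) →₀ ℂ} {N : ℝ} (hN : 1 ≤ N)
    (ha : ∀ ξ ∈ a.support, znorm n ξ ≤ N) (t : ℝ) (x : Fin n → ℝ) :
    ‖tWave n a t x‖ ≤ (3 * N) ^ ((n : ℝ) / 2) * l2Norm n a := by
  have hcard : (a.support.card : ℝ) ≤ (3 * N) ^ n := by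
    have h1 := Finset.card_le_card (support_subset_piFinset ha le_rfl)
    rw [Fintype.card_piFinset_const, Int.card_Icc] at h1
    refine (Nat.cast_le.2 h1).trans ?_
    have hfl : (⌊N⌋₊ : ℝ) ≤ N := Nat.floor_le (by linarith)
    rw [Nat.cast_pow, show (((⌊N⌋₊ : ℤ) + 1 - -(⌊N⌋₊ : ℤ)).toNat) = 2 * ⌊N⌋₊ + 1 by omega]
    gcongr
    push_cast
    linarith
  have h1 : ‖tWave n a t x‖ ≤ ∑ ξ ∈ a.support, ‖a ξ‖ := by
    refine (norm_sum_le _ _).trans (le_of_eq (Finset.sum_congr rfl fun ξ _ => ?_))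
    rw [norm_mul, norm_exp_I_mul_ofReal, mul_one]
  have h2 : (∑ ξ ∈ a.support, ‖a ξ‖) ^ 2 ≤ (3 * N) ^ n * l2Norm n a ^ 2 := by
    rw [l2Norm_sq]
    refine sq_sum_le_card_mul_sum_sq.trans ?_
    gcongr
  have h0 : 0 ≤ l2Norm n a := Real.sqrt_nonneg _
  refine h1.trans ((sq_le_sq₀ (Finset.sum_nonneg fun _ _ => norm_nonneg _) (by positivity)).1
    (h2.trans (le_of_eq ?_)))
  rw [mul_pow ((3 * N) ^ ((n : ℝ) / 2)), ← Real.rpow_natCast ((3 * N) ^ ((n : ℝ) / 2)),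
    ← Real.rpow_mul (by positivity), show (n : ℝ) / 2 * (2 : ℕ) = n by push_cast; ring,
    Real.rpow_natCast]

/-- The `L⁴` Strichartz estimate on the one-dimensional torus. -/
lemma integral_norm_tWave_one_pow_four_le (a : (Fin 1 → ℤ) →₀ ℂ) :
    ∫ p, ‖tWave 1 a p.1 p.2‖ ^ 4 ∂(timeVol.prod (torusVol 1)) ≤
      4 * (2 * π) ^ 2 * l2Norm 1 a ^ 4 := by
  classical
  set ν := timeVol.prod (torusVol 1) with hν
  have hVuniv : ν.real Set.univ = (2 * π) ^ 2 := by
    rw [hν, ← Set.univ_prod_univ, measureReal_prod_prod, timeVol_real_univ, torusVol_real_univ]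
    ring
  set e : (Fin 1 → ℤ) × (Fin 1 → ℤ) → ℝ × (Fin 1 → ℝ) → ℂ := fun k p =>
    Complex.exp (Complex.I * (p.1 * ((k.2 0 ^ 2 - k.1 0 ^ 2 : ℤ) : ℝ) : ℝ)) *
      torusChar 1 (k.1 - k.2) p.2 with he
  have hec : ∀ k, Continuous (e k) := fun k => by
    have h1 := (continuous_torusChar 1 (k.1 - k.2)).comp
      (continuous_snd : Continuous fun p : ℝ × (Fin 1 → ℝ) => p.2)
    exact Continuous.mul (by fun_prop) h1
  have he1 : ∀ k p, ‖e k p‖ = 1 := fun k p => by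
    rw [he, norm_mul, norm_torusChar, mul_one, norm_exp_I_mul_ofReal]
  have hprod : ∀ k l p, (starRingEnd ℂ) (e k p) * e l p =
      Complex.exp (Complex.I * (p.1 * (((l.2 0 ^ 2 - l.1 0 ^ 2) - (k.2 0 ^ 2 - k.1 0 ^ 2) : ℤ) : ℝ)
        : ℝ)) * torusChar 1 ((l.1 - l.2) - (k.1 - k.2)) p.2 := fun k l p => by
    simp only [he]
    rw [map_mul, ← conj_torusChar_mul 1 (k.1 - k.2) (l.1 - l.2), ← Complex.exp_conj, map_mul,
      Complex.conj_I, Complex.conj_ofReal, mul_mul_mul_comm, ← Complex.exp_add]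
    congr 2
    push_cast; ring
  have hInt : ∀ k l, ∫ p, (starRingEnd ℂ) (e k p) * e l p ∂ν =
      (if (l.2 0 ^ 2 - l.1 0 ^ 2) - (k.2 0 ^ 2 - k.1 0 ^ 2) = 0 then 2 * π else 0 : ℝ) *
        (if (l.1 - l.2) - (k.1 - k.2) = 0 then (2 * π) ^ 1 else 0 : ℝ) := fun k l => by
    simp only [hprod]
    rw [hν, integral_prod_mul (fun t : ℝ => Complex.exp (Complex.I * (t *
      (((l.2 0 ^ 2 - l.1 0 ^ 2) - (k.2 0 ^ 2 - k.1 0 ^ 2) : ℤ) : ℝ) : ℝ))),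
      integral_timeVol_exp, integral_torusChar]
  set b : (Fin 1 → ℤ) × (Fin 1 → ℤ) → ℂ := fun k => a k.1 * (starRingEnd ℂ) (a k.2) with hb
  have hpars := integral_norm_sum_sq (ν := ν) a.support.offDiag e
    (fun k _ => (hec k).measurable) (fun k _ => he1 k) ((2 * π) ^ 2)
    (fun k _ => by rw [hInt]; simp; ring) (fun k hk l hl hne => by
      rw [hInt]
      by_contra hcon
      have h1 : (l.1 - l.2) - (k.1 - k.2) = 0 := by
        by_contra h; exact hcon (by rw [if_neg h]; simp)
      have h2 : (l.2 0 ^ 2 - l.1 0 ^ 2) - (k.2 0 ^ 2 - k.1 0 ^ 2) = 0 := by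
        by_contra h; exact hcon (by rw [if_neg h]; simp)
      have h1' := congrFun h1 0
      simp only [Pi.sub_apply, Pi.zero_apply] at h1'
      have hk' : k.1 0 - k.2 0 ≠ 0 := by
        intro h0
        apply (Finset.mem_offDiag.1 hk).2.2
        funext i; rw [Subsingleton.elim i 0]; omega
      have h3 : (k.1 0 - k.2 0) * ((l.1 0 + l.2 0) - (k.1 0 + k.2 0)) = 0 := by
        have : l.1 0 - l.2 0 = k.1 0 - k.2 0 := by omega
        linear_combination -h2 - (l.1 0 + l.2 0) * this
      have h4 := (mul_eq_zero.1 h3).resolve_left hk'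
      apply hne
      ext i
      · rw [Subsingleton.elim i 0]; omega
      · rw [Subsingleton.elim i 0]; omega) b
  set v : ℝ × (Fin 1 → ℝ) → ℂ := fun p => ∑ k ∈ a.support.offDiag, b k * e k p with hv
  set S := l2Norm 1 a with hS
  have hvc : Continuous v := by fun_prop
  have hsumb : ∑ k ∈ a.support.offDiag, ‖b k‖ ^ 2 ≤ S ^ 4 := by
    calc _ ≤ ∑ k ∈ a.support ×ˢ a.support, ‖b k‖ ^ 2 :=
          Finset.sum_le_sum_of_subset_of_nonneg (fun k hk => by
            rw [Finset.mem_offDiag] at hk; exact Finset.mem_product.2 ⟨hk.1, hk.2.1⟩)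
            fun _ _ _ => by positivity
      _ = S ^ 2 * S ^ 2 := by
          rw [hS, l2Norm_sq, Finset.sum_mul_sum, Finset.sum_product]
          refine Finset.sum_congr rfl fun ξ _ => Finset.sum_congr rfl fun η _ => ?_
          rw [hb, norm_mul, RCLike.norm_conj, mul_pow]
      _ = S ^ 4 := by ring
  have hu : ∀ p, ((‖tWave 1 a p.1 p.2‖ ^ 2 : ℝ) : ℂ) = (S ^ 2 : ℝ) + v p := by
    intro p
    have h1 : ((‖tWave 1 a p.1 p.2‖ ^ 2 : ℝ) : ℂ) =
        ∑ k ∈ a.support ×ˢ a.support, b k * e k p := by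
      rw [← Complex.normSq_eq_norm_sq, ← Complex.mul_conj, tWave_eq_sum, map_sum,
        Finset.sum_mul_sum, Finset.sum_product]
      refine Finset.sum_congr rfl fun ξ _ => Finset.sum_congr rfl fun η _ => ?_
      simp only [hb, he]
      rw [← conj_torusChar_mul, map_mul, map_mul, ← Complex.exp_conj, map_mul, Complex.conj_I,
        Complex.conj_ofReal]
      have : Complex.exp (Complex.I * ((p.1 * ((η 0 ^ 2 - ξ 0 ^ 2 : ℤ) : ℝ) : ℝ) : ℂ)) =
          Complex.exp (Complex.I * (-p.1 * ∑ i, (ξ i : ℝ) ^ 2 : ℝ)) *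
            Complex.exp (-Complex.I * (-p.1 * ∑ i, (η i : ℝ) ^ 2 : ℝ)) := by
        rw [← Complex.exp_add]
        congr 1
        simp only [Finset.univ_unique, Finset.sum_singleton, Fin.default_eq_zero]
        push_cast; ring
      rw [this]; ring
    rw [h1, ← Finset.diag_union_offDiag, Finset.sum_union (Finset.disjoint_diag_offDiag _), hv]
    congr 1
    rw [Finset.sum_diag, hS, l2Norm_sq]
    push_cast
    refine Finset.sum_congr rfl fun ξ _ => ?_
    have : e (ξ, ξ) p = 1 := by simp [he, torusChar]
    simp only [this, hb, mul_one]
    rw [Complex.mul_conj, Complex.normSq_eq_norm_sq]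
    push_cast; rfl
  have hpt : ∀ p, ‖tWave 1 a p.1 p.2‖ ^ 4 ≤ 2 * S ^ 4 + 2 * ‖v p‖ ^ 2 := by
    intro p
    have h1 : ‖tWave 1 a p.1 p.2‖ ^ 2 ≤ S ^ 2 + ‖v p‖ := by
      have := congrArg norm (hu p)
      rw [Complex.norm_real, Real.norm_of_nonneg (by positivity)] at this
      rw [this]
      refine (norm_add_le _ _).trans ?_
      rw [Complex.norm_real, Real.norm_of_nonneg (by positivity)]
    have h2 := pow_le_pow_left₀ (by positivity) h1 2
    nlinarith [sq_nonneg (S ^ 2 - ‖v p‖)]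
  have hvi : Integrable (fun p => ‖v p‖ ^ 2) ν := by
    refine Integrable.of_bound (hvc.norm.pow 2).aestronglyMeasurable
      ((∑ k ∈ a.support.offDiag, ‖b k‖) ^ 2) (Filter.Eventually.of_forall fun p => ?_)
    rw [norm_pow, norm_norm]
    refine pow_le_pow_left₀ (norm_nonneg _) ((norm_sum_le _ _).trans (le_of_eq ?_)) 2
    exact Finset.sum_congr rfl fun k _ => by rw [norm_mul, he1, mul_one]
  calc _ ≤ ∫ p, (2 * S ^ 4 + 2 * ‖v p‖ ^ 2) ∂ν :=
        integral_mono_of_nonneg (Filter.Eventually.of_forall fun p => by positivity)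
          ((integrable_const _).add (hvi.const_mul 2)) (Filter.Eventually.of_forall hpt)
    _ = (2 * π) ^ 2 * (2 * S ^ 4) + 2 * ((2 * π) ^ 2 * ∑ k ∈ a.support.offDiag, ‖b k‖ ^ 2) := by
        rw [integral_add (integrable_const _) (hvi.const_mul 2), integral_const, hVuniv,
          integral_const_mul, hpars, smul_eq_mul]
    _ ≤ (2 * π) ^ 2 * (2 * S ^ 4) + 2 * ((2 * π) ^ 2 * S ^ 4) := by gcongr
    _ = _ := by ring

section DualVector

variable {n : ℕ} {s : Finset (Fin n → ℤ)} {w : (Fin n → ℤ) → ℝ} {g : ℝ × (Fin n → ℝ) → ℂ}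

/-- The weighted vector of spatial Fourier coefficients of `g(t, ·)`, evolved back to time `0`. -/
noncomputable def dualVec (n : ℕ) (s : Finset (Fin n → ℤ)) (w : (Fin n → ℤ) → ℝ)
    (g : ℝ × (Fin n → ℝ) → ℂ) (t : ℝ) : EuclideanSpace ℂ s :=
  WithLp.toLp 2 fun ξ => (√(w ξ) : ℂ) *
    (Complex.exp (Complex.I * (-t * ∑ i, ((ξ : Fin n → ℤ) i : ℝ) ^ 2 : ℝ)) *
      ∫ x, g (t, x) * torusChar n ξ x ∂(torusVol n))

lemma integrable_mul_torusChar (hg : Measurable g) (hg1 : ∀ p, ‖g p‖ ≤ 1) (ξ : Fin n → ℤ) (t : ℝ) :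
    Integrable (fun x => g (t, x) * torusChar n ξ x) (torusVol n) :=
  Integrable.of_bound ((hg.comp measurable_prodMk_left).mul
    (continuous_torusChar n ξ).measurable).aestronglyMeasurable 1
    (Filter.Eventually.of_forall fun x => by rw [norm_mul, norm_torusChar, mul_one]; exact hg1 _)

lemma integrable_norm_slice (hg : Measurable g) (hg1 : ∀ p, ‖g p‖ ≤ 1) (t : ℝ) :
    Integrable (fun x => ‖g (t, x)‖) (torusVol n) :=
  Integrable.of_bound (hg.comp measurable_prodMk_left).norm.aestronglyMeasurable 1
    (Filter.Eventually.of_forall fun x => by rw [norm_norm]; exact hg1 _)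

lemma norm_dualVec_sq_le (hw0 : ∀ ξ, 0 ≤ w ξ) (hw1 : ∀ ξ, w ξ ≤ 1) (hg : Measurable g)
    (hg1 : ∀ p, ‖g p‖ ≤ 1) (t : ℝ) :
    ‖dualVec n s w g t‖ ^ 2 ≤ (2 * π) ^ n * ∫ x, ‖g (t, x)‖ ∂(torusVol n) := by
  rw [EuclideanSpace.norm_sq_eq]
  refine le_trans ?_ (sum_norm_integral_mul_torusChar_sq_le n s (fun x => g (t, x))
    (hg.comp measurable_prodMk_left) fun x => hg1 _)
  rw [← Finset.sum_coe_sort s]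
  refine Finset.sum_le_sum fun ξ _ => ?_
  simp only [dualVec]
  rw [norm_mul, norm_mul, norm_exp_I_mul_ofReal, one_mul, mul_pow, Complex.norm_real,
    Real.norm_of_nonneg (Real.sqrt_nonneg _), Real.sq_sqrt (hw0 _)]
  exact mul_le_of_le_one_left (by positivity) (hw1 _)

lemma inner_dualVec (hw0 : ∀ ξ, 0 ≤ w ξ) (hg : Measurable g)
    (hg1 : ∀ p, ‖g p‖ ≤ 1) (t t' : ℝ) :
    inner ℂ (dualVec n s w g t) (dualVec n s w g t') =
      ∫ x, (starRingEnd ℂ) (g (t, x)) * ∫ y, g (t', y) * (∑ ξ ∈ s, (w ξ : ℂ) *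
        Complex.exp (Complex.I * ((∑ i, (y - x) i * (ξ i : ℝ)) -
          (t' - t) * ∑ i, (ξ i : ℝ) ^ 2 : ℝ))) ∂(torusVol n) ∂(torusVol n) := by
  have hsplit : ∀ (x y : Fin n → ℝ) (ξ : Fin n → ℤ),
      Complex.exp (Complex.I * ((∑ i, (y - x) i * (ξ i : ℝ)) -
        (t' - t) * ∑ i, (ξ i : ℝ) ^ 2 : ℝ)) =
      Complex.exp (Complex.I * ((t - t') * ∑ i, (ξ i : ℝ) ^ 2 : ℝ)) *
        ((starRingEnd ℂ) (torusChar n ξ x) * torusChar n ξ y) := by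
    intro x y ξ
    rw [torusChar, torusChar, ← Complex.exp_conj, ← Complex.exp_add, ← Complex.exp_add]
    congr 1
    rw [map_mul, Complex.conj_I, Complex.conj_ofReal]
    simp only [Pi.sub_apply, sub_mul, Finset.sum_sub_distrib]
    push_cast; ring
  have hy : ∀ x, ∫ y, g (t', y) * (∑ ξ ∈ s, (w ξ : ℂ) *
        Complex.exp (Complex.I * ((∑ i, (y - x) i * (ξ i : ℝ)) -
          (t' - t) * ∑ i, (ξ i : ℝ) ^ 2 : ℝ))) ∂(torusVol n) =
      ∑ ξ ∈ s, (w ξ : ℂ) * Complex.exp (Complex.I * ((t - t') * ∑ i, (ξ i : ℝ) ^ 2 : ℝ)) *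
        (starRingEnd ℂ) (torusChar n ξ x) * ∫ y, g (t', y) * torusChar n ξ y ∂(torusVol n) := by
    intro x
    have e : ∀ y, g (t', y) * (∑ ξ ∈ s, (w ξ : ℂ) *
        Complex.exp (Complex.I * ((∑ i, (y - x) i * (ξ i : ℝ)) -
          (t' - t) * ∑ i, (ξ i : ℝ) ^ 2 : ℝ))) =
        ∑ ξ ∈ s, ((w ξ : ℂ) * Complex.exp (Complex.I * ((t - t') * ∑ i, (ξ i : ℝ) ^ 2 : ℝ)) *
          (starRingEnd ℂ) (torusChar n ξ x)) * (g (t', y) * torusChar n ξ y) := fun y => by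
      rw [Finset.mul_sum]
      refine Finset.sum_congr rfl fun ξ _ => ?_
      rw [hsplit]; ring
    simp only [e]
    rw [integral_finsetSum _ fun ξ _ => (integrable_mul_torusChar hg hg1 ξ t').const_mul _]
    simp only [integral_const_mul]
  have e : ∀ x : Fin n → ℝ, (starRingEnd ℂ) (g (t, x)) * (∑ ξ ∈ s, (w ξ : ℂ) *
      Complex.exp (Complex.I * ((t - t') * ∑ i, (ξ i : ℝ) ^ 2 : ℝ)) *
        (starRingEnd ℂ) (torusChar n ξ x) * ∫ y, g (t', y) * torusChar n ξ y ∂(torusVol n)) =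
      ∑ ξ ∈ s, ((w ξ : ℂ) * Complex.exp (Complex.I * ((t - t') * ∑ i, (ξ i : ℝ) ^ 2 : ℝ)) *
        ∫ y, g (t', y) * torusChar n ξ y ∂(torusVol n)) *
        (starRingEnd ℂ) (g (t, x) * torusChar n ξ x) := fun x => by
    rw [Finset.mul_sum]
    refine Finset.sum_congr rfl fun ξ _ => ?_
    rw [map_mul]; ring
  have hconj : ∀ ξ, Integrable (fun x => (starRingEnd ℂ) (g (t, x) * torusChar n ξ x))
      (torusVol n) := fun ξ => by
    have := integrable_mul_torusChar hg hg1 ξ t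
    exact (Complex.conjCLE.toContinuousLinearMap.integrable_comp this)
  simp only [hy, e]
  rw [integral_finsetSum _ fun ξ _ => (hconj ξ).const_mul _]
  simp only [integral_const_mul, integral_conj]
  rw [PiLp.inner_apply, ← Finset.sum_coe_sort s]
  refine Finset.sum_congr rfl fun ξ _ => ?_
  simp only [dualVec, RCLike.inner_apply]
  rw [map_mul, map_mul, Complex.conj_ofReal, ← Complex.exp_conj, map_mul, Complex.conj_I,
    Complex.conj_ofReal]
  have h1 : (w ξ : ℂ) = (√(w ξ) : ℂ) * (√(w ξ) : ℂ) := by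
    rw [← Complex.ofReal_mul, Real.mul_self_sqrt (hw0 _)]
  have h2 : Complex.exp (Complex.I * ((t - t') * ∑ i, ((ξ : Fin n → ℤ) i : ℝ) ^ 2 : ℝ)) =
      Complex.exp (Complex.I * (-t' * ∑ i, ((ξ : Fin n → ℤ) i : ℝ) ^ 2 : ℝ)) *
        Complex.exp (-Complex.I * (-t * ∑ i, ((ξ : Fin n → ℤ) i : ℝ) ^ 2 : ℝ)) := by
    rw [← Complex.exp_add]; congr 1; push_cast; ring
  rw [h2, h1]
  ring

lemma norm_inner_dualVec_le (hw0 : ∀ ξ, 0 ≤ w ξ) (hg : Measurable g)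
    (hg1 : ∀ p, ‖g p‖ ≤ 1) {t t' κ : ℝ}
    (hK : ∀ x : Fin n → ℝ, ‖∑ ξ ∈ s, (w ξ : ℂ) *
      Complex.exp (Complex.I * ((∑ i, x i * (ξ i : ℝ)) -
        (t - t') * ∑ i, (ξ i : ℝ) ^ 2 : ℝ))‖ ≤ κ) :
    ‖inner ℂ (dualVec n s w g t) (dualVec n s w g t')‖ ≤
      κ * ((∫ x, ‖g (t, x)‖ ∂(torusVol n)) * ∫ x, ‖g (t', x)‖ ∂(torusVol n)) := by
  rw [norm_inner_symm, inner_dualVec hw0 hg hg1]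
  have hi := fun t => integrable_norm_slice hg hg1 t
  have e : κ * ((∫ x, ‖g (t, x)‖ ∂(torusVol n)) * ∫ x, ‖g (t', x)‖ ∂(torusVol n)) =
      ∫ x, ‖g (t', x)‖ * ∫ y, ‖g (t, y)‖ * κ ∂(torusVol n) ∂(torusVol n) := by
    rw [integral_mul_const, integral_mul_const]; ring
  rw [e]
  refine norm_integral_le_of_norm_le ((hi t').mul_const _) (Filter.Eventually.of_forall fun x => ?_)
  rw [norm_mul, RCLike.norm_conj]
  refine mul_le_mul_of_nonneg_left (norm_integral_le_of_norm_le ((hi t).mul_const _)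
    (Filter.Eventually.of_forall fun y => ?_)) (norm_nonneg _)
  rw [norm_mul]
  exact mul_le_mul_of_nonneg_left (hK _) (norm_nonneg _)

lemma measurable_dualVec (hg : Measurable g) : Measurable (dualVec n s w g) := by
  refine (WithLp.measurable_toLp 2 _).comp (measurable_pi_lambda _ fun ξ => ?_)
  have h1 : StronglyMeasurable fun t => ∫ x, g (t, x) * torusChar n ξ x ∂(torusVol n) := by
    refine StronglyMeasurable.integral_prod_right
      (f := fun t x => g (t, x) * torusChar n ξ x) (Measurable.stronglyMeasurable ?_)
    exact hg.mul ((continuous_torusChar n ξ).measurable.comp measurable_snd)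
  exact measurable_const.mul (Measurable.mul (by fun_prop) h1.measurable)

lemma measurable_integral_norm_slice (hg : Measurable g) :
    Measurable fun t => ∫ x, ‖g (t, x)‖ ∂(torusVol n) :=
  (StronglyMeasurable.integral_prod_right (f := fun t x => ‖g (t, x)‖)
    hg.norm.stronglyMeasurable).measurable

lemma integral_norm_slice_le (hg1 : ∀ p, ‖g p‖ ≤ 1) (t : ℝ) :
    ∫ x, ‖g (t, x)‖ ∂(torusVol n) ≤ (2 * π) ^ n := by
  refine (integral_mono_of_nonneg (Filter.Eventually.of_forall fun _ => norm_nonneg _)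
    (integrable_const (1 : ℝ)) (Filter.Eventually.of_forall fun x => hg1 _)).trans ?_
  rw [integral_const, torusVol_real_univ, smul_eq_mul, mul_one]

lemma integrable_dualVec (hw0 : ∀ ξ, 0 ≤ w ξ) (hw1 : ∀ ξ, w ξ ≤ 1) (hg : Measurable g)
    (hg1 : ∀ p, ‖g p‖ ≤ 1) : Integrable (dualVec n s w g) timeVol :=
  integrable_of_sq_le (measurable_dualVec hg).stronglyMeasurable
    (norm_dualVec_sq_le hw0 hw1 hg hg1) (by positivity) (integral_norm_slice_le hg1)

/-- Pairing with a wave is controlled by the time integral of the dual vector. -/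
lemma norm_integral_mul_tWave_sq_le {a : (Fin n → ℤ) →₀ ℂ} (hs : a.support ⊆ s)
    (hw0 : ∀ ξ, 0 < w ξ) (hw1 : ∀ ξ, w ξ ≤ 1) {ω : ℝ} (hω : 0 < ω) (hwa : ∀ ξ ∈ a.support, ω ≤ w ξ)
    (hg : Measurable g) (hg1 : ∀ p, ‖g p‖ ≤ 1) :
    ‖∫ p, g p * tWave n a p.1 p.2 ∂(timeVol.prod (torusVol n))‖ ^ 2 ≤
      ω⁻¹ * l2Norm n a ^ 2 * ‖∫ t, dualVec n s w g t ∂timeVol‖ ^ 2 := by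
  set b : EuclideanSpace ℂ s := WithLp.toLp 2 fun ξ => (starRingEnd ℂ) (a ξ) / (√(w ξ) : ℂ) with hb
  have hbn : ‖b‖ ^ 2 ≤ ω⁻¹ * l2Norm n a ^ 2 := by
    rw [EuclideanSpace.norm_sq_eq, l2Norm_sq, Finset.mul_sum]
    rw [Finset.sum_subset hs (f := fun ξ => ω⁻¹ * ‖a ξ‖ ^ 2)
      (fun ξ _ h => by rw [Finsupp.notMem_support_iff.1 h]; simp), ← Finset.sum_coe_sort s]
    refine Finset.sum_le_sum fun ξ _ => ?_
    simp only [hb]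
    rw [norm_div, RCLike.norm_conj, Complex.norm_real, Real.norm_of_nonneg (Real.sqrt_nonneg _),
      div_pow, Real.sq_sqrt (hw0 _).le, div_eq_inv_mul]
    by_cases h : (ξ : Fin n → ℤ) ∈ a.support
    · have := hwa _ h
      gcongr
    · rw [Finsupp.notMem_support_iff.1 h]; simp
  have hinner : ∀ t, inner ℂ b (dualVec n s w g t) =
      ∫ x, g (t, x) * tWave n a t x ∂(torusVol n) := by
    intro t
    have e : ∀ x, g (t, x) * tWave n a t x = ∑ ξ ∈ s, (a ξ *
        Complex.exp (Complex.I * (-t * ∑ i, (ξ i : ℝ) ^ 2 : ℝ))) *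
          (g (t, x) * torusChar n ξ x) := fun x => by
      rw [tWave_eq_sum, Finset.mul_sum, Finset.sum_subset hs]
      · exact Finset.sum_congr rfl fun ξ _ => by ring
      · intro ξ _ h; rw [Finsupp.notMem_support_iff.1 h]; simp
    simp only [e]
    rw [integral_finsetSum _ fun ξ _ => (integrable_mul_torusChar hg hg1 ξ t).const_mul _,
      PiLp.inner_apply, ← Finset.sum_coe_sort s]
    refine Finset.sum_congr rfl fun ξ _ => ?_
    have h0 : (√(w ξ) : ℂ) ≠ 0 := by exact_mod_cast (Real.sqrt_pos.2 (hw0 _)).ne'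
    simp only [hb, dualVec, RCLike.inner_apply]
    rw [integral_const_mul, map_div₀, Complex.conj_conj, Complex.conj_ofReal]
    field_simp
  obtain ⟨K, hK⟩ : ∃ K, ∀ p : ℝ × (Fin n → ℝ), ‖tWave n a p.1 p.2‖ ≤ K := by
    refine ⟨∑ ξ ∈ a.support, ‖a ξ‖, fun p => (norm_sum_le _ _).trans
      (Finset.sum_le_sum fun ξ _ => ?_)⟩
    rw [norm_mul, norm_exp_I_mul_ofReal, mul_one]
  have hint : Integrable (fun p : ℝ × (Fin n → ℝ) => g p * tWave n a p.1 p.2)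
      (timeVol.prod (torusVol n)) :=
    Integrable.of_bound (hg.mul (continuous_tWave n a).measurable).aestronglyMeasurable K
      (Filter.Eventually.of_forall fun p => by
        rw [norm_mul]
        exact (mul_le_of_le_one_left (norm_nonneg _) (hg1 p)).trans (hK p))
  rw [integral_prod _ hint]
  simp only [← hinner]
  rw [integral_inner (integrable_dualVec (fun ξ => (hw0 ξ).le) hw1 hg hg1)]
  refine (pow_le_pow_left₀ (norm_nonneg _) (norm_inner_le_norm _ _) 2).trans ?_
  rw [mul_pow]
  gcongr

end DualVector

section LevelSets

/-- The time differences whose quotient by `π` lies in the major arcs. -/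
def arcSet (Q δ : ℝ) : Set ℝ := {u | u / π ∈ majorArcs Q δ ∩ Set.Icc (-2) 2}

lemma measurableSet_arcSet (Q δ : ℝ) : MeasurableSet (arcSet Q δ) :=
  (measurable_id.div_const π) ((measurableSet_majorArcs Q δ).inter measurableSet_Icc)

lemma volume_preimage_div_pi (T : Set ℝ) :
    volume {u : ℝ | u / π ∈ T} = ENNReal.ofReal π * volume T := by
  have := Real.volume_preimage_mul_right (a := π⁻¹) (inv_ne_zero pi_ne_zero) T
  rw [inv_inv, abs_of_pos pi_pos] at this
  exact this

lemma volume_arcSet_le {Q δ : ℝ} (hQ : 0 ≤ Q) (hδ : 0 ≤ δ) :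
    volume (arcSet Q δ) ≤ ENNReal.ofReal (12 * π * Q * δ) := by
  rw [arcSet, volume_preimage_div_pi, show 12 * π * Q * δ = π * (12 * Q * δ) by ring,
    ENNReal.ofReal_mul pi_pos.le]
  gcongr
  exact volume_majorArcs_le Q δ hQ hδ

/-- The Gaussian weight on frequencies at scale `N`. -/
noncomputable def gaussWeight (n : ℕ) (N : ℝ) (ξ : Fin n → ℤ) : ℝ :=
  Real.exp (-((∑ i, (ξ i : ℝ) ^ 2) / N ^ 2))

lemma gaussWeight_pos (n : ℕ) (N : ℝ) (ξ : Fin n → ℤ) : 0 < gaussWeight n N ξ := Real.exp_pos _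

lemma gaussWeight_le_one (n : ℕ) (N : ℝ) (ξ : Fin n → ℤ) : gaussWeight n N ξ ≤ 1 :=
  Real.exp_le_one_iff.2 (neg_nonpos.2 (by positivity))

lemma exp_neg_one_le_gaussWeight {n : ℕ} {N : ℝ} (hN : 1 ≤ N) {ξ : Fin n → ℤ}
    (hξ : znorm n ξ ≤ N) : Real.exp (-1) ≤ gaussWeight n N ξ := by
  refine Real.exp_le_exp.2 (neg_le_neg ?_)
  rw [div_le_one (by positivity)]
  exact (Real.sqrt_le_left (by linarith)).1 hξ

/-- The frequency cube of side `2 * M + 1`. -/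
noncomputable abbrev freqCube (n M : ℕ) : Finset (Fin n → ℤ) :=
  Fintype.piFinset fun _ : Fin n => Finset.Icc (-(M : ℤ)) M

variable {n : ℕ} {N : ℝ} {a : (Fin n → ℤ) →₀ ℂ}

/-- The set where a wave exceeds a multiple of its `ℓ²` norm. -/
def superlevel (n : ℕ) (a : (Fin n → ℤ) →₀ ℂ) (r : ℝ) : Set (ℝ × (Fin n → ℝ)) :=
  {p | r * l2Norm n a < ‖tWave n a p.1 p.2‖}

lemma measurableSet_superlevel (r : ℝ) : MeasurableSet (superlevel n a r) :=
  measurableSet_lt measurable_const (continuous_tWave n a).measurable.norm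

/-- Duality: the measure of a superlevel set is controlled by a dual vector. -/
lemma exists_dualVec_superlevel (hN : 1 ≤ N) (ha : ∀ ξ ∈ a.support, znorm n ξ ≤ N)
    (ha0 : 0 < l2Norm n a) {r : ℝ} (hr : 0 < r) :
    ∃ g : ℝ × (Fin n → ℝ) → ℂ, Measurable g ∧ (∀ p, ‖g p‖ ≤ 1) ∧
      (∀ t ∉ Set.Icc 0 (2 * π), ∀ x, g (t, x) = 0) ∧
      ∫ t, ∫ x, ‖g (t, x)‖ ∂(torusVol n) ∂timeVol =
        (timeVol.prod (torusVol n)).real (superlevel n a r) ∧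
      ∀ M ≥ ⌊N⌋₊, r ^ 2 * (timeVol.prod (torusVol n)).real (superlevel n a r) ^ 2 ≤
        Real.exp 1 * ‖∫ t, dualVec n (freqCube n M) (gaussWeight n N) g t ∂timeVol‖ ^ 2 := by
  classical
  set ν := timeVol.prod (torusVol n) with hν
  set U : ℝ × (Fin n → ℝ) → ℂ := fun p => tWave n a p.1 p.2 with hU
  have hUm : Measurable U := (continuous_tWave n a).measurable
  set E : Set (ℝ × (Fin n → ℝ)) := superlevel n a r ∩ {p | p.1 ∈ Set.Icc 0 (2 * π)} with hE
  have hEm : MeasurableSet E := (measurableSet_superlevel r).inter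
    (measurable_fst measurableSet_Icc)
  have hEν : ν.real E = ν.real (superlevel n a r) := by
    have hbox : ∀ᵐ p ∂ν, p ∈ stBox n := by
      rw [hν, ← volume_restrict_stBox]
      exact ae_restrict_mem (measurableSet_Icc.prod
        (MeasurableSet.univ_pi fun _ => measurableSet_Icc))
    refine measureReal_congr ?_
    filter_upwards [hbox] with p hp
    exact propext ⟨fun h => h.1, fun h => ⟨h, hp.1⟩⟩
  set g : ℝ × (Fin n → ℝ) → ℂ := E.indicator fun p => (starRingEnd ℂ) (U p) / (‖U p‖ : ℂ) with hg
  have hUpos : ∀ p ∈ E, r * l2Norm n a < ‖U p‖ := fun p hp => hp.1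
  have hgE : ∀ p ∈ E, g p * U p = ‖U p‖ := by
    intro p hp
    have h1 : (‖U p‖ : ℂ) ≠ 0 := by
      exact_mod_cast ((by positivity : 0 < r * l2Norm n a).trans (hUpos p hp)).ne'
    rw [hg, Set.indicator_of_mem hp, div_mul_eq_mul_div, ← Complex.normSq_eq_conj_mul_self,
      Complex.normSq_eq_norm_sq, div_eq_iff h1]
    push_cast; ring
  have hgnorm : ∀ p, ‖g p‖ = E.indicator 1 p := by
    intro p
    by_cases hp : p ∈ E
    · have h1 : ‖U p‖ ≠ 0 := ((by positivity : 0 < r * l2Norm n a).trans (hUpos p hp)).ne'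
      rw [hg, Set.indicator_of_mem hp, Set.indicator_of_mem hp, norm_div, RCLike.norm_conj,
        Complex.norm_real, norm_norm, div_self h1, Pi.one_apply]
    · rw [hg, Set.indicator_of_notMem hp, Set.indicator_of_notMem hp, norm_zero]
  have hgm : Measurable g := ((Complex.continuous_conj.measurable.comp hUm).div
    (Complex.measurable_ofReal.comp hUm.norm)).indicator hEm
  have hg1 : ∀ p, ‖g p‖ ≤ 1 := fun p => by
    rw [hgnorm]; exact Set.indicator_le_self' (fun _ _ => zero_le_one) p
  have hgi : Integrable (fun p => ‖g p‖) ν := Integrable.of_bound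
    hgm.norm.aestronglyMeasurable 1 (Filter.Eventually.of_forall fun p => by
      rw [norm_norm]; exact hg1 p)
  have hm : ∫ p, ‖g p‖ ∂ν = ν.real (superlevel n a r) := by
    simp only [hgnorm]
    rw [integral_indicator_one hEm, hEν]
  refine ⟨g, hgm, hg1, fun t ht x => Set.indicator_of_notMem (fun h => ht h.2) _, ?_, ?_⟩
  · rw [← hm, hν, integral_prod _ hgi]
  · intro M hM
    have h1 := norm_integral_mul_tWave_sq_le (support_subset_piFinset ha hM)
      (gaussWeight_pos n N) (gaussWeight_le_one n N) (Real.exp_pos (-1))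
      (fun ξ hξ => exp_neg_one_le_gaussWeight hN (ha ξ hξ)) hgm hg1
    have h2 : (r * l2Norm n a) * ν.real (superlevel n a r) ≤ ‖∫ p, g p * U p ∂ν‖ := by
      have e : ∀ p, g p * U p = ((E.indicator (fun p => ‖U p‖) p : ℝ) : ℂ) := fun p => by
        by_cases hp : p ∈ E
        · rw [hgE p hp, Set.indicator_of_mem hp]
        · rw [hg, Set.indicator_of_notMem hp, Set.indicator_of_notMem hp, zero_mul,
            Complex.ofReal_zero]
      have hUi : Integrable (E.indicator fun p => ‖U p‖) ν := by
        have : Integrable (fun p => g p * U p) ν := by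
          refine Integrable.of_bound (hgm.mul hUm).aestronglyMeasurable
            ((3 * N) ^ ((n : ℝ) / 2) * l2Norm n a) (Filter.Eventually.of_forall fun p => ?_)
          rw [norm_mul]
          exact (mul_le_of_le_one_left (norm_nonneg _) (hg1 p)).trans (norm_tWave_le hN ha _ _)
        have h := this.norm
        refine h.congr (Filter.Eventually.of_forall fun p => ?_)
        simp only [e, Complex.norm_real]
        exact Real.norm_of_nonneg (Set.indicator_nonneg (fun _ _ => norm_nonneg _) p)
      simp only [e]
      rw [integral_complex_ofReal, Complex.norm_real]
      refine le_trans ?_ (le_abs_self _)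
      rw [← hm, ← integral_const_mul]
      refine integral_mono (hgi.const_mul _) hUi fun p => ?_
      simp only [hgnorm]
      by_cases hp : p ∈ E
      · rw [Set.indicator_of_mem hp, Set.indicator_of_mem hp, Pi.one_apply, mul_one]
        exact (hUpos p hp).le
      · rw [Set.indicator_of_notMem hp, Set.indicator_of_notMem hp, mul_zero]
    have h3 := (pow_le_pow_left₀ (by positivity) h2 2).trans h1
    rw [← Real.exp_neg, neg_neg] at h3
    have h4 : 0 < l2Norm n a ^ 2 := by positivity
    refine le_of_mul_le_mul_left ?_ h4
    calc _ = (r * l2Norm n a * ν.real (superlevel n a r)) ^ 2 := by ring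
      _ ≤ _ := h3
      _ = _ := by ring

lemma norm_inner_dualVec_gauss_le {g : ℝ × (Fin n → ℝ) → ℂ} (hg : Measurable g)
    (hg1 : ∀ p, ‖g p‖ ≤ 1) (hg0 : ∀ t ∉ Set.Icc 0 (2 * π), ∀ x, g (t, x) = 0) {M : ℕ} {Q δ κ : ℝ}
    (hK : ∀ (t : ℝ) (x : Fin n → ℝ), t / π ∉ majorArcs Q δ → ‖gaussKernel n M N t x‖ ≤ κ)
    {t s : ℝ} (hts : t - s ∉ arcSet Q δ) :
    ‖inner ℂ (dualVec n (freqCube n M) (gaussWeight n N) g t)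
      (dualVec n (freqCube n M) (gaussWeight n N) g s)‖ ≤
      κ * ((∫ x, ‖g (t, x)‖ ∂(torusVol n)) * ∫ x, ‖g (s, x)‖ ∂(torusVol n)) := by
  have hz : ∀ t ∉ Set.Icc 0 (2 * π), dualVec n (freqCube n M) (gaussWeight n N) g t = 0 ∧
      ∫ x, ‖g (t, x)‖ ∂(torusVol n) = 0 := by
    intro t ht
    constructor
    · ext ξ
      simp [dualVec, hg0 t ht]
    · simp [hg0 t ht]
  by_cases ht : t ∈ Set.Icc 0 (2 * π)
  · by_cases hs : s ∈ Set.Icc 0 (2 * π)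
    · refine norm_inner_dualVec_le (fun ξ => (gaussWeight_pos n N ξ).le) hg hg1 fun x => ?_
      refine hK (t - s) x fun h => hts ⟨h, ?_⟩
      rw [Set.mem_Icc, le_div_iff₀ pi_pos, div_le_iff₀ pi_pos]
      exact ⟨by linarith [ht.1, hs.2], by linarith [ht.2, hs.1]⟩
    · rw [(hz s hs).1, (hz s hs).2]; simp
  · rw [(hz t ht).1, (hz t ht).2]; simp

end LevelSets

lemma real_superlevel_le_total (n : ℕ) (a : (Fin n → ℤ) →₀ ℂ) (r : ℝ) :
    (timeVol.prod (torusVol n)).real (superlevel n a r) ≤ (2 * π) ^ (n + 1) := by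
  have h : (timeVol.prod (torusVol n)).real Set.univ = (2 * π) ^ (n + 1) := by
    rw [← Set.univ_prod_univ, measureReal_prod_prod, timeVol_real_univ, torusVol_real_univ]
    ring
  rw [← h]
  exact measureReal_mono (Set.subset_univ _)

/-- A weak-type Strichartz estimate valid at every height. -/
lemma exists_real_superlevel_le (n : ℕ) (hn : 1 ≤ n) : ∃ C > 0, ∀ (N : ℝ) (a : (Fin n → ℤ) →₀ ℂ)
    (r : ℝ), 1 ≤ N → (∀ ξ ∈ a.support, znorm n ξ ≤ N) → 0 < l2Norm n a → 0 < r →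
    (timeVol.prod (torusVol n)).real (superlevel n a r) ≤ C * N ^ 2 * r ^ (-(2 + 8 / n) : ℝ) := by
  obtain ⟨C₁, hC₁, hker⟩ := exists_norm_gaussKernel_le n
  have hn0 : (0 : ℝ) < n := by exact_mod_cast hn
  set e := Real.exp 1 with he
  have he0 : 0 < e := Real.exp_pos 1
  set C₂ : ℝ := 4 * C₁ * ((2 * e) ^ (1 / n : ℝ)) ^ 2 with hC₂
  have hC₂0 : 0 < C₂ := by positivity
  set V : ℝ := (2 * π) ^ n with hV
  have hV0 : 0 < V := by positivity
  set Ca : ℝ := (2 * π) ^ (n + 1) * C₂ ^ (2 + n / 2 : ℝ) with hCa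
  set Cb : ℝ := 24 * e * V * π ^ 2 * C₂ ^ 2 with hCb
  have hCa0 : 0 < Ca := by positivity
  have hCb0 : 0 < Cb := by positivity
  refine ⟨Ca + Cb, by positivity, fun N a r hN ha ha0 hr => ?_⟩
  set m := (timeVol.prod (torusVol n)).real (superlevel n a r) with hm
  have hm0 : 0 ≤ m := measureReal_nonneg
  set y : ℝ := r ^ (-(4 / n) : ℝ) with hy
  have hy0 : 0 < y := by positivity
  have hry : r ^ (-(2 + 8 / n) : ℝ) = (r ^ 2)⁻¹ * y ^ 2 := by
    rw [hy, ← Real.rpow_natCast (r ^ (-(4 / n) : ℝ)), ← Real.rpow_mul hr.le, ← Real.rpow_natCast r,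
      ← Real.rpow_neg hr.le, ← Real.rpow_add hr]
    congr 1
    push_cast; ring
  have hry' : r ^ (-(2 + 8 / n) : ℝ) = y ^ (2 + n / 2 : ℝ) := by
    rw [hy, ← Real.rpow_mul hr.le]
    congr 1
    field_simp; ring
  have hNsq : 1 ≤ N ^ 2 := one_le_pow₀ hN
  rcases lt_or_ge 1 (C₂ * y) with hδ | hδ
  · calc m ≤ (2 * π) ^ (n + 1) * 1 := by rw [mul_one]; exact real_superlevel_le_total n a r
      _ ≤ (2 * π) ^ (n + 1) * (C₂ * y) ^ (2 + n / 2 : ℝ) := by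
          gcongr
          exact Real.one_le_rpow hδ.le (by positivity)
      _ = Ca * 1 * r ^ (-(2 + 8 / n) : ℝ) := by
          rw [Real.mul_rpow hC₂0.le hy0.le, hry', hCa]; ring
      _ ≤ (Ca + Cb) * N ^ 2 * r ^ (-(2 + 8 / n) : ℝ) := by gcongr; linarith
  · set κ := r ^ 2 / (2 * e) with hκ
    have hκ0 : 0 < κ := by positivity
    set μ := κ ^ (1 / n : ℝ) / 2 with hμ
    have hμ0 : 0 < μ := by positivity
    have hμn : (2 * μ) ^ n = κ := by
      rw [hμ, mul_div_cancel₀ _ (two_ne_zero), one_div]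
      exact Real.rpow_inv_natCast_pow hκ0.le (by omega)
    have hδeq : C₁ / μ ^ 2 = C₂ * y := by
      have h1 : (κ ^ (1 / n : ℝ)) ^ 2 * ((2 * e) ^ (1 / n : ℝ)) ^ 2 * y = 1 := by
        rw [← mul_pow, ← Real.mul_rpow hκ0.le (by positivity), hκ,
          div_mul_cancel₀ _ (by positivity), hy, ← Real.rpow_natCast, ← Real.rpow_natCast,
          ← Real.rpow_mul hr.le, ← Real.rpow_mul hr.le, ← Real.rpow_add hr]
        convert Real.rpow_zero r using 2
        push_cast; ring
      rw [div_eq_iff (by positivity), hC₂, hμ]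
      linear_combination (-C₁) * h1
    set δ := C₁ / μ ^ 2 with hδd
    have hδ0 : 0 < δ := by positivity
    obtain ⟨M₀, hM₀⟩ := hker N μ (by linarith) hμ0 (hδeq.le.trans hδ)
    obtain ⟨g, hg, hg1, hg0, hgm, hdual⟩ := exists_dualVec_superlevel hN ha ha0 hr
    have hd := hdual (max M₀ ⌊N⌋₊) (le_max_right _ _)
    set Q := π * N ^ 2 * δ with hQ
    have hmain := norm_integral_sq_le (ν := timeVol) (B := arcSet Q δ) (κ := κ)
      (β := 12 * π * Q * δ) Measure.restrict_le_self
      (measurable_dualVec (n := n) (s := freqCube n (max M₀ ⌊N⌋₊)) (w := gaussWeight n N)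
        hg).stronglyMeasurable
      (measurable_integral_norm_slice hg) (fun t => integral_nonneg fun _ => norm_nonneg _)
      (integral_norm_slice_le hg1) hV0.le
      (norm_dualVec_sq_le (fun ξ => (gaussWeight_pos n N ξ).le) (gaussWeight_le_one n N) hg hg1)
      (measurableSet_arcSet Q δ)
      (fun t s hts => norm_inner_dualVec_gauss_le hg hg1 hg0
        (fun t x h => (hM₀ _ (le_max_left _ _) t x h).trans hμn.le) hts)
      hκ0.le (by positivity) (volume_arcSet_le (by positivity) hδ0.le)
    rw [hgm] at hmain
    have h1 : r ^ 2 * m ^ 2 ≤ e * (κ * m ^ 2 + V * (12 * π * Q * δ) * m) :=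
      hd.trans (mul_le_mul_of_nonneg_left hmain he0.le)
    have h2 : e * κ = r ^ 2 / 2 := by rw [hκ]; field_simp
    have h3 : m * (r ^ 2 * m) ≤ m * (2 * e * V * (12 * π * Q * δ)) := by
      have : e * (κ * m ^ 2 + V * (12 * π * Q * δ) * m) =
        r ^ 2 / 2 * m ^ 2 + e * V * (12 * π * Q * δ) * m := by rw [← h2]; ring
      rw [this] at h1
      linarith
    rcases hm0.eq_or_lt with hmz | hmp
    · rw [← hmz]; positivity
    have h4 := le_of_mul_le_mul_left h3 hmp
    calc m ≤ (r ^ 2)⁻¹ * (2 * e * V * (12 * π * Q * δ)) := by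
          rw [inv_mul_eq_div, le_div_iff₀ (by positivity)]; linarith
      _ = Cb * N ^ 2 * r ^ (-(2 + 8 / n) : ℝ) := by
          rw [hry, hQ, hδeq, hCb]; ring
      _ ≤ (Ca + Cb) * N ^ 2 * r ^ (-(2 + 8 / n) : ℝ) := by gcongr; linarith

/-- The overlap of two translates of `arcSet Q δ` is small unless the shift lies in a smaller
family of major arcs. -/
lemma timeVol_real_inter_arcSet_le {Q δ D δ' c s s' : ℝ} (hc : 0 ≤ c)
    (hT : ∀ h ∉ majorArcs D δ',
      volume {σ : ℝ | σ ∈ Set.Icc (-2) 2 ∧ σ ∈ majorArcs Q δ ∧ σ + h ∈ majorArcs Q δ} ≤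
        ENNReal.ofReal c)
    (hss : (s - s') / π ∉ majorArcs D δ') :
    timeVol.real {t | t - s ∈ arcSet Q δ ∧ t - s' ∈ arcSet Q δ} ≤ π * c := by
  refine ENNReal.toReal_le_of_le_ofReal (by positivity) ((Measure.restrict_le_self _).trans ?_)
  set T : Set ℝ := {σ : ℝ | σ ∈ Set.Icc (-2) 2 ∧ σ ∈ majorArcs Q δ ∧
    σ + (s - s') / π ∈ majorArcs Q δ} with hTdef
  have hsub : {t | t - s ∈ arcSet Q δ ∧ t - s' ∈ arcSet Q δ} ⊆
      (fun t => t + -s) ⁻¹' {u | u / π ∈ T} := by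
    rintro t ⟨h1, h2⟩
    refine ⟨?_, ?_, ?_⟩
    · simpa [sub_eq_add_neg] using h1.2
    · simpa [sub_eq_add_neg] using h1.1
    · have := h2.1
      rwa [show t - s' = (t + -s) + (s - s') by ring, add_div] at this
  refine (measure_mono hsub).trans ?_
  rw [measure_preimage_add_right, volume_preimage_div_pi, ENNReal.ofReal_mul pi_pos.le]
  gcongr
  exact hT _ hss

lemma overlap_constant_le {P δ C κ : ℝ} (hP : 1 ≤ P) (hδ : 0 < δ) (hC : 0 < C) (hκ : 0 < κ)
    (hCP : C ≤ P) (hδP : δ * P ^ 30 * C ≤ 6) :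
    π * (C * P * (δ ^ 2 * (P ^ 20) ^ 2 + δ * P ^ 20 / P ^ 14)) * (P ^ 3 * κ) ≤
      κ * (12 * π * P ^ 14 * δ) := by
  have h2 : C ≤ P ^ 4 := hCP.trans (le_self_pow₀ hP (by norm_num))
  have h3 : π * (C * P * (δ ^ 2 * (P ^ 20) ^ 2 + δ * P ^ 20 / P ^ 14)) * (P ^ 3 * κ) =
      (π * κ * δ * P ^ 10) * ((δ * P ^ 30 * C) * P ^ 4 + C) := by
    have : δ * P ^ 20 / P ^ 14 = δ * P ^ 6 := by field_simp
    rw [this]; ring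
  have h4 : κ * (12 * π * P ^ 14 * δ) = (π * κ * δ * P ^ 10) * (12 * P ^ 4) := by ring
  rw [h3, h4]
  refine mul_le_mul_of_nonneg_left ?_ (by positivity)
  have h5 := mul_le_mul_of_nonneg_right hδP (by positivity : 0 ≤ P ^ 4)
  linarith

lemma le_of_sq_mul_sq_le {r m e κ θ V ρ β β' : ℝ} (hr : 0 < r) (hm : 0 ≤ m) (he : 0 < e)
    (hV : 0 < V) (hθ : 0 < θ) (hκ : e * κ = r ^ 2 / 4) (hρ : ρ ≤ κ * θ) (hβ : β * β' = θ * θ)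
    (h : r ^ 2 * m ^ 2 ≤ e * (κ * m ^ 2 + θ * V * m + (ρ * m ^ 2 + V * β * β' * m) / θ)) :
    m ≤ (r ^ 2)⁻¹ * (4 * e * V * θ) := by
  have hlast : (ρ * m ^ 2 + V * β * β' * m) / θ ≤ κ * m ^ 2 + V * θ * m := by
    rw [div_le_iff₀ hθ, mul_assoc V, hβ]
    have := mul_le_mul_of_nonneg_right hρ (sq_nonneg m)
    linarith
  have h1 : r ^ 2 * m ^ 2 ≤ e * (2 * κ * m ^ 2 + 2 * V * θ * m) := by
    refine h.trans (mul_le_mul_of_nonneg_left ?_ he.le)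
    linarith
  have h3 : m * (r ^ 2 * m) ≤ m * (4 * e * V * θ) := by
    have : e * (2 * κ * m ^ 2 + 2 * V * θ * m) =
        r ^ 2 / 2 * m ^ 2 + 2 * e * V * θ * m := by
      linear_combination (2 * m ^ 2) * hκ
    rw [this] at h1
    linarith
  rcases hm.eq_or_lt with hmz | hmp
  · rw [← hmz]; positivity
  · rw [inv_mul_eq_div, le_div_iff₀ (by positivity)]
    linarith [le_of_mul_le_mul_left h3 hmp]

/-- An improved weak-type estimate on the one-dimensional torus at large heights. -/
lemma exists_real_superlevel_one_le : ∃ C > 0, ∃ K > 0, ∀ (N : ℝ) (a : (Fin 1 → ℤ) →₀ ℂ)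
    (r : ℝ), 1 ≤ N → (∀ ξ ∈ a.support, znorm 1 ξ ≤ N) → 0 < l2Norm 1 a → 0 < r →
    K * N ^ (3 / 10 : ℝ) ≤ r →
    (timeVol.prod (torusVol 1)).real (superlevel 1 a r) ≤
      C * N ^ (7 / 5 : ℝ) * r ^ (-(44 / 5) : ℝ) := by
  obtain ⟨C₁, hC₁, hker⟩ := exists_norm_gaussKernel_le 1
  obtain ⟨CA, hCA, hweak⟩ := exists_real_superlevel_le 1 le_rfl
  obtain ⟨C₃, hC₃, hover⟩ := exists_volume_inter_majorArcs_le
  set e := Real.exp 1 with he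
  have he0 : 0 < e := Real.exp_pos 1
  set C₂ : ℝ := 64 * e ^ 2 * C₁ with hC₂
  have hC₂0 : 0 < C₂ := by positivity
  set V : ℝ := (2 * π) ^ 1 with hV
  have hV0 : 0 < V := by positivity
  set w : ℝ := (π * C₂) ^ (1 / 20 : ℝ) with hw
  have hw0 : 0 < w := by positivity
  have hw20 : w ^ 20 = π * C₂ := by
    rw [hw, ← Real.rpow_natCast, ← Real.rpow_mul (by positivity)]; norm_num
  set Ca : ℝ := CA * ((1 + C₃) / w) ^ 6 with hCa
  set Cb : ℝ := 48 * π * e * V * C₂ * w ^ 14 with hCb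
  have hCa0 : 0 < Ca := by positivity
  have hCb0 : 0 < Cb := by positivity
  set K : ℝ := 1 + C₂ + C₃ ^ 2 * π ^ 3 * C₂ ^ 5 with hK
  have hK1 : 1 ≤ K := by
    have : 0 < C₃ ^ 2 * π ^ 3 * C₂ ^ 5 := by positivity
    linarith
  refine ⟨Ca + Cb, by positivity, K, by positivity, fun N a r hN ha ha0 hr hrK => ?_⟩
  set m := (timeVol.prod (torusVol 1)).real (superlevel 1 a r) with hm
  have hm0 : 0 ≤ m := measureReal_nonneg
  have hN0 : 0 < N := by linarith
  set z : ℝ := (N ^ 2 * (r ^ 4)⁻¹) ^ (1 / 20 : ℝ) with hz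
  have hz0 : 0 < z := by positivity
  have hz20 : z ^ 20 = N ^ 2 * (r ^ 4)⁻¹ := by
    rw [hz, ← Real.rpow_natCast, ← Real.rpow_mul (by positivity)]; norm_num
  have hgoal : N ^ (7 / 5 : ℝ) * r ^ (-(44 / 5) : ℝ) = (r ^ 6)⁻¹ * z ^ 14 := by
    have h1 : z ^ 14 = N ^ (7 / 5 : ℝ) * r ^ (-(14 / 5) : ℝ) := by
      rw [hz, ← Real.rpow_natCast, ← Real.rpow_mul (by positivity),
        Real.mul_rpow (by positivity) (by positivity), ← Real.rpow_natCast N,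
        ← Real.rpow_natCast r, ← Real.rpow_neg hr.le, ← Real.rpow_mul hN0.le,
        ← Real.rpow_mul hr.le]
      norm_num
    rw [h1, ← Real.rpow_natCast r, ← Real.rpow_neg hr.le, mul_left_comm, ← Real.rpow_add hr]
    norm_num
  have hr20 : K ^ 20 * N ^ 6 ≤ r ^ 20 := by
    have h1 := pow_le_pow_left₀ (by positivity) hrK 20
    have h2 : (N ^ (3 / 10 : ℝ)) ^ 20 = N ^ 6 := by
      rw [← Real.rpow_natCast, ← Real.rpow_mul hN0.le, ← Real.rpow_natCast]; norm_num
    rwa [mul_pow, h2] at h1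
  have hrK' : K ≤ r := le_trans (le_mul_of_one_le_right (by positivity)
    (Real.one_le_rpow hN (by norm_num))) hrK
  rw [mul_assoc, hgoal]
  set P : ℝ := w * z with hP
  have hP0 : 0 < P := by positivity
  rcases lt_or_ge P (1 + C₃) with hPs | hPl
  · have h1 := hweak N a r hN ha ha0 hr
    have h2 : N ^ 2 * r ^ (-(2 + 8 / ((1 : ℕ) : ℝ)) : ℝ) = (r ^ 6)⁻¹ * z ^ 20 := by
      rw [hz20, show (-(2 + 8 / ((1 : ℕ) : ℝ)) : ℝ) = -((10 : ℕ) : ℝ) by norm_num,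
        Real.rpow_neg hr.le, Real.rpow_natCast]
      field_simp
    rw [mul_assoc, h2] at h1
    have h3 : z ≤ (1 + C₃) / w := by
      rw [le_div_iff₀ hw0]; linarith [mul_comm w z]
    calc m ≤ CA * z ^ 6 * ((r ^ 6)⁻¹ * z ^ 14) := h1.trans (le_of_eq (by ring))
      _ ≤ Ca * ((r ^ 6)⁻¹ * z ^ 14) := by rw [hCa]; gcongr
      _ ≤ (Ca + Cb) * ((r ^ 6)⁻¹ * z ^ 14) := by gcongr; linarith
  · have hP1 : 1 ≤ P := by linarith
    set κ := r ^ 2 / (4 * e) with hκ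
    have hκ0 : 0 < κ := by positivity
    set μ := κ / 2 with hμ
    have hμ0 : 0 < μ := by positivity
    set δ := C₂ * (r ^ 4)⁻¹ with hδd
    have hδ0 : 0 < δ := by positivity
    have hδeq : C₁ / μ ^ 2 = δ := by
      rw [hμ, hκ, hδd, hC₂]; field_simp; norm_num
    have hδeq' : C₁ / (P ^ 3 * μ) ^ 2 = δ / P ^ 6 := by
      rw [← hδeq]; field_simp
    have hδ1 : δ ≤ 1 := by
      rw [hδd, ← div_eq_mul_inv, div_le_one (by positivity)]
      have : 0 < C₃ ^ 2 * π ^ 3 * C₂ ^ 5 := by positivity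
      calc C₂ ≤ K := by linarith
        _ ≤ K ^ 4 := le_self_pow₀ hK1 (by norm_num)
        _ ≤ r ^ 4 := by gcongr
    have hδ1' : δ / P ^ 6 ≤ 1 := (div_le_self hδ0.le (one_le_pow₀ hP1)).trans hδ1
    obtain ⟨M₀, hM₀⟩ := hker N μ hN0 hμ0 (hδeq.le.trans hδ1)
    obtain ⟨M₁, hM₁⟩ := hker N (P ^ 3 * μ) hN0 (by positivity) (hδeq'.le.trans hδ1')
    rw [hδeq] at hM₀
    rw [hδeq'] at hM₁
    have hQ : π * N ^ 2 * δ = P ^ 20 := by rw [hP, mul_pow, hw20, hz20, hδd]; ring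
    have hD : π * N ^ 2 * (δ / P ^ 6) = P ^ 14 := by
      rw [← mul_div_assoc, hQ]; field_simp
    rw [hQ] at hM₀
    rw [hD] at hM₁
    obtain ⟨g, hg, hg1, hg0, hgm, hdual⟩ := exists_dualVec_superlevel hN ha ha0 hr
    set M := max (max M₀ M₁) ⌊N⌋₊ with hM
    have hd := hdual M (le_max_right _ _)
    have hbM₀ : M₀ ≤ M := (le_max_left _ _).trans (le_max_left _ _)
    have hbM₁ : M₁ ≤ M := (le_max_right _ _).trans (le_max_left _ _)
    set A : ℝ → ℝ := fun t => ∫ x, ‖g (t, x)‖ ∂(torusVol 1) with hA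
    have hA0 : ∀ t, 0 ≤ A t := fun t => integral_nonneg fun _ => norm_nonneg _
    set κ' := P ^ 3 * κ with hκ'
    have hfar : ∀ t s, t - s ∉ arcSet (P ^ 14) (δ / P ^ 6) →
        ‖inner ℂ (dualVec 1 (freqCube 1 M) (gaussWeight 1 N) g t)
          (dualVec 1 (freqCube 1 M) (gaussWeight 1 N) g s)‖ ≤ κ' * (A t * A s) := fun t s hts =>
      norm_inner_dualVec_gauss_le hg hg1 hg0 (fun t x h => (hM₁ M hbM₁ t x h).trans
        (le_of_eq (by rw [hκ', hμ]; ring))) hts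
    set c := C₃ * P * (δ ^ 2 * (P ^ 20) ^ 2 + δ * P ^ 20 / P ^ 14) with hc
    have hc0 : 0 ≤ c := by positivity
    have hT : ∀ h ∉ majorArcs (P ^ 14) (δ / P ^ 6),
        volume {σ : ℝ | σ ∈ Set.Icc (-2) 2 ∧ σ ∈ majorArcs (P ^ 20) δ ∧
          σ + h ∈ majorArcs (P ^ 20) δ} ≤ ENNReal.ofReal c := by
      intro h hh
      have h1 := hover (P ^ 20) δ (P ^ 14) h (one_le_pow₀ hP1) hδ0 (by positivity)
        (pow_le_pow_right₀ hP1 (by norm_num)) (by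
          rwa [show δ * P ^ 14 / P ^ 20 = δ / P ^ 6 by field_simp])
      have h2 : (P ^ 20) ^ (1 / 20 : ℝ) = P := by
        rw [← Real.rpow_natCast, ← Real.rpow_mul hP0.le]; norm_num
      rwa [h2] at h1
    set θ := 12 * π * P ^ 14 * δ with hθ
    have hθ0 : 0 < θ := by positivity
    have hmain := norm_integral_sq_le_of_overlap (ν := timeVol) (B := arcSet (P ^ 20) δ)
      (B' := arcSet (P ^ 14) (δ / P ^ 6)) (κ := κ) (ρ := π * c * κ')
      (β := 12 * π * P ^ 20 * δ) (β' := 12 * π * P ^ 14 * (δ / P ^ 6)) Measure.restrict_le_self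
      (measurable_dualVec (n := 1) (s := freqCube 1 M) (w := gaussWeight 1 N)
        hg).stronglyMeasurable
      (measurable_integral_norm_slice hg) hA0
      (integral_norm_slice_le hg1) hV0.le
      (norm_dualVec_sq_le (fun ξ => (gaussWeight_pos 1 N ξ).le) (gaussWeight_le_one 1 N) hg hg1)
      (measurableSet_arcSet _ δ)
      (fun t s hts => norm_inner_dualVec_gauss_le hg hg1 hg0
        (fun t x h => (hM₀ M hbM₀ t x h).trans (le_of_eq (by rw [hμ]; ring))) hts)
      hκ0.le (measurableSet_arcSet _ _) (by positivity)
      (volume_arcSet_le (by positivity) hδ0.le) (by positivity)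
      (volume_arcSet_le (by positivity) (by positivity)) (by positivity)
      (fun s s' hss => by
        by_cases hmem : (s - s') / π ∈ majorArcs (P ^ 14) (δ / P ^ 6)
        · have hz : ∀ t ∉ Set.Icc 0 (2 * π), A t = 0 := fun t ht => by simp [hA, hg0 t ht]
          have hAA : A s * A s' = 0 := by
            by_cases hs : s ∈ Set.Icc 0 (2 * π)
            · by_cases hs' : s' ∈ Set.Icc 0 (2 * π)
              · refine absurd ⟨hmem, ?_⟩ hss
                rw [Set.mem_Icc, le_div_iff₀ pi_pos, div_le_iff₀ pi_pos]
                exact ⟨by linarith [hs.1, hs'.2], by linarith [hs.2, hs'.1]⟩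
              · rw [hz s' hs', mul_zero]
            · rw [hz s hs, zero_mul]
          have h1 := hfar s s' hss
          rw [hAA, mul_zero] at h1
          rw [le_antisymm h1 (norm_nonneg _)]
          change _ ≤ _ * (A s * A s')
          rw [hAA]; simp
        · calc _ ≤ (π * c) * (κ' * (A s * A s')) := by
                refine mul_le_mul (timeVol_real_inter_arcSet_le hc0 hT hmem) (hfar s s' hss)
                  (norm_nonneg _) (by positivity)
            _ = π * c * κ' * (A s * A s') := by ring)
      hθ0
    rw [hgm] at hmain
    have hρθ : π * c * κ' ≤ κ * θ := by
      have h1 : δ * P ^ 30 * C₃ ≤ 6 := by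
        have h2 : (δ * P ^ 30 * C₃) ^ 2 ≤ 1 := by
          have h3 : (δ * P ^ 30 * C₃) ^ 2 = C₃ ^ 2 * π ^ 3 * C₂ ^ 5 * N ^ 6 / r ^ 20 := by
            have : (δ * P ^ 30 * C₃) ^ 2 = δ ^ 2 * (P ^ 20) ^ 3 * C₃ ^ 2 := by ring
            rw [this, ← hQ, hδd]
            field_simp
          rw [h3, div_le_one (by positivity)]
          refine le_trans ?_ hr20
          gcongr
          calc _ ≤ K := by linarith
            _ ≤ K ^ 20 := le_self_pow₀ hK1 (by norm_num)
        have := abs_le_of_sq_le_sq (a := δ * P ^ 30 * C₃) (b := 1) (by linarith) (by norm_num)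
        linarith [le_of_abs_le this]
      exact overlap_constant_le hP1 hδ0 hC₃ hκ0 (by linarith) h1
    have hββ : 12 * π * P ^ 20 * δ * (12 * π * P ^ 14 * (δ / P ^ 6)) = θ * θ := by
      rw [hθ]; field_simp
    calc m ≤ (r ^ 2)⁻¹ * (4 * e * V * θ) :=
          le_of_sq_mul_sq_le hr hm0 he0 hV0 hθ0 (by rw [hκ]; field_simp) hρθ hββ
            (hd.trans (mul_le_mul_of_nonneg_left hmain he0.le))
      _ = Cb * ((r ^ 6)⁻¹ * z ^ 14) := by
          rw [hθ, hP, hδd, hCb]; field_simp; ring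
      _ ≤ (Ca + Cb) * ((r ^ 6)⁻¹ * z ^ 14) := by gcongr; linarith

/-- A weak-type bound of order `r` and a uniform bound control all moments of order `p > r`. -/
lemma integral_rpow_le_of_measureReal_lt_le {α : Type*} [MeasurableSpace α] {μ : Measure α}
    [IsFiniteMeasure μ] {f : α → ℝ} {M G r p : ℝ} (hf : Measurable f) (h0 : ∀ x, 0 ≤ f x)
    (hM0 : 0 ≤ M) (hM : ∀ x, f x ≤ M) (hp : 0 < p) (hrp : r < p) (hG : 0 ≤ G)
    (h : ∀ t > 0, μ.real {x | t < f x} ≤ G * t ^ (-r)) :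
    ∫ x, f x ^ p ∂μ ≤ p / (p - r) * G * M ^ (p - r) := by
  have hpr : 0 < p - r := sub_pos.2 hrp
  rw [integral_eq_lintegral_of_nonneg_ae (.of_forall fun x => rpow_nonneg (h0 x) p)
    (hf.pow_const p).aestronglyMeasurable]
  refine ENNReal.toReal_le_of_le_ofReal (by positivity) ?_
  rw [lintegral_rpow_eq_lintegral_meas_lt_mul μ (.of_forall h0) hf.aemeasurable hp]
  have hint : IntervalIntegrable (fun t : ℝ => G * t ^ (p - r - 1)) volume 0 M :=
    (intervalIntegral.intervalIntegrable_rpow' (by linarith)).const_mul G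
  have hval : ∫ t in (0 : ℝ)..M, G * t ^ (p - r - 1) = G * (M ^ (p - r) / (p - r)) := by
    rw [intervalIntegral.integral_const_mul, integral_rpow (Or.inl (by linarith))]
    simp [Real.zero_rpow hpr.ne']
  have key : ∫⁻ t in Set.Ioi 0, μ {x | t < f x} * ENNReal.ofReal (t ^ (p - 1)) ≤
      ENNReal.ofReal (G * (M ^ (p - r) / (p - r))) := by
    rw [← hval, intervalIntegral.integral_of_le hM0, ofReal_integral_eq_lintegral_ofReal
      ((intervalIntegrable_iff_integrableOn_Ioc_of_le hM0).1 hint)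
      ((ae_restrict_mem measurableSet_Ioc).mono fun t ht =>
        mul_nonneg hG (rpow_nonneg (Set.mem_Ioc.1 ht).1.le _)),
      ← lintegral_indicator measurableSet_Ioi, ← lintegral_indicator measurableSet_Ioc]
    refine lintegral_mono fun t => ?_
    by_cases ht : 0 < t
    · rw [Set.indicator_of_mem (Set.mem_Ioi.2 ht)]
      by_cases htM : t ≤ M
      · rw [Set.indicator_of_mem (Set.mem_Ioc.2 ⟨ht, htM⟩), ← ofReal_measureReal,
          ← ENNReal.ofReal_mul measureReal_nonneg]
        refine ENNReal.ofReal_le_ofReal ?_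
        calc μ.real {x | t < f x} * t ^ (p - 1) ≤ G * t ^ (-r) * t ^ (p - 1) :=
              mul_le_mul_of_nonneg_right (h t ht) (rpow_nonneg ht.le _)
          _ = G * t ^ (p - r - 1) := by
              rw [mul_assoc, ← rpow_add ht]; ring_nf
      · have : {x | t < f x} = ∅ :=
          Set.eq_empty_of_forall_notMem fun x hx => htM ((le_of_lt hx).trans (hM x))
        simp [this]
    · rw [Set.indicator_of_notMem (by simpa using ht)]
      exact zero_le
  calc _ ≤ ENNReal.ofReal p * ENNReal.ofReal (G * (M ^ (p - r) / (p - r))) := by gcongr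
    _ = ENNReal.ofReal (p / (p - r) * G * M ^ (p - r)) := by
        rw [← ENNReal.ofReal_mul hp.le]; congr 1; field_simp

section Moments
variable {n : ℕ} {a : (Fin n → ℤ) →₀ ℂ} {N : ℝ}

lemma superlevel_eq (hl : 0 < l2Norm n a) (r : ℝ) :
    superlevel n a r = {q | r < ‖tWave n a q.1 q.2‖ / l2Norm n a} := by
  ext q; simp [superlevel, lt_div_iff₀ hl]

lemma measurable_norm_tWave_div : Measurable fun q : ℝ × (Fin n → ℝ) =>
    ‖tWave n a q.1 q.2‖ / l2Norm n a :=
  ((continuous_tWave n a).norm.div_const _).measurable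

lemma norm_tWave_div_le (hN : 1 ≤ N) (ha : ∀ ξ ∈ a.support, znorm n ξ ≤ N)
    (hl : 0 < l2Norm n a) (q : ℝ × (Fin n → ℝ)) :
    ‖tWave n a q.1 q.2‖ / l2Norm n a ≤ (3 * N) ^ ((n : ℝ) / 2) :=
  (div_le_iff₀ hl).2 (norm_tWave_le hN ha _ _)

end Moments

/-- Moments of a normalised free wave above the exponent `2 + 8 / n`. -/
lemma exists_integral_rpow_le (n : ℕ) (hn : 1 ≤ n) {p : ℝ} (hp : 2 + 8 / (n : ℝ) < p) :
    ∃ C > 0, ∀ (N : ℝ) (a : (Fin n → ℤ) →₀ ℂ), 1 ≤ N → (∀ ξ ∈ a.support, znorm n ξ ≤ N) →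
      0 < l2Norm n a →
      ∫ q, (‖tWave n a q.1 q.2‖ / l2Norm n a) ^ p ∂(timeVol.prod (torusVol n)) ≤
        C * N ^ ((n : ℝ) / 2 * p - (n + 2)) := by
  obtain ⟨C, hC, h⟩ := exists_real_superlevel_le n hn
  have hn0 : (0 : ℝ) < n := by exact_mod_cast hn
  have hp0 : 0 < p := lt_trans (by positivity) hp
  set r : ℝ := 2 + 8 / n with hr
  have hpr : 0 < p - r := sub_pos.2 hp
  refine ⟨p / (p - r) * C * 3 ^ ((n : ℝ) / 2 * (p - r)), by positivity, fun N a hN ha hl => ?_⟩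
  have hN0 : 0 < N := by linarith
  refine (integral_rpow_le_of_measureReal_lt_le (G := C * N ^ 2) measurable_norm_tWave_div
    (fun q => by positivity) (by positivity) (norm_tWave_div_le hN ha hl) hp0 hp (by positivity)
    fun t ht => ?_).trans_eq ?_
  · rw [← superlevel_eq hl]; exact h N a t hN ha hl ht
  · rw [← rpow_mul (by positivity), mul_rpow (by norm_num) hN0.le]
    have : N ^ ((n : ℝ) / 2 * p - (n + 2)) = N ^ 2 * N ^ ((n : ℝ) / 2 * (p - r)) := by
      rw [← rpow_natCast, ← rpow_add hN0]
      congr 1; rw [hr]; push_cast; field_simp; ring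
    rw [this]; ring

/-- The ninth moment of a normalised free wave in one space dimension. -/
lemma exists_integral_rpow_nine_le :
    ∃ C > 0, ∀ (N : ℝ) (a : (Fin 1 → ℤ) →₀ ℂ), 1 ≤ N → (∀ ξ ∈ a.support, znorm 1 ξ ≤ N) →
      0 < l2Norm 1 a →
      ∫ q, (‖tWave 1 a q.1 q.2‖ / l2Norm 1 a) ^ (9 : ℝ) ∂(timeVol.prod (torusVol 1)) ≤
        C * N ^ (3 / 2 : ℝ) := by
  obtain ⟨C, hC, K, hK, h⟩ := exists_real_superlevel_one_le
  refine ⟨K ^ 5 * (4 * (2 * π) ^ 2) + 9 / (9 - 44 / 5) * C * 3 ^ (1 / 10 : ℝ),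
    by positivity, fun N a hN ha hl => ?_⟩
  have hN0 : 0 < N := by linarith
  set ν := timeVol.prod (torusVol 1) with hν
  set f : ℝ × (Fin 1 → ℝ) → ℝ := fun q => ‖tWave 1 a q.1 q.2‖ / l2Norm 1 a with hf
  have hfm : Measurable f := measurable_norm_tWave_div
  have hf0 : ∀ q, 0 ≤ f q := fun q => by positivity
  have hfM : ∀ q, f q ≤ (3 * N) ^ (1 / 2 : ℝ) := fun q => by
    simpa using norm_tWave_div_le hN ha hl q
  set T := K * N ^ (3 / 10 : ℝ) with hT
  have hT0 : 0 < T := by positivity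
  have hint : ∀ {g : ℝ × (Fin 1 → ℝ) → ℝ} (_ : Measurable g) (B : ℝ) (_ : ∀ q, ‖g q‖ ≤ B),
      Integrable g ν := fun hg B hB =>
    .of_bound hg.aestronglyMeasurable B (.of_forall hB)
  set g : ℝ × (Fin 1 → ℝ) → ℝ := {q | T < f q}.indicator f with hg
  have hgm : Measurable g := hfm.indicator (measurableSet_lt measurable_const hfm)
  have hg0 : ∀ q, 0 ≤ g q := fun q => Set.indicator_nonneg (fun _ _ => hf0 _) q
  have hgf : ∀ q, g q ≤ f q := fun q => Set.indicator_le_self' (fun _ _ => hf0 _) q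
  have hgM : ∀ q, g q ≤ (3 * N) ^ (1 / 2 : ℝ) := fun q => (hgf q).trans (hfM q)
  have hhigh : ∫ q, g q ^ (9 : ℝ) ∂ν ≤
      9 / (9 - 44 / 5) * (C * N ^ (7 / 5 : ℝ)) * ((3 * N) ^ (1 / 2 : ℝ)) ^ (9 - 44 / 5 : ℝ) := by
    refine integral_rpow_le_of_measureReal_lt_le hgm hg0 (by positivity) hgM (by norm_num)
      (by norm_num) (by positivity) fun t ht => ?_
    have hsub : {q | t < g q} ⊆ superlevel 1 a (max t T) := fun q hq => by
      rw [superlevel_eq hl]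
      have hq' : t < g q := hq
      have hmem : q ∈ {q | T < f q} := by
        by_contra hc
        rw [hg, Set.indicator_of_notMem hc] at hq'
        linarith
      exact max_lt (hq'.trans_le (hgf q)) hmem
    refine (measureReal_mono hsub).trans ((h N a _ hN ha hl (by positivity)
      (le_max_right _ _)).trans ?_)
    refine mul_le_mul_of_nonneg_left ?_ (by positivity)
    exact rpow_le_rpow_of_nonpos ht (le_max_left _ _) (by norm_num)
  have hlow : ∫ q, T ^ 5 * f q ^ 4 ∂ν ≤ T ^ 5 * (4 * (2 * π) ^ 2) := by
    rw [integral_const_mul]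
    refine mul_le_mul_of_nonneg_left ?_ (by positivity)
    simp only [hf, div_pow]
    rw [integral_div, div_le_iff₀ (by positivity)]
    exact integral_norm_tWave_one_pow_four_le a
  have hpt : ∀ q, f q ^ (9 : ℝ) ≤ T ^ 5 * f q ^ 4 + g q ^ (9 : ℝ) := fun q => by
    by_cases hq : T < f q
    · have : g q = f q := Set.indicator_of_mem (s := {q | T < f q}) hq f
      rw [this]
      have := hf0 q
      have : 0 ≤ T ^ 5 * f q ^ 4 := by positivity
      linarith
    · have h9 : f q ^ (9 : ℝ) = f q ^ 5 * f q ^ 4 := by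
        rw [← pow_add]; exact_mod_cast rpow_natCast (f q) 9
      have := pow_le_pow_left₀ (hf0 q) (not_lt.1 hq) 5
      have h2 := mul_le_mul_of_nonneg_right this (pow_nonneg (hf0 q) 4)
      exact h9.trans_le (h2.trans (le_add_of_nonneg_right (rpow_nonneg (hg0 q) 9)))
  have hi1 : Integrable (fun q => T ^ 5 * f q ^ 4) ν :=
    (hint (hfm.pow_const 4) (((3 * N) ^ (1 / 2 : ℝ)) ^ 4) fun q => by
      rw [norm_of_nonneg (pow_nonneg (hf0 q) 4)]
      exact pow_le_pow_left₀ (hf0 q) (hfM q) 4).const_mul _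
  have hi2 : Integrable (fun q => g q ^ (9 : ℝ)) ν :=
    hint (hgm.pow_const 9) (((3 * N) ^ (1 / 2 : ℝ)) ^ (9 : ℝ)) fun q => by
      rw [norm_of_nonneg (rpow_nonneg (hg0 q) 9)]
      exact rpow_le_rpow (hg0 q) (hgM q) (by norm_num)
  have hi0 : Integrable (fun q => f q ^ (9 : ℝ)) ν :=
    hint (hfm.pow_const 9) (((3 * N) ^ (1 / 2 : ℝ)) ^ (9 : ℝ)) fun q => by
      rw [norm_of_nonneg (rpow_nonneg (hf0 q) 9)]
      exact rpow_le_rpow (hf0 q) (hfM q) (by norm_num)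
  have hT5 : T ^ 5 = K ^ 5 * N ^ (3 / 2 : ℝ) := by
    rw [hT, mul_pow, ← rpow_natCast (N ^ (3 / 10 : ℝ)), ← rpow_mul hN0.le]; norm_num
  have hN32 : N ^ (7 / 5 : ℝ) * ((3 * N) ^ (1 / 2 : ℝ)) ^ (9 - 44 / 5 : ℝ) =
      3 ^ (1 / 10 : ℝ) * N ^ (3 / 2 : ℝ) := by
    rw [← rpow_mul (by positivity), mul_rpow (by norm_num) hN0.le, mul_left_comm, ← rpow_add hN0]
    norm_num
  calc ∫ q, f q ^ (9 : ℝ) ∂ν ≤ ∫ q, (T ^ 5 * f q ^ 4 + g q ^ (9 : ℝ)) ∂ν :=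
        integral_mono hi0 (hi1.add hi2) hpt
    _ = ∫ q, T ^ 5 * f q ^ 4 ∂ν + ∫ q, g q ^ (9 : ℝ) ∂ν := integral_add hi1 hi2
    _ ≤ _ := add_le_add hlow hhigh
    _ = _ := by
        rw [hT5]
        linear_combination (9 / (9 - 44 / 5) * C) * hN32

/-- Moments of order at least nine of a normalised free wave in one space dimension. -/
lemma exists_integral_rpow_one_le {p : ℝ} (hp : 9 ≤ p) :
    ∃ C > 0, ∀ (N : ℝ) (a : (Fin 1 → ℤ) →₀ ℂ), 1 ≤ N → (∀ ξ ∈ a.support, znorm 1 ξ ≤ N) →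
      0 < l2Norm 1 a →
      ∫ q, (‖tWave 1 a q.1 q.2‖ / l2Norm 1 a) ^ p ∂(timeVol.prod (torusVol 1)) ≤
        C * N ^ (1 / 2 * p - 3) := by
  obtain ⟨C, hC, h⟩ := exists_integral_rpow_nine_le
  refine ⟨C * 3 ^ (1 / 2 * (p - 9)), by positivity, fun N a hN ha hl => ?_⟩
  have hN0 : 0 < N := by linarith
  set ν := timeVol.prod (torusVol 1) with hν
  set f : ℝ × (Fin 1 → ℝ) → ℝ := fun q => ‖tWave 1 a q.1 q.2‖ / l2Norm 1 a with hf
  have hfm : Measurable f := measurable_norm_tWave_div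
  have hf0 : ∀ q, 0 ≤ f q := fun q => by positivity
  set M := (3 * N) ^ (1 / 2 : ℝ) with hM
  have hfM : ∀ q, f q ≤ M := fun q => by simpa [hM] using norm_tWave_div_le hN ha hl q
  have hint : ∀ s : ℝ, 0 ≤ s → Integrable (fun q => f q ^ s) ν := fun s hs =>
    .of_bound (hfm.pow_const s).aestronglyMeasurable (M ^ s) <| .of_forall fun q => by
      rw [norm_of_nonneg (rpow_nonneg (hf0 q) s)]
      exact rpow_le_rpow (hf0 q) (hfM q) hs
  calc ∫ q, f q ^ p ∂ν ≤ ∫ q, M ^ (p - 9) * f q ^ (9 : ℝ) ∂ν := by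
        refine integral_mono (hint p (by linarith)) ((hint 9 (by norm_num)).const_mul _)
          fun q => ?_
        have : f q ^ p = f q ^ (p - 9) * f q ^ (9 : ℝ) := by
          rw [← rpow_add_of_nonneg (hf0 q) (by linarith) (by norm_num), sub_add_cancel]
        simp only [this]
        exact mul_le_mul_of_nonneg_right (rpow_le_rpow (hf0 q) (hfM q) (by linarith))
          (rpow_nonneg (hf0 q) _)
    _ ≤ M ^ (p - 9) * (C * N ^ (3 / 2 : ℝ)) := by
        rw [integral_const_mul]
        exact mul_le_mul_of_nonneg_left (h N a hN ha hl) (by positivity)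
    _ = _ := by
        rw [hM, ← rpow_mul (by positivity), mul_rpow (by norm_num) hN0.le,
          show 1 / 2 * p - 3 = 1 / 2 * (p - 9) + 3 / 2 by ring, rpow_add hN0]
        ring

/-- A moment bound for normalised free waves gives the Strichartz estimate. -/
lemma exists_boxLpNorm_le_of_integral_rpow_le {n : ℕ} {p s : ℝ} (hp : 0 < p)
    (h : ∃ C > 0, ∀ (N : ℝ) (a : (Fin n → ℤ) →₀ ℂ), 1 ≤ N → (∀ ξ ∈ a.support, znorm n ξ ≤ N) →
      0 < l2Norm n a →
      ∫ q, (‖tWave n a q.1 q.2‖ / l2Norm n a) ^ p ∂(timeVol.prod (torusVol n)) ≤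
        C * N ^ (s * p)) :
    ∃ C > 0, ∀ N : ℝ, 1 ≤ N → ∀ a : (Fin n → ℤ) →₀ ℂ, (∀ ξ ∈ a.support, znorm n ξ ≤ N) →
      boxLpNorm n p (tWave n a) ≤ C * N ^ s * l2Norm n a := by
  obtain ⟨C, hC, h⟩ := h
  refine ⟨C ^ (1 / p), by positivity, fun N hN a ha => ?_⟩
  have hN0 : 0 < N := by linarith
  have hl0 : 0 ≤ l2Norm n a := Real.sqrt_nonneg _
  rw [boxLpNorm, volume_restrict_stBox]
  rcases hl0.eq_or_lt with hl | hl
  · have hu : ∀ t x, ‖tWave n a t x‖ = 0 := fun t x => by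
      have := norm_tWave_le hN ha t x
      rw [← hl, mul_zero] at this
      exact le_antisymm this (norm_nonneg _)
    simp [hu, ← hl, zero_rpow hp.ne', hp.ne']
  · have heq : ∀ q : ℝ × (Fin n → ℝ), ‖tWave n a q.1 q.2‖ ^ p =
        l2Norm n a ^ p * (‖tWave n a q.1 q.2‖ / l2Norm n a) ^ p := fun q => by
      rw [← mul_rpow hl0 (by positivity), mul_div_cancel₀ _ hl.ne']
    simp only [heq]
    rw [integral_const_mul]
    calc _ ≤ (l2Norm n a ^ p * (C * N ^ (s * p))) ^ (1 / p) := by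
          refine rpow_le_rpow (mul_nonneg (by positivity)
            (integral_nonneg fun q => by positivity)) ?_ (by positivity)
          exact mul_le_mul_of_nonneg_left (h N a hN ha hl) (by positivity)
      _ = C ^ (1 / p) * N ^ s * l2Norm n a := by
          rw [mul_rpow (by positivity) (by positivity), mul_rpow hC.le (by positivity),
            ← rpow_mul hl0, ← rpow_mul hN0.le, mul_one_div_cancel hp.ne', rpow_one,
            mul_assoc s, mul_one_div_cancel hp.ne', mul_one]
          ring

/-- Strichartz estimate at the scaling-critical exponent `p = (n+2)k`. -/
theorem strichartz_critical_exponent (n k : ℕ) (h : AdmissibleNL n k) (hk : 2 ≤ k) :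
    ∃ C > 0, ∀ N : ℝ, 1 ≤ N → ∀ a : (Fin n → ℤ) →₀ ℂ,
      (∀ ξ ∈ a.support, znorm n ξ ≤ N) →
      boxLpNorm n (((n : ℝ) + 2) * k) (tWave n a) ≤
        C * N ^ ((n : ℝ) / 2 - 1 / (k : ℝ)) * l2Norm n a := by
  have hk2 : (2 : ℝ) ≤ k := by exact_mod_cast hk
  have hp : 0 < ((n : ℝ) + 2) * k := by positivity
  refine exists_boxLpNorm_le_of_integral_rpow_le hp ?_
  have hs : ((n : ℝ) / 2 - 1 / (k : ℝ)) * (((n : ℝ) + 2) * k) =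
      (n : ℝ) / 2 * (((n : ℝ) + 2) * k) - (n + 2) := by
    field_simp
  rw [hs]
  by_cases hn : n = 1
  · subst hn
    have hk3 : (3 : ℝ) ≤ k := by
      have : 3 ≤ k := by unfold AdmissibleNL at h; omega
      exact_mod_cast this
    convert exists_integral_rpow_one_le (p := (((1 : ℕ) : ℝ) + 2) * k) ?_ using 9
    · norm_num
    · push_cast; linarith
  · have hn2 : 2 ≤ n := by unfold AdmissibleNL at h; omega
    have hn2' : (2 : ℝ) ≤ n := by exact_mod_cast hn2
    refine exists_integral_rpow_le n (by omega) ?_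
    have h8 : 8 / (n : ℝ) ≤ 4 := by
      rw [div_le_iff₀ (by linarith)]; linarith
    nlinarith
end

section
/- (Quadratic localization of frequencies in a strip.) Let n ≥ 1. For every ξ₀ ∈ ℝⁿ with ξ₀ ≠ 0, all reals M > 0 and N > 0, every integer l ≥ 1 with N² ≤ M²·l, and every ξ ∈ ℝⁿ satisfying max_{1≤i≤n} |ξ_i − (ξ₀)_i| ≤ N and |ξ₀|·M·l ≤ ξ·ξ₀ ≤ |ξ₀|·M·(l+1), one has | |ξ|² − M²l² | ≤ (n+3)·M²·l, where |ξ| denotes the Euclidean norm and ξ·ξ₀ the Euclidean inner product. -/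
open Finset

/-- quadratic localization of frequencies in a strip. A frequency `ξ` lying in
the cube of side `2N` centered at `ξ₀` and in the `l`-th strip (orthogonal to `ξ₀`, of width
`M`) satisfies `|ξ|² = M²l² + O(M²l)`, provided `N² ≤ M²l`. -/
theorem strip_quadratic_localization (n : ℕ) (hn : 1 ≤ n) (ξ₀ : Fin n → ℝ) (hξ₀ : ξ₀ ≠ 0)
    (M N : ℝ) (hM : 0 < M) (hN : 0 < N) (l : ℤ) (hl : 1 ≤ l)
    (hNl : N ^ 2 ≤ M ^ 2 * (l : ℝ)) (ξ : Fin n → ℝ)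
    (hcube : ∀ i, |ξ i - ξ₀ i| ≤ N)
    (hlo : Real.sqrt (∑ i, ξ₀ i ^ 2) * M * (l : ℝ) ≤ ∑ i, ξ i * ξ₀ i)
    (hhi : ∑ i, ξ i * ξ₀ i ≤ Real.sqrt (∑ i, ξ₀ i ^ 2) * M * ((l : ℝ) + 1)) :
    |(∑ i, ξ i ^ 2) - M ^ 2 * (l : ℝ) ^ 2| ≤ ((n : ℝ) + 3) * M ^ 2 * (l : ℝ) := by
  set r := Real.sqrt (∑ i, ξ₀ i ^ 2)
  have hpos : 0 < ∑ i, ξ₀ i ^ 2 := by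
    obtain ⟨i, hi⟩ := Function.ne_iff.mp hξ₀
    exact Finset.sum_pos' (fun j _ => sq_nonneg _) ⟨i, Finset.mem_univ i, sq_pos_of_ne_zero hi⟩
  have hr0 : 0 < r := Real.sqrt_pos.mpr hpos
  have hr2 : r ^ 2 = ∑ i, ξ₀ i ^ 2 := Real.sq_sqrt hpos.le
  have hdist : ∑ i, (ξ i - ξ₀ i) ^ 2 ≤ n * N ^ 2 := by
    calc ∑ i, (ξ i - ξ₀ i) ^ 2 ≤ ∑ _i : Fin n, N ^ 2 :=
          Finset.sum_le_sum fun i _ => sq_le_sq' (abs_le.mp (hcube i)).1 (abs_le.mp (hcube i)).2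
      _ = n * N ^ 2 := by simp
  have hexp : ∑ i, (ξ i - ξ₀ i) ^ 2 = ∑ i, ξ i ^ 2 - 2 * ∑ i, ξ i * ξ₀ i + r ^ 2 := by
    rw [hr2, Finset.mul_sum, ← Finset.sum_sub_distrib, ← Finset.sum_add_distrib]
    exact Finset.sum_congr rfl fun i _ => by ring
  have hcs := Finset.sum_mul_sq_le_sq_mul_sq Finset.univ ξ ξ₀
  rw [← hr2] at hcs
  obtain ⟨t, ht⟩ : ∃ t, ∑ i, ξ i * ξ₀ i = r * t := ⟨(∑ i, ξ i * ξ₀ i) / r, by field_simp⟩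
  rw [ht] at hlo hhi hcs hexp
  have hl1 : (1 : ℝ) ≤ l := by exact_mod_cast hl
  have htlo : M * l ≤ t := le_of_mul_le_mul_left (by linarith) hr0
  have hthi : t ≤ M * (l + 1) := le_of_mul_le_mul_left (by linarith) hr0
  have htA : t ^ 2 ≤ ∑ i, ξ i ^ 2 :=
    le_of_mul_le_mul_left (by linarith [mul_pow r t 2]) (pow_pos hr0 2)
  have hAt : ∑ i, ξ i ^ 2 - t ^ 2 ≤ n * N ^ 2 := by nlinarith [sq_nonneg (t - r)]
  have hnN : (n : ℝ) * N ^ 2 ≤ n * (M ^ 2 * l) := by gcongr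
  have hMl : 0 ≤ M * (l : ℝ) := by positivity
  have hsqlo : (M * (l : ℝ)) ^ 2 ≤ t ^ 2 := pow_le_pow_left₀ hMl htlo 2
  have hsqhi : t ^ 2 ≤ (M * ((l : ℝ) + 1)) ^ 2 := pow_le_pow_left₀ (hMl.trans htlo) hthi 2
  have hM2 : M ^ 2 ≤ M ^ 2 * (l : ℝ) := le_mul_of_one_le_right (sq_nonneg M) hl1
  rw [abs_of_nonneg (by linarith [mul_pow M (l : ℝ) 2])]
  linarith
end
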